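/- arXiv:2204.00412 — 2 statements merged into one kernel-verified Lean document; each statement's English description precedes it below -/
import Mathlib

section
/- There exists a multiplicative basis A of order 2 for ℤ⁺ (A ∈ MB_2) such that limsup_{x→∞} A(x) · (log x)^{1/2} / x = 2/√π. -/
open Filter Real

/-- Counting function: `A(x) = |A ∩ {1,…,⌊x⌋}|`. -/
noncomputable def cntF (A : Set ℕ) (x : ℝ) : ℕ := (A ∩ Set.Icc 1 ⌊x⌋₊).ncard

/-- Multiplicative representation function of order `h`. -/
noncomputable def mulRep (h : ℕ) (A : Set ℕ) (n : ℕ) : ℕ :=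
  {f : Fin h → ℕ | (∀ i, f i ∈ A) ∧ ∏ i, f i = n}.ncard

/-- `A` is a multiplicative basis of order `h` for `ℤ⁺`. -/
def IsMB (h : ℕ) (A : Set ℕ) : Prop := ∀ n : ℕ, 1 ≤ n → 1 ≤ mulRep h A n

section

open Finset

open ArithmeticFunction (vonMangoldt_nonneg vonMangoldt_sum)

open scoped ArithmeticFunction.vonMangoldt ArithmeticFunction.Moebius Topology

section FiniteSums

/-- Reordering a sum over divisor pairs of the integers up to `N`. -/
theorem sum_Ioc_sum_divisorsAntidiagonal (N : ℕ) (F : ℕ → ℕ → ℝ) :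
    ∑ n ∈ Ioc 0 N, ∑ x ∈ n.divisorsAntidiagonal, F x.1 x.2 =
      ∑ a ∈ Ioc 0 N, ∑ b ∈ Ioc 0 (N / a), F a b := by
  rw [Finset.sum_sigma', Finset.sum_sigma']
  refine Finset.sum_bij' (fun x _ => ⟨x.2.1, x.2.2⟩) (fun y _ => ⟨y.1 * y.2, (y.1, y.2)⟩)
    ?_ ?_ ?_ ?_ ?_
  · rintro ⟨n, a, b⟩ h
    simp only [mem_sigma, mem_Ioc, Nat.mem_divisorsAntidiagonal] at h ⊢
    obtain ⟨⟨h1, h2⟩, rfl, h3⟩ := h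
    have ha : 0 < a := Nat.pos_of_ne_zero (by rintro rfl; simp at h3)
    have hb : 0 < b := Nat.pos_of_ne_zero (by rintro rfl; simp at h3)
    refine ⟨⟨ha, le_trans (Nat.le_mul_of_pos_right a hb) h2⟩, hb, ?_⟩
    rw [Nat.le_div_iff_mul_le ha, mul_comm]; exact h2
  · rintro ⟨a, b⟩ h
    simp only [mem_sigma, mem_Ioc, Nat.mem_divisorsAntidiagonal] at h ⊢
    obtain ⟨⟨h1, h2⟩, h3, h4⟩ := h
    rw [Nat.le_div_iff_mul_le h1] at h4
    exact ⟨⟨by positivity, by rwa [mul_comm]⟩, trivial, by positivity⟩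
  · rintro ⟨n, a, b⟩ h
    simp only [mem_sigma, mem_Ioc, Nat.mem_divisorsAntidiagonal] at h
    obtain ⟨⟨h1, h2⟩, rfl, h3⟩ := h
    rfl
  · rintro ⟨a, b⟩ h
    rfl
  · rintro ⟨n, a, b⟩ h
    rfl

/-- The order of summation in a hyperbola sum can be exchanged. -/
theorem sum_Ioc_sum_Ioc_div_comm (N : ℕ) (F : ℕ → ℕ → ℝ) :
    ∑ a ∈ Ioc 0 N, ∑ b ∈ Ioc 0 (N / a), F a b = ∑ b ∈ Ioc 0 N, ∑ a ∈ Ioc 0 (N / b), F a b := by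
  rw [← sum_Ioc_sum_divisorsAntidiagonal, ← sum_Ioc_sum_divisorsAntidiagonal N (fun b a => F a b)]
  refine Finset.sum_congr rfl fun n _ => ?_
  exact Nat.sum_divisorsAntidiagonal' F |>.trans
    (Nat.sum_divisorsAntidiagonal (fun b a => F a b)).symm

theorem sum_Ioc_mul_le_of_antitone {c d h : ℕ → ℝ} {N : ℕ}
    (hcd : ∀ n ≤ N, ∑ k ∈ Ioc 0 n, c k ≤ ∑ k ∈ Ioc 0 n, d k)
    (hh : ∀ n, 1 ≤ n → n < N → h (n + 1) ≤ h n) (h0 : 0 ≤ h N) :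
    ∑ k ∈ Ioc 0 N, c k * h k ≤ ∑ k ∈ Ioc 0 N, d k * h k := by
  have key : ∀ n ≤ N, (∑ k ∈ Ioc 0 n, d k - ∑ k ∈ Ioc 0 n, c k) * h n ≤
      ∑ k ∈ Ioc 0 n, d k * h k - ∑ k ∈ Ioc 0 n, c k * h k := by
    intro n
    induction n with
    | zero => simp
    | succ n ih =>
      intro hn
      have ih := ih (by lia)
      have hE := hcd n (by lia)
      simp only [Finset.sum_Ioc_succ_top (Nat.zero_le n)]
      rcases Nat.eq_zero_or_pos n with rfl | hpos
      · simp; linarith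
      · have := hh n hpos (by lia)
        nlinarith
  have := key N le_rfl
  have h2 := mul_nonneg (sub_nonneg.2 (hcd N le_rfl)) h0
  linarith

theorem abs_sum_Ioc_mul_le_of_antitone {c d h : ℕ → ℝ} {N : ℕ}
    (hcd : ∀ n ≤ N, |∑ k ∈ Ioc 0 n, c k| ≤ ∑ k ∈ Ioc 0 n, d k)
    (hh : ∀ n, 1 ≤ n → n < N → h (n + 1) ≤ h n) (h0 : 0 ≤ h N) :
    |∑ k ∈ Ioc 0 N, c k * h k| ≤ ∑ k ∈ Ioc 0 N, d k * h k := by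
  rw [abs_le]
  constructor
  · have := sum_Ioc_mul_le_of_antitone (c := fun k => - c k) (d := d) (h := h) (N := N)
      (fun n hn => by
        rw [Finset.sum_neg_distrib]; exact (neg_le_abs _).trans (hcd n hn)) hh h0
    simp only [neg_mul, Finset.sum_neg_distrib] at this
    linarith
  · exact sum_Ioc_mul_le_of_antitone (fun n hn => (le_abs_self _).trans (hcd n hn)) hh h0

theorem abs_sum_Ioc_mul_le_of_monotone {c h : ℕ → ℝ} {N : ℕ} {B : ℝ}
    (hc : ∀ n ≤ N, |∑ k ∈ Ioc 0 n, c k| ≤ B)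
    (hh : ∀ n, 1 ≤ n → n < N → h n ≤ h (n + 1)) (h0 : 0 ≤ h 1) (hN : 1 ≤ N) :
    |∑ k ∈ Ioc 0 N, c k * h k| ≤ 2 * B * h N := by
  have hB : 0 ≤ B := (abs_nonneg _).trans (hc 0 (Nat.zero_le _))
  have key : ∀ n, 1 ≤ n → n ≤ N →
      |∑ k ∈ Ioc 0 n, c k * h k - (∑ k ∈ Ioc 0 n, c k) * h n| ≤ B * (h n - h 1) ∧ 0 ≤ h n := by
    intro n hn
    induction n, hn using Nat.le_induction with
    | base => intro _; simp [h0]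
    | succ n hn ih =>
      intro hnN
      obtain ⟨ih, ih0⟩ := ih (by lia)
      have h1 := hh n hn (by lia)
      have hC := hc n (by lia)
      refine ⟨?_, ih0.trans h1⟩
      simp only [Finset.sum_Ioc_succ_top (Nat.zero_le n)]
      have e : ∑ k ∈ Ioc 0 n, c k * h k + c (n + 1) * h (n + 1)
          - (∑ k ∈ Ioc 0 n, c k + c (n + 1)) * h (n + 1) =
          (∑ k ∈ Ioc 0 n, c k * h k - (∑ k ∈ Ioc 0 n, c k) * h n)
          - (∑ k ∈ Ioc 0 n, c k) * (h (n + 1) - h n) := by ring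
      rw [e]
      refine (abs_sub _ _).trans ?_
      rw [abs_mul, abs_of_nonneg (sub_nonneg.2 h1)]
      have := mul_le_mul_of_nonneg_right hC (sub_nonneg.2 h1)
      linarith
  obtain ⟨h1, h2⟩ := key N hN le_rfl
  have h3 : |(∑ k ∈ Ioc 0 N, c k) * h N| ≤ B * h N := by
    rw [abs_mul, abs_of_nonneg h2]
    exact mul_le_mul_of_nonneg_right (hc N le_rfl) h2
  have h4 := abs_add_le (∑ k ∈ Ioc 0 N, c k * h k - (∑ k ∈ Ioc 0 N, c k) * h N)
    ((∑ k ∈ Ioc 0 N, c k) * h N)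
  rw [sub_add_cancel] at h4
  have := mul_nonneg hB h0
  linarith

theorem sum_Ioc_inv_sqrt_le (n : ℕ) : ∑ k ∈ Ioc 0 n, 1 / √(k : ℝ) ≤ 2 * √(n : ℝ) := by
  induction n with
  | zero => simp
  | succ n ih =>
    rw [Finset.sum_Ioc_succ_top (Nat.zero_le n)]
    push_cast
    have ha : 0 ≤ √(n : ℝ) := sqrt_nonneg _
    have hb : 0 < √((n : ℝ) + 1) := sqrt_pos.2 (by positivity)
    have e1 := sq_sqrt (Nat.cast_nonneg (α := ℝ) n)
    have e2 := sq_sqrt (show (0 : ℝ) ≤ (n : ℝ) + 1 by positivity)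
    have : 1 / √((n : ℝ) + 1) ≤ 2 * √((n : ℝ) + 1) - 2 * √(n : ℝ) := by
      rw [div_le_iff₀ hb]
      nlinarith [sq_nonneg (√((n : ℝ) + 1) - √(n : ℝ))]
    linarith

theorem sqrt_le_sum_Ioc_inv_sqrt (n : ℕ) : √(n : ℝ) ≤ ∑ k ∈ Ioc 0 n, 1 / √(k : ℝ) := by
  rcases Nat.eq_zero_or_pos n with rfl | hn
  · simp
  calc √(n : ℝ) = ∑ k ∈ Ioc 0 n, 1 / √(n : ℝ) := by
        have hs : 0 < √(n : ℝ) := sqrt_pos.2 (by positivity)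
        rw [Finset.sum_const, Nat.card_Ioc, nsmul_eq_mul, Nat.sub_zero]
        field_simp
        exact sq_sqrt (Nat.cast_nonneg (α := ℝ) n)
    _ ≤ _ := by
        refine Finset.sum_le_sum fun k hk => ?_
        rw [mem_Ioc] at hk
        have : (0 : ℝ) < k := by exact_mod_cast hk.1
        have h2 : (k : ℝ) ≤ n := by exact_mod_cast hk.2
        gcongr

theorem sum_Ioc_inv_mul_sqrt_le (n : ℕ) : ∑ k ∈ Ioc 0 n, 1 / √(k : ℝ) * (1 / (k : ℝ)) ≤ 3 := by
  suffices h : ∀ n : ℕ, 1 ≤ n →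
      ∑ k ∈ Ioc 0 n, 1 / √(k : ℝ) * (1 / (k : ℝ)) ≤ 3 - 2 / √(n : ℝ) by
    rcases Nat.eq_zero_or_pos n with rfl | hn
    · simp
    · have := h n hn
      have h2 : 0 ≤ 2 / √(n : ℝ) := by positivity
      linarith
  intro n hn
  induction n, hn using Nat.le_induction with
  | base => norm_num
  | succ n hn ih =>
    rw [Finset.sum_Ioc_succ_top (Nat.zero_le n)]
    push_cast
    have hn0 : (0 : ℝ) < n := by exact_mod_cast hn
    have ha : 0 < √(n : ℝ) := sqrt_pos.2 hn0
    have hb : 0 < √((n : ℝ) + 1) := sqrt_pos.2 (by positivity)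
    have e1 := sq_sqrt hn0.le
    have e2 := sq_sqrt (show (0 : ℝ) ≤ (n : ℝ) + 1 by positivity)
    set a := √(n : ℝ)
    set b := √((n : ℝ) + 1)
    have hab : a ≤ b := sqrt_le_sqrt (by linarith)
    have : 1 / b * (1 / ((n : ℝ) + 1)) ≤ 2 / a - 2 / b := by
      rw [← e2, div_sub_div _ _ ha.ne' hb.ne', div_mul_div_comm, div_le_div_iff₀ (by positivity)
        (by positivity)]
      have h1 : (b - a) * (b + a) = 1 := by linear_combination e2 - e1
      have h2 : 1 ≤ (b - a) * (2 * b) := by nlinarith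
      have h3 : 1 * 1 * (a * b) ≤ ((b - a) * (2 * b)) * (a * b) := by
        have : 0 < a * b := by positivity
        nlinarith
      refine h3.trans ?_
      have : 0 ≤ (b - a) * 2 * b ^ 2 * (b - a) := by
        have : 0 ≤ b - a := by linarith
        positivity
      nlinarith
    linarith

theorem abs_sum_Ioc_div_le_of_sqrt {c : ℕ → ℝ} {B : ℝ}
    (hc : ∀ n : ℕ, |∑ k ∈ Ioc 0 n, c k| ≤ B * √(n : ℝ)) (N : ℕ) :
    |∑ k ∈ Ioc 0 N, c k * (1 / (k : ℝ))| ≤ 3 * B := by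
  have hB : 0 ≤ B := by simpa using (abs_nonneg _).trans (hc 1)
  have := abs_sum_Ioc_mul_le_of_antitone (c := c) (d := fun k => B * (1 / √(k : ℝ)))
    (h := fun k => 1 / (k : ℝ)) (N := N)
    (fun n _ => by
      rw [← Finset.mul_sum]
      exact (hc n).trans (mul_le_mul_of_nonneg_left (sqrt_le_sum_Ioc_inv_sqrt n) hB))
    (fun n hn _ => by
      have : (0 : ℝ) < n := by exact_mod_cast hn
      gcongr
      linarith [Nat.cast_add_one (R := ℝ) n])
    (by positivity)
  refine this.trans ?_
  simp only [mul_assoc, ← Finset.mul_sum]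
  have := mul_le_mul_of_nonneg_left (sum_Ioc_inv_mul_sqrt_le N) hB
  linarith

end FiniteSums

section Mertens

theorem sum_Ioc_vonMangoldt_le (n : ℕ) : ∑ k ∈ Ioc 0 n, Λ k ≤ 6 * (n : ℝ) := by
  have h := Chebyshev.psi_le_const_mul_self (x := n) (Nat.cast_nonneg n)
  rw [Chebyshev.psi, Nat.floor_natCast] at h
  refine h.trans ?_
  have : log 4 ≤ 2 := by
    rw [show (4 : ℝ) = 2 ^ 2 by norm_num, Real.log_pow]
    have := Real.log_two_lt_d9
    push_cast; linarith
  have h0 : (0 : ℝ) ≤ n := Nat.cast_nonneg n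
  nlinarith

/-- `log n! = n log n - n + O(1 + log n)`. -/
theorem sum_Ioc_log_bounds (n : ℕ) (hn : 1 ≤ n) :
    n * log n - n ≤ ∑ k ∈ Ioc 0 n, log (k : ℝ) ∧
      ∑ k ∈ Ioc 0 n, log (k : ℝ) ≤ n * log n - n + 1 + log n := by
  induction n, hn using Nat.le_induction with
  | base => norm_num
  | succ n hn ih =>
    have hn0 : (0 : ℝ) < n := by exact_mod_cast hn
    rw [Finset.sum_Ioc_succ_top (Nat.zero_le n)]
    push_cast
    have h1 : log ((n : ℝ) + 1) - log n ≤ 1 / n := by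
      rw [← log_div (by positivity) (by positivity)]
      refine (log_le_sub_one_of_pos (by positivity)).trans (le_of_eq ?_)
      field_simp; ring
    have h2 : 1 / ((n : ℝ) + 1) ≤ log ((n : ℝ) + 1) - log n := by
      rw [← log_div (by positivity) (by positivity)]
      refine le_trans (le_of_eq ?_) (one_sub_inv_le_log_of_pos (by positivity))
      field_simp; ring
    have h3 : n * (log ((n : ℝ) + 1) - log n) ≤ 1 := by
      rw [le_div_iff₀ hn0] at h1; linarith
    have h4 : 1 ≤ (n + 1) * (log ((n : ℝ) + 1) - log n) := by
      rw [div_le_iff₀ (by positivity)] at h2; linarith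
    constructor <;> nlinarith [ih.1, ih.2]

theorem sum_Ioc_vonMangoldt_mul_div (N : ℕ) :
    ∑ k ∈ Ioc 0 N, Λ k * ((N / k : ℕ) : ℝ) = ∑ n ∈ Ioc 0 N, log (n : ℝ) := by
  have h := sum_Ioc_sum_divisorsAntidiagonal N (fun a _ => Λ a)
  simp only [Finset.sum_const, Nat.card_Ioc, nsmul_eq_mul, Nat.sub_zero] at h
  rw [Finset.sum_congr rfl (fun k _ => mul_comm _ _), ← h]
  refine Finset.sum_congr rfl fun n _ => ?_
  rw [Nat.sum_divisorsAntidiagonal (fun a _ => Λ a), vonMangoldt_sum]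

/-- Mertens' first theorem for the von Mangoldt function. -/
theorem abs_sum_Ioc_vonMangoldt_div_sub_log_le (N : ℕ) (hN : 1 ≤ N) :
    |∑ k ∈ Ioc 0 N, Λ k * (1 / (k : ℝ)) - log N| ≤ 6 := by
  have hN0 : (0 : ℝ) < N := by exact_mod_cast hN
  obtain ⟨h1, h2⟩ := sum_Ioc_log_bounds N hN
  rw [← sum_Ioc_vonMangoldt_mul_div] at h1 h2
  have h3 : ∑ k ∈ Ioc 0 N, Λ k * ((N / k : ℕ) : ℝ) ≤ N * ∑ k ∈ Ioc 0 N, Λ k * (1 / (k : ℝ)) := by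
    rw [Finset.mul_sum]
    refine Finset.sum_le_sum fun k hk => ?_
    have := mul_le_mul_of_nonneg_left (Nat.cast_div_le (m := N) (n := k) (α := ℝ))
      (vonMangoldt_nonneg (n := k))
    refine this.trans (le_of_eq (by ring))
  have h4 : N * ∑ k ∈ Ioc 0 N, Λ k * (1 / (k : ℝ)) ≤
      ∑ k ∈ Ioc 0 N, Λ k * ((N / k : ℕ) : ℝ) + ∑ k ∈ Ioc 0 N, Λ k := by
    rw [Finset.mul_sum, ← Finset.sum_add_distrib]
    refine Finset.sum_le_sum fun k hk => ?_
    rw [mem_Ioc] at hk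
    have hk0 : (0 : ℝ) < k := by exact_mod_cast hk.1
    have : (N : ℝ) / k ≤ ((N / k : ℕ) : ℝ) + 1 := by
      rw [div_le_iff₀ hk0]
      have := Nat.lt_mul_div_succ N hk.1
      have h : (N : ℝ) < k * (((N / k : ℕ) : ℝ) + 1) := by exact_mod_cast this
      linarith
    have := mul_le_mul_of_nonneg_left this (vonMangoldt_nonneg (n := k))
    have e : (N : ℝ) * (Λ k * (1 / (k : ℝ))) = Λ k * ((N : ℝ) / k) := by ring
    rw [e]; linarith
  have h5 := sum_Ioc_vonMangoldt_le N
  have h6 : log (N : ℝ) ≤ N - 1 := log_le_sub_one_of_pos hN0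
  rw [abs_le]
  constructor
  · have : N * (-6) ≤ N * (∑ k ∈ Ioc 0 N, Λ k * (1 / (k : ℝ)) - log N) := by nlinarith
    exact le_of_mul_le_mul_left this hN0
  · have : N * (∑ k ∈ Ioc 0 N, Λ k * (1 / (k : ℝ)) - log N) ≤ N * 6 := by nlinarith
    exact le_of_mul_le_mul_left this hN0

end Mertens

section Selberg

theorem sum_divisorsAntidiagonal_moebius_mul_log_sub (t : ℝ) (k : ℕ) :
    ∑ x ∈ k.divisorsAntidiagonal, (μ x.1 : ℝ) * (t - log (x.1 : ℝ)) =
      (if k = 1 then t else 0) + Λ k := by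
  rw [Nat.sum_divisorsAntidiagonal (fun d _ => (μ d : ℝ) * (t - log (d : ℝ)))]
  simp only [mul_sub, Finset.sum_sub_distrib, ← Finset.sum_mul]
  have h1 := ArithmeticFunction.sum_moebius_mul_log_eq (n := k)
  simp only [ArithmeticFunction.log_apply] at h1
  rw [h1]
  have h2 := congrArg (fun f : ArithmeticFunction ℝ => f k)
    (ArithmeticFunction.coe_moebius_mul_coe_zeta (R := ℝ))
  simp only [ArithmeticFunction.coe_mul_zeta_apply, ArithmeticFunction.intCoe_apply,
    ArithmeticFunction.one_apply] at h2
  rw [h2]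
  split_ifs <;> simp

theorem sum_Ioc_sum_vonMangoldt_div (M : ℕ) :
    ∑ n ∈ Ioc 0 M, ∑ k ∈ Ioc 0 (M / n), Λ k = ∑ n ∈ Ioc 0 M, log (n : ℝ) := by
  rw [sum_Ioc_sum_Ioc_div_comm M (fun _ k => Λ k), ← sum_Ioc_vonMangoldt_mul_div]
  simp [mul_comm]

theorem sum_Ioc_inv_bounds (M : ℕ) (hM : 1 ≤ M) :
    log M + eulerMascheroniConstant ≤ ∑ n ∈ Ioc 0 M, 1 / (n : ℝ) ∧
      ∑ n ∈ Ioc 0 M, 1 / (n : ℝ) ≤ log M + eulerMascheroniConstant + 1 / M := by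
  have hM0 : (0 : ℝ) < M := by exact_mod_cast hM
  have e : (harmonic M : ℝ) = ∑ n ∈ Ioc 0 M, 1 / (n : ℝ) := by
    rw [harmonic_eq_sum_Icc]
    push_cast
    simp only [one_div]
    rfl
  have h1 := eulerMascheroniSeq_lt_eulerMascheroniConstant M
  have h2 := eulerMascheroniConstant_lt_eulerMascheroniSeq' M
  rw [eulerMascheroniSeq, e] at h1
  rw [eulerMascheroniSeq', if_neg (by lia), e] at h2
  have h3 : log ((M : ℝ) + 1) - log M ≤ 1 / M := by
    rw [← log_div (by positivity) (by positivity)]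
    refine (log_le_sub_one_of_pos (by positivity)).trans (le_of_eq ?_)
    field_simp; ring
  constructor <;> linarith

theorem abs_sum_log_sub_le {M : ℕ} {y : ℝ} (hM : 1 ≤ M) (h1 : M ≤ y) (h2 : y ≤ M + 1) :
    |∑ n ∈ Ioc 0 M, log (n : ℝ) - y * ∑ n ∈ Ioc 0 M, 1 / (n : ℝ)
      + (eulerMascheroniConstant + 1) * M| ≤ 4 * (1 + log y) := by
  have hM1 : (1 : ℝ) ≤ M := by exact_mod_cast hM
  have hM0 : (0 : ℝ) < M := by linarith
  obtain ⟨a1, a2⟩ := sum_Ioc_log_bounds M hM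
  obtain ⟨b1, b2⟩ := sum_Ioc_inv_bounds M hM
  have c1 := one_half_lt_eulerMascheroniConstant
  have c2 := eulerMascheroniConstant_lt_two_thirds
  have hl : log M ≤ log y := log_le_log hM0 h1
  have hl0 : 0 ≤ log (M : ℝ) := log_nonneg hM1
  set H := ∑ n ∈ Ioc 0 M, 1 / (n : ℝ)
  set G := ∑ n ∈ Ioc 0 M, log (n : ℝ)
  set γ := eulerMascheroniConstant
  set l := log (M : ℝ)
  have hy : y * (1 / M) ≤ 2 := by
    rw [mul_one_div, div_le_iff₀ hM0]; linarith
  have hy0 : 0 < y := by linarith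
  have d1 := mul_le_mul_of_nonneg_left b1 hy0.le
  have d2 := mul_le_mul_of_nonneg_left b2 hy0.le
  have e1 : 0 ≤ (y - M) * (l + γ) := by
    apply mul_nonneg <;> linarith
  have e2 : (y - M) * (l + γ) ≤ l + γ := by nlinarith
  rw [abs_le]
  constructor
  · nlinarith
  · nlinarith

theorem log_mul_one_add_log_le_sqrt {y : ℝ} (hy : 1 ≤ y) : log y * (1 + log y) ≤ 20 * √y := by
  have hy0 : 0 < y := by linarith
  have e : log y = 4 * log (√(√y)) := by
    rw [log_sqrt (sqrt_nonneg _), log_sqrt hy0.le]; ring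
  have h1 : 1 ≤ √y := by rwa [one_le_sqrt]
  have h2 : 1 ≤ √(√y) := by rwa [one_le_sqrt]
  have h3 : log (√(√y)) ≤ √(√y) - 1 := log_le_sub_one_of_pos (by linarith)
  have h4 : 0 ≤ log y := log_nonneg hy
  have h5 : √(√y) ^ 2 = √y := sq_sqrt (sqrt_nonneg _)
  have h6 : log y ≤ 4 * (√(√y) - 1) := by linarith
  nlinarith

/-- Selberg's symmetry formula, as an upper bound. -/
theorem selberg_upper_bound (N : ℕ) (hN : 1 ≤ N) :
    ∑ k ∈ Ioc 0 N, Λ k * log k + ∑ k ∈ Ioc 0 N, Λ k * ∑ j ∈ Ioc 0 (N / k), Λ j ≤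
      2 * N * log N + 166 * N := by
  have hN1 : (1 : ℝ) ≤ N := by exact_mod_cast hN
  have hN0 : (0 : ℝ) < N := by linarith
  set γ := eulerMascheroniConstant
  set ψ : ℕ → ℝ := fun M => ∑ j ∈ Ioc 0 M, Λ j with hψ
  have hψ0 : ∀ M, 0 ≤ ψ M := fun M => Finset.sum_nonneg fun _ _ => vonMangoldt_nonneg
  set Φ : ℕ → ℝ := fun k => ψ (N / k) - N * (1 / (k : ℝ)) + (γ + 1) with hΦ
  have key := sum_Ioc_sum_divisorsAntidiagonal N
    (fun d n => (μ d : ℝ) * (log N - log (d : ℝ)) * Φ (d * n))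
  have hL : ∑ k ∈ Ioc 0 N, ∑ x ∈ k.divisorsAntidiagonal,
      (μ x.1 : ℝ) * (log N - log (x.1 : ℝ)) * Φ (x.1 * x.2) =
      log N * Φ 1 + ∑ k ∈ Ioc 0 N, Λ k * Φ k := by
    have : ∀ k ∈ Ioc 0 N, ∑ x ∈ k.divisorsAntidiagonal,
        (μ x.1 : ℝ) * (log N - log (x.1 : ℝ)) * Φ (x.1 * x.2) =
        (if k = 1 then log N * Φ 1 else 0) + Λ k * Φ k := by
      intro k hk
      rw [mem_Ioc] at hk
      have e : ∑ x ∈ k.divisorsAntidiagonal,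
          (μ x.1 : ℝ) * (log N - log (x.1 : ℝ)) * Φ (x.1 * x.2) =
          (∑ x ∈ k.divisorsAntidiagonal, (μ x.1 : ℝ) * (log N - log (x.1 : ℝ))) * Φ k := by
        rw [Finset.sum_mul]
        refine Finset.sum_congr rfl fun x hx => ?_
        rw [(Nat.mem_divisorsAntidiagonal.1 hx).1]
      rw [e, sum_divisorsAntidiagonal_moebius_mul_log_sub, add_mul]
      split_ifs with h
      · rw [h]
      · simp
    rw [Finset.sum_congr rfl this, Finset.sum_add_distrib, Finset.sum_ite_eq',
      if_pos (by simp; lia)]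
  rw [hL] at key
  have hR : ∑ a ∈ Ioc 0 N, ∑ b ∈ Ioc 0 (N / a),
      (μ a : ℝ) * (log N - log (a : ℝ)) * Φ (a * b) ≤ 160 * N := by
    have : ∀ a ∈ Ioc 0 N, ∑ b ∈ Ioc 0 (N / a),
        (μ a : ℝ) * (log N - log (a : ℝ)) * Φ (a * b) ≤ 80 * √N * (1 / √(a : ℝ)) := by
      intro a ha
      rw [mem_Ioc] at ha
      have ha0 : (0 : ℝ) < a := by exact_mod_cast ha.1
      have haN : (a : ℝ) ≤ N := by exact_mod_cast ha.2
      have hM : 1 ≤ N / a := (Nat.one_le_div_iff ha.1).2 ha.2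
      have hy1 : ((N / a : ℕ) : ℝ) ≤ (N : ℝ) / a := Nat.cast_div_le
      have hy2 : (N : ℝ) / a ≤ ((N / a : ℕ) : ℝ) + 1 := by
        rw [div_le_iff₀ ha0]
        have h : (N : ℝ) < a * (((N / a : ℕ) : ℝ) + 1) := by
          exact_mod_cast Nat.lt_mul_div_succ N ha.1
        linarith
      have h1 := abs_sum_log_sub_le hM hy1 hy2
      have e1 : ∑ b ∈ Ioc 0 (N / a), Φ (a * b) = ∑ n ∈ Ioc 0 (N / a), log (n : ℝ) -
          (N : ℝ) / a * ∑ n ∈ Ioc 0 (N / a), 1 / (n : ℝ) + (γ + 1) * ((N / a : ℕ) : ℝ) := by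
        rw [← sum_Ioc_sum_vonMangoldt_div]
        simp only [hΦ, hψ, Finset.sum_add_distrib, Finset.sum_sub_distrib, Finset.sum_const,
          Nat.card_Ioc, nsmul_eq_mul, Nat.sub_zero, ← Nat.div_div_eq_div_mul, Finset.mul_sum]
        congr 1
        · congr 1
          refine Finset.sum_congr rfl fun b _ => ?_
          push_cast
          rw [div_mul_div_comm, mul_one, mul_one_div]
        · ring
      rw [← e1] at h1
      rw [← Finset.mul_sum]
      have hyy : 1 ≤ (N : ℝ) / a := by rw [le_div_iff₀ ha0]; linarith
      have hlog : log N - log (a : ℝ) = log ((N : ℝ) / a) := (log_div hN0.ne' ha0.ne').symm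
      rw [hlog]
      have hmu : |(μ a : ℝ)| ≤ 1 := by
        have := ArithmeticFunction.abs_moebius_le_one (n := a)
        exact_mod_cast this
      have h2 := log_mul_one_add_log_le_sqrt hyy
      have h3 : 0 ≤ log ((N : ℝ) / a) := log_nonneg hyy
      calc _ ≤ |(μ a : ℝ) * log ((N : ℝ) / a) * ∑ b ∈ Ioc 0 (N / a), Φ (a * b)| := le_abs_self _
        _ = |(μ a : ℝ)| * (log ((N : ℝ) / a) * |∑ b ∈ Ioc 0 (N / a), Φ (a * b)|) := by
            rw [abs_mul, abs_mul, abs_of_nonneg h3, mul_assoc]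
        _ ≤ 1 * (log ((N : ℝ) / a) * (4 * (1 + log ((N : ℝ) / a)))) := by gcongr
        _ ≤ 80 * √((N : ℝ) / a) := by linarith
        _ = _ := by rw [sqrt_div hN0.le]; ring
    refine (Finset.sum_le_sum this).trans ?_
    rw [← Finset.mul_sum]
    have h1 := sum_Ioc_inv_sqrt_le N
    have h2 : 0 ≤ √(N : ℝ) := sqrt_nonneg _
    have h3 := mul_self_sqrt hN0.le
    nlinarith
  rw [← key] at hR
  have hM := abs_le.1 (abs_sum_Ioc_vonMangoldt_div_sub_log_le N hN)
  have hlogN : 0 ≤ log (N : ℝ) := log_nonneg hN1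
  have hΦ1 : Φ 1 = ψ N - N + (γ + 1) := by simp [hΦ]
  have hsum : ∑ k ∈ Ioc 0 N, Λ k * Φ k = ∑ k ∈ Ioc 0 N, Λ k * ψ (N / k) -
      N * ∑ k ∈ Ioc 0 N, Λ k * (1 / (k : ℝ)) + (γ + 1) * ψ N := by
    simp only [hΦ, mul_add, mul_sub, Finset.sum_add_distrib, Finset.sum_sub_distrib,
      ← Finset.sum_mul, Finset.mul_sum]
    congr 1
    · congr 1
      exact Finset.sum_congr rfl fun k _ => by ring
    · simp only [hψ]; ring
  have hlog : ∑ k ∈ Ioc 0 N, Λ k * log k ≤ log N * ψ N := by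
    rw [hψ, Finset.mul_sum]
    refine Finset.sum_le_sum fun k hk => ?_
    rw [mem_Ioc] at hk
    have : log (k : ℝ) ≤ log N :=
      log_le_log (by exact_mod_cast hk.1) (by exact_mod_cast hk.2)
    nlinarith [vonMangoldt_nonneg (n := k)]
  have c1 := one_half_lt_eulerMascheroniConstant
  have hg : 0 ≤ (γ + 1) * ψ N := mul_nonneg (by simp only [γ]; linarith) (hψ0 N)
  have hg2 : 0 ≤ (γ + 1) * log N := mul_nonneg (by simp only [γ]; linarith) hlogN
  rw [hΦ1, hsum] at hR
  nlinarith

end Selberg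

section HalfDensity

theorem sum_Ioc_vonMangoldt_div_sqrt_le (M : ℕ) :
    ∑ k ∈ Ioc 0 M, Λ k * √((M / k : ℕ) : ℝ) ≤ 12 * M := by
  have h := sum_Ioc_mul_le_of_antitone (c := fun k => Λ k) (d := fun _ => 6)
    (h := fun k => 1 / √(k : ℝ)) (N := M)
    (fun n _ => by
      have := sum_Ioc_vonMangoldt_le n
      simp only [Finset.sum_const, Nat.card_Ioc, nsmul_eq_mul, Nat.sub_zero]
      linarith)
    (fun n hn _ => by
      have : (0 : ℝ) < n := by exact_mod_cast hn
      gcongr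
      lia)
    (by positivity)
  rw [← Finset.mul_sum] at h
  have h1 := sum_Ioc_inv_sqrt_le M
  calc ∑ k ∈ Ioc 0 M, Λ k * √((M / k : ℕ) : ℝ)
      ≤ ∑ k ∈ Ioc 0 M, √(M : ℝ) * (Λ k * (1 / √(k : ℝ))) := by
        refine Finset.sum_le_sum fun k _ => ?_
        have : √((M / k : ℕ) : ℝ) ≤ √(M : ℝ) * (1 / √(k : ℝ)) := by
          rw [mul_one_div, ← sqrt_div (Nat.cast_nonneg M)]
          exact sqrt_le_sqrt Nat.cast_div_le
        have := mul_le_mul_of_nonneg_left this (vonMangoldt_nonneg (n := k))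
        linarith
    _ = √(M : ℝ) * ∑ k ∈ Ioc 0 M, Λ k * (1 / √(k : ℝ)) := by rw [Finset.mul_sum]
    _ ≤ √(M : ℝ) * (6 * (2 * √(M : ℝ))) :=
        mul_le_mul_of_nonneg_left (h.trans (by linarith)) (sqrt_nonneg _)
    _ = 12 * M := by
        have := mul_self_sqrt (Nat.cast_nonneg (α := ℝ) M)
        linear_combination 12 * this

theorem sum_Ioc_mul_sum_Ioc_le {c r : ℕ → ℝ} {B : ℝ} (hB : 0 ≤ B) (hc : ∀ k, |c k| ≤ Λ k)
    (hr : ∀ n : ℕ, |∑ k ∈ Ioc 0 n, r k| ≤ B * √(n : ℝ)) (M : ℕ) :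
    |∑ k ∈ Ioc 0 M, c k * ∑ j ∈ Ioc 0 (M / k), r j| ≤ 12 * B * M := by
  refine (Finset.abs_sum_le_sum_abs _ _).trans ?_
  calc ∑ k ∈ Ioc 0 M, |c k * ∑ j ∈ Ioc 0 (M / k), r j|
      ≤ ∑ k ∈ Ioc 0 M, B * (Λ k * √((M / k : ℕ) : ℝ)) := by
        refine Finset.sum_le_sum fun k _ => ?_
        rw [abs_mul]
        calc _ ≤ Λ k * (B * √((M / k : ℕ) : ℝ)) := by
              gcongr
              · exact hc k
              · exact hr _
          _ = _ := by ring
    _ ≤ 12 * B * M := by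
        rw [← Finset.mul_sum]
        have := mul_le_mul_of_nonneg_left (sum_Ioc_vonMangoldt_div_sqrt_le M) hB
        linarith

variable {f : ℕ → ℝ} {B : ℝ}

theorem sum_half_vonMangoldt_selberg_le (f0 : ∀ n, 0 ≤ f n) (f1 : ∀ n, f n ≤ 1)
    (hf : ∀ n : ℕ, |∑ k ∈ Ioc 0 n, Λ k * (2 * f k - 1)| ≤ B * √(n : ℝ)) (M : ℕ) (hM : 1 ≤ M) :
    ∑ k ∈ Ioc 0 M, Λ k * f k * log k +
        ∑ k ∈ Ioc 0 M, Λ k * f k * ∑ j ∈ Ioc 0 (M / k), Λ j * f j ≤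
      M * log M / 2 + (∑ k ∈ Ioc 0 M, Λ k * log k) / 4 + (42 + 11 * B) * M := by
  have hB : 0 ≤ B := by simpa using (abs_nonneg _).trans (hf 1)
  have hM1 : (1 : ℝ) ≤ M := by exact_mod_cast hM
  set ρ : ℕ → ℝ := fun k => Λ k * (2 * f k - 1) with hρ
  have hg : ∀ k, Λ k * f k = (Λ k + ρ k) / 2 := fun k => by simp only [hρ]; ring
  have hρΛ : ∀ k, |ρ k| ≤ Λ k := fun k => by
    have h1 := f0 k
    have h2 := f1 k
    rw [hρ, abs_mul, abs_of_nonneg vonMangoldt_nonneg]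
    refine mul_le_of_le_one_right vonMangoldt_nonneg ?_
    rw [abs_le]; constructor <;> linarith
  have h1 := sum_Ioc_mul_sum_Ioc_le hB (c := fun k => Λ k)
    (fun k => (abs_of_nonneg vonMangoldt_nonneg).le) hf M
  have h2 := sum_Ioc_mul_sum_Ioc_le hB hρΛ hf M
  have h3 : ∑ k ∈ Ioc 0 M, ρ k * ∑ j ∈ Ioc 0 (M / k), Λ j =
      ∑ k ∈ Ioc 0 M, Λ k * ∑ j ∈ Ioc 0 (M / k), ρ j := by
    simp only [Finset.mul_sum]
    rw [sum_Ioc_sum_Ioc_div_comm M (fun k j => ρ k * Λ j)]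
    simp only [mul_comm]
  have h4 := selberg_upper_bound M hM
  have h5 : |∑ k ∈ Ioc 0 M, ρ k * log (k : ℝ)| ≤ 2 * (B * √(M : ℝ)) * log M :=
    abs_sum_Ioc_mul_le_of_monotone
      (fun n hn => (hf n).trans (by gcongr))
      (fun n hn _ => log_le_log (by exact_mod_cast hn) (by push_cast; linarith))
      (by simp) hM
  have h6 : √(M : ℝ) * log M ≤ 2 * M := by
    have e : log (M : ℝ) = 2 * log √(M : ℝ) := by rw [log_sqrt (by linarith)]; ring
    have e2 : log √(M : ℝ) ≤ √(M : ℝ) - 1 := log_le_sub_one_of_pos (sqrt_pos.2 (by linarith))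
    have e3 := mul_self_sqrt (show (0 : ℝ) ≤ M by linarith)
    have e4 := sqrt_nonneg (M : ℝ)
    nlinarith
  have e1 : ∑ k ∈ Ioc 0 M, Λ k * f k * log k =
      (∑ k ∈ Ioc 0 M, Λ k * log k) / 2 + (∑ k ∈ Ioc 0 M, ρ k * log k) / 2 := by
    rw [Finset.sum_div, Finset.sum_div, ← Finset.sum_add_distrib]
    exact Finset.sum_congr rfl fun k _ => by rw [hg]; ring
  have e2 : ∑ k ∈ Ioc 0 M, Λ k * f k * ∑ j ∈ Ioc 0 (M / k), Λ j * f j =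
      (∑ k ∈ Ioc 0 M, Λ k * ∑ j ∈ Ioc 0 (M / k), Λ j) / 4 +
      (∑ k ∈ Ioc 0 M, Λ k * ∑ j ∈ Ioc 0 (M / k), ρ j) / 4 +
      (∑ k ∈ Ioc 0 M, ρ k * ∑ j ∈ Ioc 0 (M / k), Λ j) / 4 +
      (∑ k ∈ Ioc 0 M, ρ k * ∑ j ∈ Ioc 0 (M / k), ρ j) / 4 := by
    simp only [Finset.sum_div, ← Finset.sum_add_distrib]
    refine Finset.sum_congr rfl fun k _ => ?_
    simp only [hg, ← Finset.sum_div, Finset.sum_add_distrib]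
    ring
  rw [e1, e2, h3]
  have h7 := mul_le_mul_of_nonneg_left h6 hB
  have a1 := (abs_le.1 h1).2
  have a2 := (abs_le.1 h2).2
  have a5 := (abs_le.1 h5).2
  simp only [← hρ] at a1
  have : ∑ k ∈ Ioc 0 M, Λ k * ∑ j ∈ Ioc 0 (M / k), Λ j ≤ 2 * M * log M + 166 * M
    - ∑ k ∈ Ioc 0 M, Λ k * log k := by linarith
  nlinarith

theorem abs_sum_half_vonMangoldt_div_sub_log_le
    (hf : ∀ n : ℕ, |∑ k ∈ Ioc 0 n, Λ k * (2 * f k - 1)| ≤ B * √(n : ℝ)) (N : ℕ) (hN : 1 ≤ N) :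
    |∑ k ∈ Ioc 0 N, Λ k * f k * (1 / (k : ℝ)) - log N / 2| ≤ 3 + 2 * B := by
  have h1 := abs_le.1 (abs_sum_Ioc_vonMangoldt_div_sub_log_le N hN)
  have h2 := abs_le.1 (abs_sum_Ioc_div_le_of_sqrt hf N)
  have hB : 0 ≤ B := by simpa using (abs_nonneg _).trans (hf 1)
  have e : ∑ k ∈ Ioc 0 N, Λ k * f k * (1 / (k : ℝ)) =
      (∑ k ∈ Ioc 0 N, Λ k * (1 / (k : ℝ))) / 2 +
      (∑ k ∈ Ioc 0 N, Λ k * (2 * f k - 1) * (1 / (k : ℝ))) / 2 := by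
    simp only [Finset.sum_div, ← Finset.sum_add_distrib]
    exact Finset.sum_congr rfl fun k _ => by ring
  rw [e, abs_le]
  constructor <;> linarith

end HalfDensity

section LogarithmicMean

theorem log_cast_div_bounds {N m : ℕ} (hm : 0 < m) (hmN : m ≤ N) :
    log ((N / m : ℕ) : ℝ) ≤ log N - log m ∧ log N - log m ≤ log ((N / m : ℕ) : ℝ) + 1 := by
  have hm0 : (0 : ℝ) < m := by exact_mod_cast hm
  have hN0 : (0 : ℝ) < N := by exact_mod_cast hm.trans_le hmN
  have hM : 1 ≤ N / m := (Nat.one_le_div_iff hm).2 hmN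
  have hM1 : (1 : ℝ) ≤ ((N / m : ℕ) : ℝ) := by exact_mod_cast hM
  rw [← log_div hN0.ne' hm0.ne']
  refine ⟨log_le_log (by linarith) Nat.cast_div_le, ?_⟩
  have h : (N : ℝ) / m ≤ 2 * ((N / m : ℕ) : ℝ) := by
    rw [div_le_iff₀ hm0]
    have h : (N : ℝ) < m * (((N / m : ℕ) : ℝ) + 1) := by
      exact_mod_cast Nat.lt_mul_div_succ N hm
    nlinarith
  calc log ((N : ℝ) / m) ≤ log (2 * ((N / m : ℕ) : ℝ)) := log_le_log (by positivity) h
    _ = log 2 + log ((N / m : ℕ) : ℝ) := log_mul (by norm_num) (by linarith)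
    _ ≤ _ := by have := log_two_lt_d9; linarith

variable {f : ℕ → ℝ} {B : ℝ}

theorem sum_mul_log_eq_sum_sum_vonMangoldt (fmul : ∀ a b, f (a * b) = f a * f b) (N : ℕ)
    (h : ℕ → ℝ) (w : ℕ → ℕ → ℝ) (hw : ∀ a b, w a b = h (a * b)) :
    ∑ n ∈ Ioc 0 N, f n * log n * h n =
      ∑ m ∈ Ioc 0 N, f m * ∑ k ∈ Ioc 0 (N / m), Λ k * f k * w m k := by
  simp only [Finset.mul_sum]
  rw [← sum_Ioc_sum_divisorsAntidiagonal N (fun m k => f m * (Λ k * f k * w m k))]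
  refine Finset.sum_congr rfl fun n _ => ?_
  have e : ∀ x ∈ n.divisorsAntidiagonal, f x.1 * (Λ x.2 * f x.2 * w x.1 x.2) =
      Λ x.2 * (f n * h n) := by
    intro x hx
    rw [← (Nat.mem_divisorsAntidiagonal.1 hx).1, fmul, hw]; ring
  rw [Finset.sum_congr rfl e, ← Finset.sum_mul,
    Nat.sum_divisorsAntidiagonal' (fun _ b => Λ b), vonMangoldt_sum]
  ring

theorem abs_log_mul_logMean_sub_le (f0 : ∀ n, 0 ≤ f n)
    (fmul : ∀ a b, f (a * b) = f a * f b)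
    (hf : ∀ n : ℕ, |∑ k ∈ Ioc 0 n, Λ k * (2 * f k - 1)| ≤ B * √(n : ℝ)) (N : ℕ) :
    |log N * ∑ n ∈ Ioc 0 N, f n * (1 / (n : ℝ)) -
      3 / 2 * ∑ n ∈ Ioc 0 N, f n * (1 / (n : ℝ)) * (log N - log n)| ≤
    (4 + 2 * B) * ∑ n ∈ Ioc 0 N, f n * (1 / (n : ℝ)) := by
  have h1 := sum_mul_log_eq_sum_sum_vonMangoldt fmul N (fun n => 1 / (n : ℝ))
    (fun a b => 1 / (a : ℝ) * (1 / (b : ℝ))) (fun a b => by push_cast; ring)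
  have e : log N * ∑ n ∈ Ioc 0 N, f n * (1 / (n : ℝ)) -
      3 / 2 * ∑ n ∈ Ioc 0 N, f n * (1 / (n : ℝ)) * (log N - log n) =
      ∑ m ∈ Ioc 0 N, f m * (1 / (m : ℝ)) * (∑ k ∈ Ioc 0 (N / m), Λ k * f k * (1 / (k : ℝ))
        - (log N - log m) / 2) := by
    have h2 : ∑ m ∈ Ioc 0 N, f m * (1 / (m : ℝ)) * (∑ k ∈ Ioc 0 (N / m), Λ k * f k * (1 / (k : ℝ))
        - (log N - log m) / 2) = ∑ n ∈ Ioc 0 N, f n * log n * (1 / (n : ℝ)) -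
        1 / 2 * ∑ n ∈ Ioc 0 N, f n * (1 / (n : ℝ)) * (log N - log n) := by
      rw [h1, Finset.mul_sum, ← Finset.sum_sub_distrib]
      refine Finset.sum_congr rfl fun m _ => ?_
      have : ∑ k ∈ Ioc 0 (N / m), Λ k * f k * (1 / (m : ℝ) * (1 / (k : ℝ))) =
          1 / (m : ℝ) * ∑ k ∈ Ioc 0 (N / m), Λ k * f k * (1 / (k : ℝ)) := by
        rw [Finset.mul_sum]
        exact Finset.sum_congr rfl fun k _ => by ring
      rw [this]; ring
    rw [h2]
    have h3 : ∑ n ∈ Ioc 0 N, f n * (1 / (n : ℝ)) * (log N - log n) =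
        log N * ∑ n ∈ Ioc 0 N, f n * (1 / (n : ℝ)) - ∑ n ∈ Ioc 0 N, f n * log n * (1 / (n : ℝ)) := by
      rw [Finset.mul_sum, ← Finset.sum_sub_distrib]
      exact Finset.sum_congr rfl fun k _ => by ring
    rw [h3]; ring
  rw [e, Finset.mul_sum]
  refine (Finset.abs_sum_le_sum_abs _ _).trans (Finset.sum_le_sum fun m hm => ?_)
  rw [mem_Ioc] at hm
  have h4 := abs_le.1 (abs_sum_half_vonMangoldt_div_sub_log_le hf (N / m)
    ((Nat.one_le_div_iff hm.1).2 hm.2))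
  obtain ⟨h5, h6⟩ := log_cast_div_bounds hm.1 hm.2
  have h7 : 0 ≤ f m * (1 / (m : ℝ)) := mul_nonneg (f0 m) (by positivity)
  rw [abs_mul, abs_of_nonneg h7, mul_comm]
  refine mul_le_mul_of_nonneg_right ?_ h7
  rw [abs_le]
  constructor <;> linarith

theorem tendsto_log_cast_atTop : Tendsto (fun N : ℕ => log (N : ℝ)) atTop atTop :=
  tendsto_log_atTop.comp tendsto_natCast_atTop_atTop

theorem tendsto_log_add_div_log (D : ℝ) :
    Tendsto (fun N : ℕ => (log (N : ℝ) + D) / log N) atTop (𝓝 1) := by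
  have h1 : Tendsto (fun N : ℕ => 1 + D / log (N : ℝ)) atTop (𝓝 (1 + 0)) :=
    tendsto_const_nhds.add (tendsto_const_nhds.div_atTop tendsto_log_cast_atTop)
  rw [add_zero] at h1
  refine h1.congr' ?_
  filter_upwards [tendsto_log_cast_atTop.eventually_gt_atTop 0] with N hN
  field_simp

/-- The logarithmic mean of `f` is asymptotic to a multiple of `√(log N)`. -/
theorem exists_tendsto_logMean (f0 : ∀ n, 0 ≤ f n)
    (fmul : ∀ a b, f (a * b) = f a * f b)
    (hf : ∀ n : ℕ, |∑ k ∈ Ioc 0 n, Λ k * (2 * f k - 1)| ≤ B * √(n : ℝ)) :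
    ∃ c : ℝ, 0 ≤ c ∧ Tendsto (fun N : ℕ => (∑ n ∈ Ioc 0 N, f n * (1 / (n : ℝ))) / √(log N))
      atTop (𝓝 c) := by
  have hB : 0 ≤ B := by simpa using (abs_nonneg _).trans (hf 1)
  set C : ℝ := 4 + 2 * B with hC
  set L : ℕ → ℝ := fun N => ∑ n ∈ Ioc 0 N, f n * (1 / (n : ℝ)) with hL
  set I : ℕ → ℝ := fun N => ∑ n ∈ Ioc 0 N, f n * (1 / (n : ℝ)) * (log N - log n) with hI
  have hLI : ∀ N : ℕ, |log N * L N - 3 / 2 * I N| ≤ C * L N := abs_log_mul_logMean_sub_le f0 fmul hf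
  have hI0 : ∀ N, 0 ≤ I N := fun N => Finset.sum_nonneg fun n hn => by
    rw [mem_Ioc] at hn
    have : log (n : ℝ) ≤ log N := log_le_log (by exact_mod_cast hn.1) (by exact_mod_cast hn.2)
    exact mul_nonneg (mul_nonneg (f0 n) (by positivity)) (by linarith)
  have hIs : ∀ N, I (N + 1) = I N + L N * (log ((N : ℝ) + 1) - log N) := by
    intro N
    simp only [hI, hL]
    rw [Finset.sum_Ioc_succ_top (Nat.zero_le N), sub_self, mul_zero, add_zero, Finset.sum_mul,
      ← Finset.sum_add_distrib]
    push_cast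
    exact Finset.sum_congr rfl fun n _ => by ring
  obtain ⟨N₀, hN₀⟩ := eventually_atTop.1 (tendsto_log_cast_atTop.eventually_ge_atTop (C + 1))
  set v : ℕ → ℝ := fun N => log N - C with hv
  have hv0 : ∀ N, N₀ ≤ N → 1 ≤ v N := fun N hN => by
    have := hN₀ N hN
    simp only [hv]; linarith
  have hN1 : 1 ≤ N₀ := by
    by_contra h
    have h0 : N₀ = 0 := by lia
    have := hN₀ 0 (by lia)
    simp at this
    linarith
  set J : ℕ → ℝ := fun N => I N / (v N * √(v N)) with hJ
  have hanti : Antitone (fun n => J (N₀ + n)) := by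
    refine antitone_nat_of_succ_le fun n => ?_
    set N := N₀ + n with hN
    change J (N + 1) ≤ J N
    have h1 := hv0 N (by lia)
    have h2 := hv0 (N + 1) (by lia)
    have hN0 : (0 : ℝ) < N := by exact_mod_cast (show 0 < N by lia)
    have hl : log (N : ℝ) ≤ log ((N : ℝ) + 1) := log_le_log hN0 (by linarith)
    have hvv : v (N + 1) = v N + (log ((N : ℝ) + 1) - log N) := by
      simp only [hv]; push_cast; ring
    have h3 := (abs_le.1 (hLI N)).2
    have h4 : v N * L N ≤ 3 / 2 * I N := by simp only [hv]; linarith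
    have h5 := hIs N
    set ℓ := log ((N : ℝ) + 1) - log N
    have hℓ : 0 ≤ ℓ := by simp only [ℓ]; linarith
    simp only [hJ]
    have hp : 0 < √(v N) := sqrt_pos.2 (by linarith)
    have hq : 0 < √(v (N + 1)) := sqrt_pos.2 (by linarith)
    have hpq : √(v N) ≤ √(v (N + 1)) := sqrt_le_sqrt (by linarith)
    have ep : √(v N) ^ 2 = v N := sq_sqrt (by linarith)
    have eq : √(v (N + 1)) ^ 2 = v (N + 1) := sq_sqrt (by linarith)
    set p := √(v N)
    set q := √(v (N + 1))
    rw [div_le_div_iff₀ (by positivity) (by positivity)]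
    have h6 : I (N + 1) * v N ≤ I N * (v N + 3 / 2 * ℓ) := by
      rw [h5]; nlinarith
    have h7 : (v N + 3 / 2 * ℓ) * p ≤ v (N + 1) * q := by
      have e1 : ℓ = q ^ 2 - p ^ 2 := by rw [ep, eq, hvv]; ring
      rw [e1, ← ep, ← eq]
      have := mul_nonneg (sq_nonneg (q - p)) (show 0 ≤ 2 * q + p by linarith)
      nlinarith
    calc I (N + 1) * (v N * p) = I (N + 1) * v N * p := by ring
      _ ≤ I N * (v N + 3 / 2 * ℓ) * p := by gcongr
      _ = I N * ((v N + 3 / 2 * ℓ) * p) := by ring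
      _ ≤ I N * (v (N + 1) * q) := mul_le_mul_of_nonneg_left h7 (hI0 N)
  have hJ0 : ∀ n, 0 ≤ J (N₀ + n) := fun n =>
    div_nonneg (hI0 _) (mul_nonneg (by have := hv0 (N₀ + n) (by lia); linarith) (sqrt_nonneg _))
  have hlim := tendsto_atTop_ciInf hanti ⟨0, by rintro _ ⟨n, rfl⟩; exact hJ0 n⟩
  set κ := ⨅ n, J (N₀ + n)
  have hκ : 0 ≤ κ := ge_of_tendsto' hlim hJ0
  have hlim : Tendsto J atTop (𝓝 κ) := by
    rw [← tendsto_add_atTop_iff_nat N₀]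
    simpa [add_comm] using hlim
  have hU := tendsto_log_cast_atTop
  have hmain : ∀ D : ℝ, Tendsto (fun N : ℕ => 3 / 2 * I N / ((log N + D) * √(log N)))
      atTop (𝓝 (3 / 2 * κ)) := by
    intro D
    have h1 : Tendsto (fun N : ℕ => (3 / 2 * J N) * (((log (N : ℝ) + -C) / log N) *
        √((log (N : ℝ) + -C) / log N) * ((log (N : ℝ) + D) / log N)⁻¹)) atTop
        (𝓝 ((3 / 2 * κ) * (1 * √1 * 1⁻¹))) :=
      (hlim.const_mul _).mul ((((tendsto_log_add_div_log _).mul (tendsto_log_add_div_log _).sqrt)).mul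
        ((tendsto_log_add_div_log D).inv₀ one_ne_zero))
    simp only [sqrt_one, inv_one, mul_one] at h1
    refine h1.congr' ?_
    filter_upwards [hU.eventually_gt_atTop 0, hU.eventually_gt_atTop C,
      hU.eventually_gt_atTop (-D)] with N a1 a2 a3
    have b1 : 0 < log (N : ℝ) - C := by linarith
    have b2 : 0 < log (N : ℝ) + D := by linarith
    have s1 : 0 < √(log (N : ℝ) - C) := sqrt_pos.2 b1
    have s2 : 0 < √(log (N : ℝ)) := sqrt_pos.2 a1
    simp only [hJ, hv, ← sub_eq_add_neg]
    rw [sqrt_div b1.le]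
    field_simp
  refine ⟨3 / 2 * κ, by positivity, tendsto_of_tendsto_of_tendsto_of_le_of_le' (hmain C)
    (hmain (-C)) ?_ ?_⟩
  · filter_upwards [hU.eventually_gt_atTop 0] with N a1
    have s2 : 0 < √(log (N : ℝ)) := sqrt_pos.2 a1
    have := (abs_le.1 (hLI N)).1
    rw [div_le_div_iff₀ (by positivity) s2]
    have h8 : 3 / 2 * I N ≤ L N * (log N + C) := by linarith
    have := mul_le_mul_of_nonneg_right h8 s2.le
    linarith
  · filter_upwards [hU.eventually_gt_atTop 0, hU.eventually_gt_atTop C] with N a1 a2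
    have s2 : 0 < √(log (N : ℝ)) := sqrt_pos.2 a1
    have := (abs_le.1 (hLI N)).2
    have b1 : 0 < log (N : ℝ) + -C := by linarith
    rw [div_le_div_iff₀ s2 (by positivity)]
    have h8 : L N * (log N + -C) ≤ 3 / 2 * I N := by linarith
    have := mul_le_mul_of_nonneg_right h8 s2.le
    linarith

end LogarithmicMean

section Abelian

open MeasureTheory

theorem continuous_sqrt_mul_exp (δ : ℝ) : Continuous (fun u : ℝ => √u * (δ * exp (-δ * u))) := by
  fun_prop

theorem integral_sqrt_mul_exp_add (δ s t : ℝ) :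
    (∫ u in (0 : ℝ)..s, √u * (δ * exp (-δ * u))) + ∫ u in s..t, √u * (δ * exp (-δ * u)) =
      ∫ u in (0 : ℝ)..t, √u * (δ * exp (-δ * u)) :=
  intervalIntegral.integral_add_adjacent_intervals
    ((continuous_sqrt_mul_exp δ).intervalIntegrable _ _)
    ((continuous_sqrt_mul_exp δ).intervalIntegrable _ _)

theorem integral_mul_exp_neg (δ s t : ℝ) :
    ∫ u in s..t, δ * exp (-δ * u) = exp (-δ * s) - exp (-δ * t) := by
  have h : ∀ u ∈ Set.uIcc s t,
      HasDerivAt (fun u => -exp (-δ * u)) (δ * exp (-δ * u)) u := by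
    intro u _
    have := ((hasDerivAt_id u).const_mul (-δ)).exp.neg
    simp only [id, mul_one] at this
    rw [show δ * exp (-δ * u) = -(exp (-δ * u) * -δ) by ring]
    exact this
  rw [intervalIntegral.integral_eq_sub_of_hasDerivAt h
    (Continuous.intervalIntegrable (by fun_prop) _ _)]
  ring

theorem integral_sqrt_mul_exp_bounds {δ s t : ℝ} (hδ : 0 < δ) (hst : s ≤ t) :
    √s * (exp (-δ * s) - exp (-δ * t)) ≤ ∫ u in s..t, √u * (δ * exp (-δ * u)) ∧
      ∫ u in s..t, √u * (δ * exp (-δ * u)) ≤ √t * (exp (-δ * s) - exp (-δ * t)) := by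
  have hc : Continuous (fun u : ℝ => δ * exp (-δ * u)) := by fun_prop
  have hc' := continuous_sqrt_mul_exp δ
  rw [← integral_mul_exp_neg, ← intervalIntegral.integral_const_mul,
    ← intervalIntegral.integral_const_mul]
  constructor
  · refine intervalIntegral.integral_mono_on hst ((hc.const_mul _).intervalIntegrable _ _)
      (hc'.intervalIntegrable _ _) fun u hu => ?_
    have := sqrt_le_sqrt hu.1
    gcongr
  · refine intervalIntegral.integral_mono_on hst (hc'.intervalIntegrable _ _)
      ((hc.const_mul _).intervalIntegrable _ _) fun u hu => ?_
    have := sqrt_le_sqrt hu.2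
    gcongr

theorem tendsto_integral_sqrt_mul_exp {δ : ℝ} (hδ : 0 < δ) :
    Tendsto (fun t : ℝ => ∫ u in (0 : ℝ)..t, √u * (δ * exp (-δ * u))) atTop
      (𝓝 (√π / 2 / √δ)) := by
  have e : ∀ u ∈ Set.Ioi (0 : ℝ), √u * (δ * exp (-δ * u)) =
      δ * (u ^ ((3 : ℝ) / 2 - 1) * exp (-(δ * u))) := by
    intro u _
    rw [sqrt_eq_rpow]
    norm_num
    ring
  have hval : ∫ u in Set.Ioi (0 : ℝ), √u * (δ * exp (-δ * u)) = √π / 2 / √δ := by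
    rw [setIntegral_congr_fun measurableSet_Ioi e, integral_const_mul,
      integral_rpow_mul_exp_neg_mul_Ioi (by norm_num) hδ,
      show (3 : ℝ) / 2 = 1 / 2 + 1 by norm_num, Gamma_add_one (by norm_num), Gamma_one_half_eq,
      rpow_add_one (by positivity), ← sqrt_eq_rpow, sqrt_div zero_le_one, sqrt_one]
    field_simp
  rw [← hval]
  refine intervalIntegral_tendsto_integral_Ioi 0 ?_ tendsto_id
  by_contra h
  have h0 := integral_undef h
  rw [hval] at h0
  have : 0 < √π / 2 / √δ := by positivity
  linarith

variable {c : ℕ → ℝ} {δ F a K : ℝ}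

theorem tendsto_sum_Ioc_of_hasSum {t : ℕ → ℝ} (h0 : t 0 = 0) (hs : HasSum t F) :
    Tendsto (fun N => ∑ n ∈ Ioc 0 N, t n) atTop (𝓝 F) := by
  have h := (tendsto_add_atTop_iff_nat 1).2 hs.tendsto_sum_nat
  refine h.congr fun N => ?_
  rw [Finset.sum_range_succ', h0, add_zero]
  induction N with
  | zero => simp
  | succ N ih => rw [Finset.sum_range_succ, ih, Finset.sum_Ioc_succ_top (Nat.zero_le N)]

theorem tendsto_exp_neg_mul_log (hδ : 0 < δ) :
    Tendsto (fun N : ℕ => exp (-δ * log N)) atTop (𝓝 0) := by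
  refine tendsto_exp_atBot.comp ?_
  exact tendsto_log_cast_atTop.const_mul_atTop_of_neg (by linarith)

/-- An Abelian theorem, as an upper bound. -/
theorem hasSum_le_of_sum_le_sqrt_log (hδ : 0 < δ) (ha : 0 ≤ a) (h0 : c 0 = 0)
    (hs : HasSum (fun n : ℕ => c n * exp (-δ * log n)) F)
    (hL : ∀ N : ℕ, 1 ≤ N → ∑ n ∈ Ioc 0 N, c n ≤ a * √(log N) + K) :
    F ≤ a * (√π / 2 / √δ) + K := by
  have key : ∀ N : ℕ, 1 ≤ N → ∑ n ∈ Ioc 0 N, c n * exp (-δ * log n) -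
      (∑ n ∈ Ioc 0 N, c n) * exp (-δ * log N) ≤
      a * (∫ u in (0 : ℝ)..log N, √u * (δ * exp (-δ * u))) + K * (1 - exp (-δ * log N)) := by
    intro N hN
    induction N, hN using Nat.le_induction with
    | base => simp
    | succ N hN ih =>
      have hN0 : (0 : ℝ) < N := by exact_mod_cast hN
      have hl : log (N : ℝ) ≤ log ((N + 1 : ℕ) : ℝ) := log_le_log hN0 (by push_cast; linarith)
      have h1 := (integral_sqrt_mul_exp_bounds hδ hl).1
      have h3 : exp (-δ * log ((N + 1 : ℕ) : ℝ)) ≤ exp (-δ * log N) := by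
        apply exp_le_exp.2; nlinarith
      have h4 := mul_le_mul_of_nonneg_right (hL N hN) (sub_nonneg.2 h3)
      have h5 := mul_le_mul_of_nonneg_left h1 ha
      rw [← integral_sqrt_mul_exp_add δ (log N) (log ((N + 1 : ℕ) : ℝ))]
      simp only [Finset.sum_Ioc_succ_top (Nat.zero_le N)]
      nlinarith
  have hlim : Tendsto (fun N : ℕ => a * (∫ u in (0 : ℝ)..log N, √u * (δ * exp (-δ * u))) + K +
      a * (log (N : ℝ) ^ (1 / 2 : ℝ) * exp (-δ * log N))) atTop
      (𝓝 (a * (√π / 2 / √δ) + K + a * 0)) :=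
    ((((tendsto_integral_sqrt_mul_exp hδ).comp tendsto_log_cast_atTop).const_mul a).add_const
      K).add (((tendsto_rpow_mul_exp_neg_mul_atTop_nhds_zero (1 / 2) δ hδ).comp
        tendsto_log_cast_atTop).const_mul a)
  rw [mul_zero, add_zero] at hlim
  refine le_of_tendsto_of_tendsto (tendsto_sum_Ioc_of_hasSum (by simp [h0]) hs) hlim ?_
  filter_upwards [eventually_ge_atTop 1] with N hN
  have h1 := key N hN
  have h2 := mul_le_mul_of_nonneg_right (hL N hN) (exp_nonneg (-δ * log N))
  rw [← sqrt_eq_rpow]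
  nlinarith

/-- An Abelian theorem, as a lower bound. -/
theorem le_hasSum_of_sqrt_log_le_sum (hδ : 0 < δ) (ha : 0 ≤ a) (h0 : c 0 = 0)
    (hc : ∀ n, 0 ≤ c n)
    (hs : HasSum (fun n : ℕ => c n * exp (-δ * log n)) F)
    (hL : ∀ N : ℕ, 1 ≤ N → a * √(log N) - K ≤ ∑ n ∈ Ioc 0 N, c n) :
    a * (√π / 2 / √δ) - (K + a) ≤ F := by
  have key : ∀ N : ℕ, 1 ≤ N →
      a * (∫ u in (0 : ℝ)..log N, √u * (δ * exp (-δ * u))) -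
        (K + a) * (1 - exp (-δ * log N)) ≤
      ∑ n ∈ Ioc 0 N, c n * exp (-δ * log n) - (∑ n ∈ Ioc 0 N, c n) * exp (-δ * log N) := by
    intro N hN
    induction N, hN using Nat.le_induction with
    | base => simp
    | succ N hN ih =>
      have hN1 : (1 : ℝ) ≤ N := by exact_mod_cast hN
      have hN0 : (0 : ℝ) < N := by linarith
      have hl : log (N : ℝ) ≤ log ((N + 1 : ℕ) : ℝ) := log_le_log hN0 (by push_cast; linarith)
      have hl0 : 0 ≤ log (N : ℝ) := log_nonneg hN1
      have h1 := (integral_sqrt_mul_exp_bounds hδ hl).2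
      have h3 : exp (-δ * log ((N + 1 : ℕ) : ℝ)) ≤ exp (-δ * log N) := by
        apply exp_le_exp.2; nlinarith
      have h6 : log ((N + 1 : ℕ) : ℝ) ≤ log N + 1 := by
        have : log ((N + 1 : ℕ) : ℝ) - log N ≤ 1 := by
          rw [← log_div (by positivity) hN0.ne']
          refine (log_le_sub_one_of_pos (by positivity)).trans ?_
          push_cast
          rw [add_div, div_self hN0.ne']
          have : 1 / (N : ℝ) ≤ 1 := by rw [div_le_one hN0]; exact hN1
          linarith
        linarith
      have h7 : √(log ((N + 1 : ℕ) : ℝ)) ≤ √(log (N : ℝ)) + 1 := by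
        rw [sqrt_le_left (by positivity)]
        have := sq_sqrt hl0
        have := sqrt_nonneg (log (N : ℝ))
        nlinarith
      have h8 : a * √(log ((N + 1 : ℕ) : ℝ)) - (K + a) ≤ ∑ n ∈ Ioc 0 N, c n := by
        have := hL N hN
        nlinarith
      have h4 := mul_le_mul_of_nonneg_right h8 (sub_nonneg.2 h3)
      have h5 := mul_le_mul_of_nonneg_left h1 ha
      rw [← integral_sqrt_mul_exp_add δ (log N) (log ((N + 1 : ℕ) : ℝ))]
      simp only [Finset.sum_Ioc_succ_top (Nat.zero_le N)]
      nlinarith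
  have hlim : Tendsto (fun N : ℕ => a * (∫ u in (0 : ℝ)..log N, √u * (δ * exp (-δ * u))) -
      (K + a) * (1 - exp (-δ * log N))) atTop
      (𝓝 (a * (√π / 2 / √δ) - (K + a) * (1 - 0))) :=
    (((tendsto_integral_sqrt_mul_exp hδ).comp tendsto_log_cast_atTop).const_mul a).sub
      (((tendsto_exp_neg_mul_log hδ).const_sub 1).const_mul (K + a))
  rw [sub_zero, mul_one] at hlim
  refine le_of_tendsto_of_tendsto hlim (tendsto_sum_Ioc_of_hasSum (by simp [h0]) hs) ?_
  filter_upwards [eventually_ge_atTop 1] with N hN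
  have h1 := key N hN
  have h2 : 0 ≤ (∑ n ∈ Ioc 0 N, c n) * exp (-δ * log N) :=
    mul_nonneg (Finset.sum_nonneg fun n _ => hc n) (exp_nonneg _)
  linarith

end Abelian

section UpperBound

theorem exists_le_add_const_of_eventually_le {x y : ℕ → ℝ} (h : ∀ᶠ N in atTop, x N ≤ y N) :
    ∃ K, 0 ≤ K ∧ ∀ N, x N ≤ y N + K := by
  obtain ⟨N₀, hN₀⟩ := eventually_atTop.1 h
  refine ⟨∑ n ∈ range N₀, |x n - y n|, Finset.sum_nonneg fun _ _ => abs_nonneg _, fun N => ?_⟩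
  have h0 : 0 ≤ ∑ n ∈ range N₀, |x n - y n| := Finset.sum_nonneg fun _ _ => abs_nonneg _
  rcases le_or_gt N₀ N with hN | hN
  · linarith [hN₀ N hN]
  · have := Finset.single_le_sum (f := fun n => |x n - y n|) (fun _ _ => abs_nonneg _)
      (mem_range.2 hN)
    have := le_abs_self (x N - y N)
    linarith

variable {f : ℕ → ℝ} {B c : ℝ}

theorem le_of_tendsto_logMean {F : ℝ → ℝ} (f0 : ∀ n, 0 ≤ f n)
    (hF : ∀ δ, 0 < δ → HasSum (fun n : ℕ => f n * (1 / (n : ℝ)) * exp (-δ * log n)) (F δ))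
    (hlim : Tendsto (fun δ => √δ * F δ) (𝓝[>] 0) (𝓝 1)) (hc : 0 ≤ c)
    (hL : Tendsto (fun N : ℕ => (∑ n ∈ Ioc 0 N, f n * (1 / (n : ℝ))) / √(log N)) atTop (𝓝 c)) :
    c ≤ 2 / √π := by
  have hpi : 0 < √π := sqrt_pos.2 pi_pos
  rcases hc.eq_or_lt with rfl | hc
  · positivity
  refine le_of_forall_lt_imp_le_of_dense fun a hac => ?_
  rcases le_or_gt a 0 with ha | ha
  · exact ha.trans (by positivity)
  have hev : ∀ᶠ N : ℕ in atTop, a * √(log N) ≤ ∑ n ∈ Ioc 0 N, f n * (1 / (n : ℝ)) := by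
    filter_upwards [hL.eventually (lt_mem_nhds hac), tendsto_log_cast_atTop.eventually_gt_atTop 0]
      with N h1 h2
    rw [lt_div_iff₀ (sqrt_pos.2 h2)] at h1
    exact h1.le
  obtain ⟨K, -, hK⟩ := exists_le_add_const_of_eventually_le hev
  have h1 : ∀ δ, 0 < δ → a * (√π / 2) - (K + a) * √δ ≤ √δ * F δ := by
    intro δ hδ
    have hs : 0 < √δ := sqrt_pos.2 hδ
    have h2 := le_hasSum_of_sqrt_log_le_sum hδ ha.le (by simp)
      (fun n => mul_nonneg (f0 n) (by positivity)) (hF δ hδ)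
      (fun N _ => by have := hK N; linarith)
    have h3 := mul_le_mul_of_nonneg_left h2 hs.le
    refine le_trans (le_of_eq ?_) h3
    field_simp
  have h2 : Tendsto (fun δ : ℝ => a * (√π / 2) - (K + a) * √δ) (𝓝[>] 0)
      (𝓝 (a * (√π / 2) - (K + a) * √0)) :=
    ((continuous_const.sub (continuous_const.mul continuous_sqrt)).tendsto 0).mono_left
      nhdsWithin_le_nhds
  have h3 := le_of_tendsto_of_tendsto h2 hlim (by
    filter_upwards [self_mem_nhdsWithin] with δ hδ using h1 δ hδ)
  rw [sqrt_zero, mul_zero, sub_zero] at h3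
  rw [le_div_iff₀ hpi]
  linarith

theorem sum_mul_log_sub_le (f1 : ∀ n, f n ≤ 1) {N : ℕ} (hN : 1 ≤ N) :
    ∑ n ∈ Ioc 0 N, f n * (log N - log n) ≤ N := by
  have h1 := (sum_Ioc_log_bounds N hN).1
  calc ∑ n ∈ Ioc 0 N, f n * (log N - log n) ≤ ∑ n ∈ Ioc 0 N, (log N - log (n : ℝ)) := by
        refine Finset.sum_le_sum fun n hn => ?_
        rw [mem_Ioc] at hn
        have : log (n : ℝ) ≤ log N := log_le_log (by exact_mod_cast hn.1) (by exact_mod_cast hn.2)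
        nlinarith [f1 n]
    _ = N * log N - ∑ n ∈ Ioc 0 N, log (n : ℝ) := by
        simp [Finset.sum_sub_distrib]
    _ ≤ N := by linarith

theorem sum_mul_log_le (f0 : ∀ n, 0 ≤ f n) (f1 : ∀ n, f n ≤ 1)
    (fmul : ∀ a b, f (a * b) = f a * f b) {N : ℕ} (hN : 1 ≤ N) :
    (∑ n ∈ Ioc 0 N, f n) * log N ≤ 6 * N * (∑ n ∈ Ioc 0 N, f n * (1 / (n : ℝ))) + N := by
  have h1 := sum_mul_log_sub_le f1 hN
  have h2 := sum_mul_log_eq_sum_sum_vonMangoldt fmul N (fun _ => 1) (fun _ _ => 1) (fun _ _ => rfl)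
  simp only [mul_one] at h2
  have h3 : ∑ m ∈ Ioc 0 N, f m * ∑ k ∈ Ioc 0 (N / m), Λ k * f k ≤
      6 * N * ∑ n ∈ Ioc 0 N, f n * (1 / (n : ℝ)) := by
    rw [Finset.mul_sum]
    refine Finset.sum_le_sum fun m _ => ?_
    have h4 : ∑ k ∈ Ioc 0 (N / m), Λ k * f k ≤ 6 * ((N : ℝ) / m) :=
      calc _ ≤ ∑ k ∈ Ioc 0 (N / m), Λ k :=
            Finset.sum_le_sum fun k _ => mul_le_of_le_one_right vonMangoldt_nonneg (f1 k)
        _ ≤ 6 * ((N / m : ℕ) : ℝ) := sum_Ioc_vonMangoldt_le _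
        _ ≤ _ := by have := Nat.cast_div_le (m := N) (n := m) (α := ℝ); linarith
    refine (mul_le_mul_of_nonneg_left h4 (f0 m)).trans (le_of_eq (by ring))
  have h5 : (∑ n ∈ Ioc 0 N, f n) * log N =
      ∑ n ∈ Ioc 0 N, f n * (log N - log n) + ∑ n ∈ Ioc 0 N, f n * log n := by
    rw [← Finset.sum_add_distrib, Finset.sum_mul]
    exact Finset.sum_congr rfl fun n _ => by ring
  rw [h5, h2]
  linarith

theorem sum_mul_log_sq_le (f0 : ∀ n, 0 ≤ f n) (f1 : ∀ n, f n ≤ 1)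
    (fmul : ∀ a b, f (a * b) = f a * f b)
    (hf : ∀ n : ℕ, |∑ k ∈ Ioc 0 n, Λ k * (2 * f k - 1)| ≤ B * √(n : ℝ)) {N : ℕ} (hN : 1 ≤ N) :
    (∑ n ∈ Ioc 0 N, f n) * log N ^ 2 ≤
      N * ((log N / 3 + (44 + 12 * B)) * (∑ n ∈ Ioc 0 N, f n * (1 / (n : ℝ))) + 2 * log N) +
      (∑ k ∈ Ioc 0 N, Λ k * log k * ∑ m ∈ Ioc 0 (N / k), f m) / 4 := by
  have hN0 : (0 : ℝ) < N := by exact_mod_cast hN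
  have hU : 0 ≤ log (N : ℝ) := log_nonneg (by exact_mod_cast hN)
  have hB : 0 ≤ B := by simpa using (abs_nonneg _).trans (hf 1)
  set L := ∑ n ∈ Ioc 0 N, f n * (1 / (n : ℝ)) with hL
  have hL0 : 0 ≤ L := Finset.sum_nonneg fun n _ => mul_nonneg (f0 n) (by positivity)
  set G : ℕ → ℝ := fun M => ∑ k ∈ Ioc 0 M, Λ k * f k with hG
  set W : ℕ → ℝ := fun M => ∑ k ∈ Ioc 0 M, Λ k * f k * log k +
    ∑ k ∈ Ioc 0 M, Λ k * f k * G (M / k) with hW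
  have e1 := sum_mul_log_eq_sum_sum_vonMangoldt fmul N (fun n => log (n : ℝ))
    (fun a b => log ((a * b : ℕ) : ℝ)) (fun _ _ => rfl)
  have e2 := sum_mul_log_eq_sum_sum_vonMangoldt fmul N (fun n => G (N / n))
    (fun a b => G (N / a / b)) (fun a b => by rw [Nat.div_div_eq_div_mul])
  have e3 : ∑ n ∈ Ioc 0 N, f n * log n * log n = ∑ m ∈ Ioc 0 N, f m * W (N / m) := by
    rw [e1]
    simp only [hW, mul_add, Finset.sum_add_distrib]
    rw [← e2, ← Finset.sum_add_distrib]
    refine Finset.sum_congr rfl fun m hm => ?_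
    rw [mem_Ioc] at hm
    have hm0 : (m : ℝ) ≠ 0 := by exact_mod_cast hm.1.ne'
    have : ∀ k ∈ Ioc 0 (N / m), Λ k * f k * log ((m * k : ℕ) : ℝ) =
        Λ k * f k * log k + Λ k * f k * log m := by
      intro k hk
      rw [mem_Ioc] at hk
      have hk0 : (k : ℝ) ≠ 0 := by exact_mod_cast hk.1.ne'
      rw [Nat.cast_mul, log_mul hm0 hk0]; ring
    rw [Finset.sum_congr rfl this, Finset.sum_add_distrib, ← Finset.sum_mul]
    simp only [hG]
    ring
  have h1 : (∑ n ∈ Ioc 0 N, f n) * log N ^ 2 ≤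
      ∑ m ∈ Ioc 0 N, f m * W (N / m) + 2 * log N * N := by
    have h2 := mul_le_mul_of_nonneg_left (sum_mul_log_sub_le f1 hN)
      (show 0 ≤ 2 * log (N : ℝ) by linarith)
    have h3 : (∑ n ∈ Ioc 0 N, f n) * log N ^ 2 ≤ ∑ n ∈ Ioc 0 N, f n * log n * log n +
        2 * log N * ∑ n ∈ Ioc 0 N, f n * (log N - log n) := by
      rw [Finset.sum_mul, Finset.mul_sum, ← Finset.sum_add_distrib]
      refine Finset.sum_le_sum fun n _ => ?_
      have := mul_nonneg (f0 n) (sq_nonneg (log N - log (n : ℝ)))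
      nlinarith
    rw [← e3]
    linarith
  have h2 : ∑ m ∈ Ioc 0 N, f m * W (N / m) ≤
      N * ((∑ n ∈ Ioc 0 N, f n * (1 / (n : ℝ)) * (log N - log n)) / 2) +
      (∑ k ∈ Ioc 0 N, Λ k * log k * ∑ m ∈ Ioc 0 (N / k), f m) / 4 + (42 + 11 * B) * N * L := by
    have e4 : ∑ k ∈ Ioc 0 N, Λ k * log k * ∑ m ∈ Ioc 0 (N / k), f m =
        ∑ m ∈ Ioc 0 N, f m * ∑ k ∈ Ioc 0 (N / m), Λ k * log k := by
      simp only [Finset.mul_sum]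
      rw [sum_Ioc_sum_Ioc_div_comm N (fun k m => Λ k * log k * f m)]
      exact Finset.sum_congr rfl fun m _ => Finset.sum_congr rfl fun k _ => by ring
    rw [e4, hL, Finset.mul_sum, Finset.sum_div, Finset.sum_div, Finset.mul_sum,
      ← Finset.sum_add_distrib, ← Finset.sum_add_distrib]
    refine Finset.sum_le_sum fun m hm => ?_
    rw [mem_Ioc] at hm
    have h3 := sum_half_vonMangoldt_selberg_le f0 f1 hf (N / m)
      ((Nat.one_le_div_iff hm.1).2 hm.2)
    have h4 : ((N / m : ℕ) : ℝ) ≤ N * (1 / (m : ℝ)) := by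
      rw [mul_one_div]; exact Nat.cast_div_le
    have h5 := (log_cast_div_bounds hm.1 hm.2).1
    have h6 : 0 ≤ log ((N / m : ℕ) : ℝ) := log_natCast_nonneg _
    have h7 : ((N / m : ℕ) : ℝ) * log ((N / m : ℕ) : ℝ) ≤
        N * (1 / (m : ℝ)) * (log N - log m) := by gcongr
    have h8 : W (N / m) ≤ N * (1 / (m : ℝ)) * (log N - log m) / 2 +
        (∑ k ∈ Ioc 0 (N / m), Λ k * log k) / 4 + (42 + 11 * B) * (N * (1 / (m : ℝ))) := by
      have := mul_le_mul_of_nonneg_left h4 (show 0 ≤ 42 + 11 * B by positivity)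
      simp only [hW, hG]
      linarith
    refine (mul_le_mul_of_nonneg_left h8 (f0 m)).trans (le_of_eq (by ring))
  have h3 := (abs_le.1 (abs_log_mul_logMean_sub_le f0 fmul hf N)).1
  rw [← hL] at h3
  have h4 := mul_le_mul_of_nonneg_left h3 hN0.le
  have h5 : 0 ≤ N * (B * L) := by positivity
  have h6 : 0 ≤ N * L := by positivity
  nlinarith

end UpperBound

section Bootstrap

theorem sub_mul_div_sqrt_le {V a b : ℝ} (hab : a ≤ b) (hb : b < V) (ha : 0 ≤ a) :
    (b - a) * (a / √(V - a)) ≤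
      (-2 * b * √(V - b) - 4 / 3 * ((V - b) * √(V - b))) -
        (-2 * a * √(V - a) - 4 / 3 * ((V - a) * √(V - a))) := by
  have hp : 0 < √(V - a) := sqrt_pos.2 (by linarith)
  have hq : 0 < √(V - b) := sqrt_pos.2 (by linarith)
  have hqp : √(V - b) ≤ √(V - a) := sqrt_le_sqrt (by linarith)
  have ep : √(V - a) ^ 2 = V - a := sq_sqrt (by linarith)
  have eq : √(V - b) ^ 2 = V - b := sq_sqrt (by linarith)
  set p := √(V - a)
  set q := √(V - b)
  clear_value p q
  obtain rfl : a = V - p ^ 2 := by linarith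
  obtain rfl : b = V - q ^ 2 := by linarith
  rw [← mul_div_assoc, div_le_iff₀ hp]
  have h1 : 0 ≤ (p - q) * (p - q) * (V - p ^ 2) :=
    mul_nonneg (mul_nonneg (by linarith) (by linarith)) ha
  have h2 : 0 ≤ (p - q) * ((p - q) * (2 * p + q)) :=
    mul_nonneg (by linarith) (mul_nonneg (by linarith) (by positivity))
  have h3 := mul_nonneg h2 hp.le
  have h4 : 0 ≤ (p - q) * (p - q) * p ^ 2 :=
    mul_nonneg (mul_nonneg (by linarith) (by linarith)) (by positivity)
  nlinarith

/-- A Riemann sum for `∫ u / √(1 + log N - u)`, weighted by the von Mangoldt function. -/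
theorem sum_vonMangoldt_div_mul_le {N : ℕ} (hN : 1 ≤ N) :
    ∑ k ∈ Ioc 0 N, Λ k * (1 / (k : ℝ)) * (log k / √(1 + log N - log k)) ≤
      4 / 3 * ((1 + log N) * √(1 + log N)) + 15 * log N := by
  set h : ℕ → ℝ := fun k => log k / √(1 + log N - log k) with hh
  have hlog : ∀ k, 1 ≤ k → k ≤ N → 0 ≤ log (k : ℝ) ∧ log (k : ℝ) ≤ log N := fun k h1 h2 =>
    ⟨log_natCast_nonneg k, log_le_log (by exact_mod_cast h1) (by exact_mod_cast h2)⟩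
  have h1 := abs_sum_Ioc_mul_le_of_monotone (h := h) (N := N) (B := 7)
    (c := fun k => Λ k * (1 / (k : ℝ)) - (log ((k : ℝ) + 1) - log k))
    (fun n _ => by
      have ht : ∑ k ∈ Ioc 0 n, (log ((k : ℝ) + 1) - log k) = log ((n : ℝ) + 1) := by
        clear * -
        induction n with
        | zero => simp
        | succ n ih => rw [Finset.sum_Ioc_succ_top (Nat.zero_le n), ih]; push_cast; ring
      rw [Finset.sum_sub_distrib, ht]
      rcases Nat.eq_zero_or_pos n with rfl | hn
      · simp
      have h2 := abs_le.1 (abs_sum_Ioc_vonMangoldt_div_sub_log_le n hn)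
      have hn0 : (0 : ℝ) < n := by exact_mod_cast hn
      have hn1 : (1 : ℝ) ≤ n := by exact_mod_cast hn
      have h3 : log (n : ℝ) ≤ log ((n : ℝ) + 1) := log_le_log hn0 (by linarith)
      have h4 : log ((n : ℝ) + 1) - log n ≤ 1 := by
        rw [← log_div (by positivity) hn0.ne']
        refine (log_le_sub_one_of_pos (by positivity)).trans ?_
        rw [add_div, div_self hn0.ne']
        have : 1 / (n : ℝ) ≤ 1 := by rw [div_le_one hn0]; exact hn1
        linarith
      rw [abs_le]
      constructor <;> linarith)
    (fun n hn hnN => by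
      obtain ⟨a1, a2⟩ := hlog n hn hnN.le
      obtain ⟨b1, b2⟩ := hlog (n + 1) (by lia) hnN
      have h3 : log (n : ℝ) ≤ log ((n + 1 : ℕ) : ℝ) :=
        log_le_log (by exact_mod_cast hn) (by push_cast; linarith)
      have h4 : 0 < √(1 + log N - log ((n + 1 : ℕ) : ℝ)) := sqrt_pos.2 (by linarith)
      simp only [hh]
      gcongr)
    (by simp [hh]) hN
  have hhN : h N = log N := by simp [hh]
  rw [hhN] at h1
  have h2 := (abs_le.1 h1).2
  have h2' : ∑ k ∈ Ioc 0 N, (Λ k * (1 / (k : ℝ)) - (log ((k : ℝ) + 1) - log k)) * h k =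
      ∑ k ∈ Ioc 0 N, Λ k * (1 / (k : ℝ)) * h k -
        ∑ k ∈ Ioc 0 N, (log ((k : ℝ) + 1) - log k) * h k := by
    rw [← Finset.sum_sub_distrib]
    exact Finset.sum_congr rfl fun k _ => sub_mul _ _ _
  rw [h2'] at h2
  have h3 : ∀ n, 1 ≤ n → n ≤ N →
      ∑ k ∈ Ioc 0 (n - 1), (log ((k : ℝ) + 1) - log k) * h k ≤
        (-2 * log n * √(1 + log N - log n) -
          4 / 3 * ((1 + log N - log n) * √(1 + log N - log n))) +
        4 / 3 * ((1 + log N) * √(1 + log N)) := by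
    intro n hn
    induction n, hn using Nat.le_induction with
    | base => intro _; simp
    | succ n hn ih =>
      intro hnN
      have ih := ih (by lia)
      obtain ⟨a1, a2⟩ := hlog n hn (by lia)
      obtain ⟨b1, b2⟩ := hlog (n + 1) (by lia) hnN
      have h3 : log (n : ℝ) ≤ log ((n + 1 : ℕ) : ℝ) :=
        log_le_log (by exact_mod_cast hn) (by push_cast; linarith)
      have h4 := sub_mul_div_sqrt_le (V := 1 + log N) h3 (by linarith) a1
      obtain ⟨m, rfl⟩ : ∃ m, n = m + 1 := ⟨n - 1, by lia⟩
      simp only [Nat.add_sub_cancel] at ih ⊢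
      rw [Finset.sum_Ioc_succ_top (Nat.zero_le m)]
      simp only [hh] at ih ⊢
      have e : ((m + 1 + 1 : ℕ) : ℝ) = ((m + 1 : ℕ) : ℝ) + 1 := by push_cast; ring
      rw [e] at h4 ⊢
      linarith
  have h4 : (log ((N : ℝ) + 1) - log N) * log N ≤ log N := by
    have hn0 : (0 : ℝ) < N := by exact_mod_cast hN
    have h4 : log ((N : ℝ) + 1) - log N ≤ 1 := by
      rw [← log_div (by positivity) hn0.ne']
      refine (log_le_sub_one_of_pos (by positivity)).trans ?_
      rw [add_div, div_self hn0.ne']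
      have : 1 / (N : ℝ) ≤ 1 := by rw [div_le_one hn0]; exact_mod_cast hN
      linarith
    exact mul_le_of_le_one_left (log_natCast_nonneg N) h4
  have h5 := h3 N hN le_rfl
  have h6 : ∑ k ∈ Ioc 0 N, (log ((k : ℝ) + 1) - log k) * h k =
      ∑ k ∈ Ioc 0 (N - 1), (log ((k : ℝ) + 1) - log k) * h k +
        (log ((N : ℝ) + 1) - log N) * log N := by
    obtain ⟨m, rfl⟩ : ∃ m, N = m + 1 := ⟨N - 1, by lia⟩
    rw [Finset.sum_Ioc_succ_top (Nat.zero_le m), Nat.add_sub_cancel, hhN]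
  have h7 := log_natCast_nonneg N
  rw [add_sub_cancel_right, sqrt_one] at h5
  linarith

theorem div_sqrt_one_add_log_le {x y : ℝ} (hx : 1 ≤ x) (hxy : x ≤ y) :
    x / √(1 + log x) ≤ y / √(1 + log y) := by
  have hx0 : 0 < x := by linarith
  have hlx : 0 ≤ log x := log_nonneg hx
  have hly : 0 ≤ log y := log_nonneg (hx.trans hxy)
  have ht : 1 ≤ y / x := by rwa [le_div_iff₀ hx0, one_mul]
  have hlt : log (y / x) ≤ y / x - 1 := log_le_sub_one_of_pos (by linarith)
  have e : log y = log x + log (y / x) := by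
    rw [log_div (by linarith) hx0.ne']; ring
  have h1 : √(1 + log y) ≤ y / x * √(1 + log x) := by
    rw [sqrt_le_left (by positivity), mul_pow, sq_sqrt (by linarith), e]
    have h2 : 0 ≤ y / x * (y / x - 1) * (1 + log x) :=
      mul_nonneg (mul_nonneg (by linarith) (by linarith)) (by linarith)
    have h3 : 0 ≤ (y / x - 1) * log x := mul_nonneg (by linarith) hlx
    nlinarith
  rw [div_le_div_iff₀ (sqrt_pos.2 (by linarith)) (sqrt_pos.2 (by linarith))]
  calc x * √(1 + log y) ≤ x * (y / x * √(1 + log x)) := by gcongr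
    _ = y * √(1 + log x) := by field_simp

theorem sum_vonMangoldt_mul_log_mul_le {S : ℕ → ℝ} {b K : ℝ} (hb : 0 ≤ b) (hK : 0 ≤ K)
    (hS : ∀ M : ℕ, 1 ≤ M → S M ≤ b * (M / √(1 + log M)) + K) {N : ℕ} (hN : 1 ≤ N) :
    ∑ k ∈ Ioc 0 N, Λ k * log k * S (N / k) ≤
      b * N * (4 / 3 * ((1 + log N) * √(1 + log N)) + 15 * log N) + 6 * K * N * log N := by
  have h1 := mul_le_mul_of_nonneg_left (sum_vonMangoldt_div_mul_le hN)
    (show 0 ≤ b * (N : ℝ) by positivity)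
  have h2 := mul_le_mul_of_nonneg_left (sum_Ioc_vonMangoldt_le N)
    (show 0 ≤ K * log (N : ℝ) from mul_nonneg hK (log_natCast_nonneg N))
  suffices h : ∑ k ∈ Ioc 0 N, Λ k * log k * S (N / k) ≤
      b * N * ∑ k ∈ Ioc 0 N, Λ k * (1 / (k : ℝ)) * (log k / √(1 + log N - log k)) +
      K * log N * ∑ k ∈ Ioc 0 N, Λ k by linarith
  rw [Finset.mul_sum, Finset.mul_sum, ← Finset.sum_add_distrib]
  refine Finset.sum_le_sum fun k hk => ?_
  rw [mem_Ioc] at hk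
  have hk0 : (0 : ℝ) < k := by exact_mod_cast hk.1
  have hN0 : (0 : ℝ) < N := by exact_mod_cast hN
  have hM : 1 ≤ N / k := (Nat.one_le_div_iff hk.1).2 hk.2
  have h3 := div_sqrt_one_add_log_le (show (1 : ℝ) ≤ ((N / k : ℕ) : ℝ) by exact_mod_cast hM)
    (Nat.cast_div_le (m := N) (n := k) (α := ℝ))
  rw [log_div hN0.ne' hk0.ne', ← add_sub_assoc] at h3
  have h4 := (hS _ hM).trans (add_le_add_left (mul_le_mul_of_nonneg_left h3 hb) K)
  have h5 : log (k : ℝ) ≤ log N := log_le_log hk0 (by exact_mod_cast hk.2)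
  have h6 : 0 ≤ log (k : ℝ) := log_natCast_nonneg k
  have h7 : 0 ≤ Λ k := vonMangoldt_nonneg
  calc Λ k * log k * S (N / k)
      ≤ Λ k * log k * (b * ((N : ℝ) / k / √(1 + log N - log k)) + K) := by gcongr
    _ = b * N * (Λ k * (1 / (k : ℝ)) * (log k / √(1 + log N - log k))) + Λ k * log k * K := by
        ring
    _ ≤ b * N * (Λ k * (1 / (k : ℝ)) * (log k / √(1 + log N - log k))) + Λ k * log N * K := by
        gcongr
    _ = _ := by ring

end Bootstrap

section MeanValue

variable {f : ℕ → ℝ} {B c : ℝ}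

theorem exists_eventually_sum_mul_sqrt_le (f0 : ∀ n, 0 ≤ f n) (f1 : ∀ n, f n ≤ 1)
    (fmul : ∀ a b, f (a * b) = f a * f b)
    (hL : Tendsto (fun N : ℕ => (∑ n ∈ Ioc 0 N, f n * (1 / (n : ℝ))) / √(log N)) atTop (𝓝 c)) :
    ∃ b, 0 ≤ b ∧ ∀ᶠ N : ℕ in atTop, (∑ n ∈ Ioc 0 N, f n) * √(1 + log N) / N ≤ b := by
  have hlim := (((hL.const_mul 6).add_const 1).add_const (1 + 1)).mul
    (tendsto_log_add_div_log 1)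
  refine ⟨|(6 * c + 1 + (1 + 1)) * 1| + 1, by positivity, ?_⟩
  have hlt : (6 * c + 1 + (1 + 1)) * 1 < |(6 * c + 1 + (1 + 1)) * 1| + 1 := by
    linarith [le_abs_self ((6 * c + 1 + (1 + 1)) * 1)]
  filter_upwards [hlim.eventually (gt_mem_nhds hlt), eventually_ge_atTop 1,
    tendsto_log_cast_atTop.eventually_ge_atTop 1] with N h1 hN hU
  refine le_trans ?_ h1.le
  have hN0 : (0 : ℝ) < N := by exact_mod_cast hN
  have h2 := sum_mul_log_le f0 f1 fmul hN
  set U := log (N : ℝ)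
  set L := ∑ n ∈ Ioc 0 N, f n * (1 / (n : ℝ))
  set S := ∑ n ∈ Ioc 0 N, f n
  have hL0 : 0 ≤ L := Finset.sum_nonneg fun n _ => mul_nonneg (f0 n) (by positivity)
  have hS0 : 0 ≤ S := Finset.sum_nonneg fun n _ => f0 n
  have hp : 1 ≤ √U := by rwa [one_le_sqrt]
  have ep : √U ^ 2 = U := sq_sqrt (by linarith)
  have hq : √(1 + U) ≤ √U * ((U + 1) / U) := by
    rw [sqrt_le_left (by positivity), mul_pow, ep, div_pow]
    rw [show U * ((U + 1) ^ 2 / U ^ 2) = (U + 1) ^ 2 / U by field_simp, le_div_iff₀ (by linarith)]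
    nlinarith
  calc S * √(1 + U) / N ≤ S * (√U * ((U + 1) / U)) / N := by gcongr
    _ = (S * √U / N) * ((U + 1) / U) := by ring
    _ ≤ (6 * (L / √U) + 1 + (1 + 1)) * ((U + 1) / U) := by
      gcongr
      rw [div_le_iff₀ hN0]
      have h3 : S * √U * √U ≤ (6 * N * L + N) := by nlinarith
      have h4 : S * √U ≤ (6 * N * L + N) / √U := by rwa [le_div_iff₀ (by linarith)]
      have h5 : (N : ℝ) / √U ≤ N := div_le_self hN0.le hp
      rw [add_div] at h4
      have h6 : 6 * N * L / √U = 6 * (L / √U) * N := by ring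
      nlinarith

theorem eventually_sum_mul_sqrt_le_of_le (f0 : ∀ n, 0 ≤ f n) (f1 : ∀ n, f n ≤ 1)
    (fmul : ∀ a b, f (a * b) = f a * f b)
    (hf : ∀ n : ℕ, |∑ k ∈ Ioc 0 n, Λ k * (2 * f k - 1)| ≤ B * √(n : ℝ))
    (hL : Tendsto (fun N : ℕ => (∑ n ∈ Ioc 0 N, f n * (1 / (n : ℝ))) / √(log N)) atTop (𝓝 c))
    {b ε : ℝ} (hb : 0 ≤ b) (hε : 0 < ε)
    (hs : ∀ᶠ N : ℕ in atTop, (∑ n ∈ Ioc 0 N, f n) * √(1 + log N) / N ≤ b) :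
    ∀ᶠ N : ℕ in atTop, (∑ n ∈ Ioc 0 N, f n) * √(1 + log N) / N ≤ c / 3 + b / 3 + ε := by
  have hs' : ∀ᶠ M : ℕ in atTop, ∑ n ∈ Ioc 0 M, f n ≤ b * (M / √(1 + log M)) := by
    filter_upwards [hs, eventually_ge_atTop 1] with M h1 hM
    have hM0 : (0 : ℝ) < M := by exact_mod_cast hM
    have h2 : 0 < √(1 + log (M : ℝ)) := sqrt_pos.2 (by linarith [log_natCast_nonneg M])
    rw [div_le_iff₀ hM0] at h1
    rwa [← mul_div_assoc, le_div_iff₀ h2]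
  obtain ⟨K, hK, hSK⟩ := exists_le_add_const_of_eventually_le hs'
  set C : ℝ := 44 + 12 * B with hC
  set D : ℝ := 2 + 15 / 4 * b + 3 / 2 * K with hD
  have hr := tendsto_log_add_div_log
  have hlim : Tendsto (fun N : ℕ => (∑ n ∈ Ioc 0 N, f n * (1 / (n : ℝ))) / √(log N) *
      √((log N + 1) / log N) * (1 / 3 * ((log N + 3 * C) / log N)) +
      b / 3 * ((log N + 1) / log N) ^ 2 + D * (√((log N + 1) / log N) * (√(log N))⁻¹)) atTop
      (𝓝 (c * √1 * (1 / 3 * 1) + b / 3 * 1 ^ 2 + D * (√1 * 0))) :=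
    (((hL.mul (hr 1).sqrt).mul ((hr _).const_mul _)).add (((hr 1).pow 2).const_mul _)).add
      (((hr 1).sqrt.mul (tendsto_inv_atTop_zero.comp
        (tendsto_sqrt_atTop.comp tendsto_log_cast_atTop))).const_mul D)
  have hlt : c * √1 * (1 / 3 * 1) + b / 3 * 1 ^ 2 + D * (√1 * 0) < c / 3 + b / 3 + ε := by
    rw [sqrt_one]; linarith
  filter_upwards [hlim.eventually (gt_mem_nhds hlt), eventually_ge_atTop 1,
    tendsto_log_cast_atTop.eventually_ge_atTop 1] with N h1 hN hU
  refine le_trans ?_ h1.le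
  have hN0 : (0 : ℝ) < N := by exact_mod_cast hN
  have h2 := sum_mul_log_sq_le f0 f1 fmul hf hN
  have h3 := sum_vonMangoldt_mul_log_mul_le hb hK (fun M _ => hSK M) hN
  set U := log (N : ℝ)
  set L := ∑ n ∈ Ioc 0 N, f n * (1 / (n : ℝ))
  set S := ∑ n ∈ Ioc 0 N, f n
  have hU0 : 0 < U := by linarith
  have h4 : S * U ^ 2 ≤
      N * ((U / 3 + C) * L + b / 3 * ((1 + U) * √(1 + U)) + D * U) := by
    simp only [hD]
    linarith
  have hp : 0 < √U := sqrt_pos.2 hU0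
  have hq : 0 < √(1 + U) := sqrt_pos.2 (by linarith)
  have ep : √U ^ 2 = U := sq_sqrt hU0.le
  have eq : √(1 + U) ^ 2 = 1 + U := sq_sqrt (by linarith)
  have e : L / √U * √((U + 1) / U) * (1 / 3 * ((U + 3 * C) / U)) +
      b / 3 * ((U + 1) / U) ^ 2 + D * (√((U + 1) / U) * (√U)⁻¹) =
      ((U / 3 + C) * L + b / 3 * ((1 + U) * √(1 + U)) + D * U) * √(1 + U) / U ^ 2 := by
    rw [sqrt_div (by linarith), add_comm U 1]
    have e1 : (1 + U) * √(1 + U) * √(1 + U) = (1 + U) ^ 2 := by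
      rw [mul_assoc, ← sq, eq]; ring
    have e2 : ((U / 3 + C) * L + b / 3 * ((1 + U) * √(1 + U)) + D * U) * √(1 + U) =
      (U / 3 + C) * L * √(1 + U) + b / 3 * (1 + U) ^ 2 + D * U * √(1 + U) := by
      rw [← e1]; ring
    rw [e2]
    generalize √(1 + U) = q
    have e3 : ∀ x : ℝ, x / √U / √U = x / U := fun x => by
      rw [div_div, ← sq, ep]
    have e4 : L / √U * (q / √U) = L * q / U := by
      rw [div_mul_div_comm, ← sq, ep]
    have e5 : q / √U * (√U)⁻¹ = q / U := by
      rw [← div_eq_mul_inv, e3]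
    rw [e4, e5]
    field_simp
  rw [e, div_le_div_iff₀ hN0 (by positivity)]
  have := mul_le_mul_of_nonneg_right h4 hq.le
  linarith

theorem eventually_sum_mul_sqrt_le (f0 : ∀ n, 0 ≤ f n) (f1 : ∀ n, f n ≤ 1)
    (fmul : ∀ a b, f (a * b) = f a * f b)
    (hf : ∀ n : ℕ, |∑ k ∈ Ioc 0 n, Λ k * (2 * f k - 1)| ≤ B * √(n : ℝ)) {F : ℝ → ℝ}
    (hF : ∀ δ, 0 < δ → HasSum (fun n : ℕ => f n * (1 / (n : ℝ)) * exp (-δ * log n)) (F δ))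
    (hlim : Tendsto (fun δ => √δ * F δ) (𝓝[>] 0) (𝓝 1)) {ε : ℝ} (hε : 0 < ε) :
    ∀ᶠ N : ℕ in atTop, (∑ n ∈ Ioc 0 N, f n) * √(1 + log N) / N ≤ 1 / √π + ε := by
  obtain ⟨c, hc, hL⟩ := exists_tendsto_logMean f0 fmul hf
  have hc2 := le_of_tendsto_logMean f0 hF hlim hc hL
  set G : Set ℝ := {b | 0 ≤ b ∧
    ∀ᶠ N : ℕ in atTop, (∑ n ∈ Ioc 0 N, f n) * √(1 + log N) / N ≤ b} with hG
  have hne : G.Nonempty := exists_eventually_sum_mul_sqrt_le f0 f1 fmul hL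
  have hbdd : BddBelow G := ⟨0, fun b hb => hb.1⟩
  have hstep : ∀ η, 0 < η → sInf G ≤ c / 2 + 2 * η := by
    intro η hη
    obtain ⟨b, hb, hbη⟩ := exists_lt_of_csInf_lt hne (lt_add_of_pos_right (sInf G) hη)
    have h1 := csInf_le hbdd (show c / 3 + b / 3 + η ∈ G from
      ⟨by have := hb.1; positivity, eventually_sum_mul_sqrt_le_of_le f0 f1 fmul hf hL hb.1 hη hb.2⟩)
    linarith
  have h2 : sInf G ≤ c / 2 := by
    refine le_of_forall_pos_le_add fun η hη => ?_
    have := hstep (η / 2) (by linarith)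
    linarith
  have h3 : sInf G < 1 / √π + ε := by
    have : c / 2 ≤ 1 / √π := by
      have : 2 / √π = 2 * (1 / √π) := by ring
      linarith
    linarith
  obtain ⟨b, hb, hbε⟩ := exists_lt_of_csInf_lt hne h3
  filter_upwards [hb.2] with N hN using hN.trans hbε.le

end MeanValue

section GreedySigns

/-- The weight of `p` in the logarithm of the Euler product at `s = 1`. -/
noncomputable def primeWeight (n : ℕ) : ℝ := -log (1 - 1 / n)

theorem inv_le_primeWeight {n : ℕ} (hn : 2 ≤ n) : 1 / (n : ℝ) ≤ primeWeight n := by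
  have hn' : (2 : ℝ) ≤ n := by exact_mod_cast hn
  have h : 1 / (n : ℝ) ≤ 1 / 2 := one_div_le_one_div_of_le two_pos hn'
  have := log_le_sub_one_of_pos (show 0 < 1 - 1 / (n : ℝ) by linarith)
  rw [primeWeight]
  linarith

theorem primeWeight_le {n : ℕ} (hn : 2 ≤ n) : primeWeight n ≤ 1 / ((n : ℝ) - 1) := by
  have hn' : (2 : ℝ) ≤ n := by exact_mod_cast hn
  have h : 1 / (n : ℝ) ≤ 1 / 2 := one_div_le_one_div_of_le two_pos hn'
  have h1 := one_sub_inv_le_log_of_pos (show 0 < 1 - 1 / (n : ℝ) by linarith)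
  have h2 : (1 - 1 / (n : ℝ))⁻¹ - 1 = 1 / ((n : ℝ) - 1) := by
    have : (n : ℝ) - 1 ≠ 0 := by linarith
    field_simp
    ring
  rw [primeWeight]
  linarith

theorem inv_sub_one_le_two_div {x : ℝ} (hx : 2 ≤ x) : 1 / (x - 1) ≤ 2 / x := by
  rw [div_le_div_iff₀ (by linarith) (by linarith)]
  linarith

theorem primeWeight_le_two_mul {p q : ℕ} (hp : 2 ≤ p) (hpq : p ≤ q) (hq : q + 1 ≤ 2 * p) :
    primeWeight p ≤ 2 * primeWeight q := by
  have hp' : (2 : ℝ) ≤ p := by exact_mod_cast hp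
  have hpq' : (p : ℝ) ≤ q := by exact_mod_cast hpq
  have hq' : (q : ℝ) + 1 ≤ 2 * p := by exact_mod_cast hq
  have h1 : 1 / (q : ℝ) ≤ 1 / 2 := one_div_le_one_div_of_le two_pos (hp'.trans hpq')
  have h2 : (1 - 1 / (q : ℝ)) ^ 2 ≤ 1 - 1 / (p : ℝ) := by
    have hq0 : 0 < (q : ℝ) := by linarith
    have hp0 : 0 < (p : ℝ) := by linarith
    have e : 1 - 1 / (p : ℝ) - (1 - 1 / (q : ℝ)) ^ 2 = ((2 * q - 1) * p - q ^ 2) / (p * q ^ 2) := by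
      field_simp
      ring
    have : 0 ≤ ((2 * q - 1) * p - q ^ 2) / ((p : ℝ) * q ^ 2) := by
      apply div_nonneg _ (by positivity)
      nlinarith
    linarith
  have h3 := log_le_log (by have : 0 < 1 - 1 / (q : ℝ) := by linarith
                            positivity) h2
  rw [log_pow] at h3
  push_cast at h3
  rw [primeWeight, primeWeight]
  linarith

/-- Partial sums of `± primeWeight p`, each sign being chosen against the current sum. -/
noncomputable def greedySum : ℕ → ℝ
  | 0 => 0
  | n + 1 => greedySum n + if (n + 1).Prime then
      (if greedySum n ≤ 0 then 1 else -1) * primeWeight (n + 1) else 0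

/-- The signs chosen by `greedySum`. -/
noncomputable def greedySign (n : ℕ) : ℝ := if greedySum (n - 1) ≤ 0 then 1 else -1

theorem greedySign_eq (n : ℕ) : greedySign n = 1 ∨ greedySign n = -1 := by
  rw [greedySign]
  split_ifs <;> simp

theorem abs_greedySign (n : ℕ) : |greedySign n| = 1 := by
  rcases greedySign_eq n with h | h <;> simp [h]

theorem greedySum_eq_sum (n : ℕ) :
    greedySum n = ∑ k ∈ Ioc 0 n, if k.Prime then greedySign k * primeWeight k else 0 := by
  induction n with
  | zero => simp [greedySum]
  | succ n ih => rw [sum_Ioc_succ_top (Nat.zero_le n), ← ih, greedySum, greedySign]; rfl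

theorem exists_prime_abs_greedySum_le {n : ℕ} (hn : 2 ≤ n) :
    ∃ p : ℕ, p.Prime ∧ p ≤ n ∧ n < 2 * p ∧ |greedySum n| ≤ primeWeight p := by
  suffices H : ∃ p : ℕ, p.Prime ∧ p ≤ n ∧ (∀ q : ℕ, q.Prime → q ≤ n → q ≤ p) ∧
      |greedySum n| ≤ primeWeight p by
    obtain ⟨p, hp, hpn, hmax, h⟩ := H
    obtain ⟨q, hq, hpq, hq2⟩ := Nat.exists_prime_lt_and_le_two_mul p hp.ne_zero
    refine ⟨p, hp, hpn, ?_, h⟩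
    by_contra! hc
    exact absurd (hmax q hq (by omega)) (by omega)
  induction n, hn using Nat.le_induction with
  | base =>
    refine ⟨2, Nat.prime_two, le_rfl, fun q _ h => h, ?_⟩
    have := inv_le_primeWeight (le_refl 2)
    have h0 : 0 ≤ primeWeight 2 := le_trans (by positivity) this
    simp [greedySum, Nat.prime_two, Nat.not_prime_one, abs_of_nonneg h0]
  | succ n hn ih =>
    obtain ⟨p, hp, hpn, hmax, h⟩ := ih
    by_cases hq : (n + 1).Prime
    · refine ⟨n + 1, hq, le_rfl, fun q _ h => h, ?_⟩
      obtain ⟨r, hr, hpr, hr2⟩ := Nat.exists_prime_lt_and_le_two_mul p hp.ne_zero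
      have h1 : n < r := by
        by_contra! hc
        exact absurd (hmax r hr hc) (by omega)
      have h2 : n + 1 ≠ 2 * p := fun e => by
        have := hp.two_le
        exact Nat.not_prime_mul (by norm_num) (by omega) (e ▸ hq)
      have h3 := primeWeight_le_two_mul hp.two_le (show p ≤ n + 1 by omega) (by omega)
      have h4 : 0 ≤ primeWeight (n + 1) := le_trans (by positivity) (inv_le_primeWeight hq.two_le)
      rw [abs_le] at h
      rw [greedySum, if_pos hq, abs_le]
      split_ifs with h0
      · constructor <;> linarith
      · push Not at h0
        constructor <;> linarith
    · refine ⟨p, hp, by omega, fun q hq' hqn => hmax q hq' ?_, ?_⟩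
      · rcases Nat.lt_or_ge n q with h' | h'
        · exact absurd ((show q = n + 1 by omega) ▸ hq') hq
        · exact h'
      · rw [greedySum, if_neg hq, add_zero]
        exact h

theorem abs_greedySum_le (n : ℕ) : |greedySum n| ≤ 4 / n := by
  rcases Nat.lt_or_ge n 2 with hn | hn
  · interval_cases n <;> simp [greedySum, Nat.not_prime_one]
  · obtain ⟨p, hp, hpn, hnp, h⟩ := exists_prime_abs_greedySum_le hn
    have hp2 : (2 : ℝ) ≤ p := by exact_mod_cast hp.two_le
    have hn2 : (n : ℝ) ≤ 2 * p := by exact_mod_cast hnp.le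
    have hn0 : (0 : ℝ) < n := by exact_mod_cast (by omega : 0 < n)
    refine (h.trans (primeWeight_le hp.two_le)).trans ((inv_sub_one_le_two_div hp2).trans ?_)
    rw [div_le_div_iff₀ (by linarith) hn0]
    linarith

theorem abs_sum_Ioc_mul_sub_le {c h g : ℕ → ℝ} {b : ℝ}
    (hc : ∀ n : ℕ, |∑ k ∈ Ioc 0 n, c k| ≤ b / n)
    (hg : ∀ k, 0 < k → |h (k + 1) - h k| ≤ g k) (n : ℕ) :
    |∑ k ∈ Ioc 0 n, c k * h k - (∑ k ∈ Ioc 0 n, c k) * h n| ≤ ∑ k ∈ Ioc 0 n, b / k * g k := by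
  have hb : 0 ≤ b := by simpa using (abs_nonneg _).trans (hc 1)
  suffices H : ∀ n, |∑ k ∈ Ioc 0 (n + 1), c k * h k - (∑ k ∈ Ioc 0 (n + 1), c k) * h (n + 1)| ≤
      ∑ k ∈ Ioc 0 n, b / k * g k by
    rcases n with _ | n
    · simp
    · refine (H n).trans ?_
      rw [sum_Ioc_succ_top (Nat.zero_le n)]
      have := (abs_nonneg _).trans (hg (n + 1) n.succ_pos)
      exact le_add_of_nonneg_right (by positivity)
  intro n
  induction n with
  | zero => simp
  | succ n ih =>
    rw [sum_Ioc_succ_top (Nat.zero_le (n + 1)), sum_Ioc_succ_top (Nat.zero_le (n + 1)),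
      sum_Ioc_succ_top (Nat.zero_le n) fun k : ℕ => b / k * g k]
    have e : ∑ k ∈ Ioc 0 (n + 1), c k * h k + c (n + 1 + 1) * h (n + 1 + 1) -
        (∑ k ∈ Ioc 0 (n + 1), c k + c (n + 1 + 1)) * h (n + 1 + 1) =
        (∑ k ∈ Ioc 0 (n + 1), c k * h k - (∑ k ∈ Ioc 0 (n + 1), c k) * h (n + 1)) -
          (∑ k ∈ Ioc 0 (n + 1), c k) * (h (n + 1 + 1) - h (n + 1)) := by ring
    rw [e]
    refine (abs_sub _ _).trans (add_le_add ih ?_)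
    rw [abs_mul]
    exact mul_le_mul (hc (n + 1)) (hg (n + 1) n.succ_pos) (abs_nonneg _) (by positivity)

theorem log_add_two_le_two_mul_sqrt {x : ℝ} (hx : 0 < x) : log x + 2 ≤ 2 * √x := by
  have := log_le_sub_one_of_pos (sqrt_pos.2 hx)
  rw [log_sqrt hx.le] at this
  linarith

theorem abs_succ_mul_log_sub_le {k : ℕ} (hk : 0 < k) :
    |((k + 1 : ℕ) : ℝ) * log (k + 1 : ℕ) - k * log k| ≤ 2 * √(k : ℝ) := by
  have hk1 : (1 : ℝ) ≤ k := by exact_mod_cast hk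
  have hk0 : (0 : ℝ) < k := by linarith
  have h1 := log_add_two_le_two_mul_sqrt hk0
  have h2 : log ((k : ℝ) + 1) - log k ≤ 1 / k := by
    rw [← log_div (by positivity) hk0.ne']
    refine (log_le_sub_one_of_pos (by positivity)).trans_eq ?_
    field_simp
    ring
  have h3 : log (k : ℝ) ≤ log ((k : ℝ) + 1) := log_le_log hk0 (by linarith)
  have h4 : 0 ≤ log (k : ℝ) := log_nonneg hk1
  push_cast
  rw [abs_of_nonneg (by nlinarith)]
  have h5 : ((k : ℝ) + 1) * (log ((k : ℝ) + 1) - log k) ≤ (k + 1) * (1 / k) :=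
    mul_le_mul_of_nonneg_left h2 (by positivity)
  have h6 : ((k : ℝ) + 1) * (1 / k) ≤ 2 := by
    rw [mul_one_div, div_le_iff₀ hk0]
    linarith
  linarith

theorem abs_sum_prime_greedySign_mul_log_le (n : ℕ) :
    |∑ k ∈ Ioc 0 n, if k.Prime then greedySign k * log k else 0| ≤ 32 * √(n : ℝ) := by
  set c : ℕ → ℝ := fun k => if k.Prime then greedySign k * primeWeight k else 0 with hc
  have hC : ∀ n : ℕ, |∑ k ∈ Ioc 0 n, c k| ≤ 4 / n := fun n => by
    rw [hc, ← greedySum_eq_sum]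
    exact abs_greedySum_le n
  have h1 := abs_sum_Ioc_mul_sub_le hC (h := fun k => (k : ℝ) * log k)
    (g := fun k => 2 * √(k : ℝ)) (fun k hk => abs_succ_mul_log_sub_le hk) n
  have h2 : ∑ k ∈ Ioc 0 n, 4 / (k : ℝ) * (2 * √(k : ℝ)) ≤ 16 * √(n : ℝ) := by
    have : ∀ k : ℕ, 4 / (k : ℝ) * (2 * √(k : ℝ)) = 8 * (1 / √(k : ℝ)) := fun k => by
      rw [← sqrt_div_self']
      ring
    simp_rw [this, ← mul_sum]
    linarith [sum_Ioc_inv_sqrt_le n]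
  have h3 : |(∑ k ∈ Ioc 0 n, c k) * (n * log n)| ≤ 8 * √(n : ℝ) := by
    rcases n.eq_zero_or_pos with rfl | hn
    · simp
    have hn1 : (1 : ℝ) ≤ n := by exact_mod_cast hn
    have hl := log_nonneg hn1
    rw [abs_mul, abs_of_nonneg (by positivity : 0 ≤ (n : ℝ) * log n)]
    have h := mul_le_mul_of_nonneg_right (hC n) (by positivity : 0 ≤ (n : ℝ) * log n)
    have e : 4 / (n : ℝ) * (n * log n) = 4 * log n := by field_simp
    linarith [log_add_two_le_two_mul_sqrt (by linarith : (0 : ℝ) < n)]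
  have h4 : |∑ k ∈ Ioc 0 n, c k * (k * log k) -
      ∑ k ∈ Ioc 0 n, (if k.Prime then greedySign k * log k else 0)| ≤ 8 * √(n : ℝ) := by
    rw [← sum_sub_distrib]
    refine (abs_sum_le_sum_abs _ _).trans ?_
    have : ∀ k ∈ Ioc 0 n, |c k * (k * log k) - (if k.Prime then greedySign k * log k else 0)| ≤
        4 * (1 / √(k : ℝ)) := by
      intro k _
      by_cases hk : k.Prime
      · have hk2 : (2 : ℝ) ≤ k := by exact_mod_cast hk.two_le
        have hk0 : (0 : ℝ) < k := by linarith
        have hl : 0 ≤ log (k : ℝ) := log_nonneg (by linarith)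
        simp only [hc, if_pos hk]
        have e : greedySign k * primeWeight k * (k * log k) - greedySign k * log k =
          greedySign k * (log k * (primeWeight k * k - 1)) := by ring
        have l1 : 0 ≤ primeWeight k * k - 1 := by
          have := inv_le_primeWeight hk.two_le
          rw [div_le_iff₀ hk0] at this
          linarith
        have l2 : primeWeight k * k - 1 ≤ 2 / k := by
          have := mul_le_mul_of_nonneg_right (primeWeight_le hk.two_le) hk0.le
          have e : 1 / ((k : ℝ) - 1) * k = 1 + 1 / ((k : ℝ) - 1) := by
            have : (k : ℝ) - 1 ≠ 0 := by linarith
            field_simp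
            ring
          linarith [inv_sub_one_le_two_div hk2]
        rw [e, abs_mul, abs_greedySign, one_mul, abs_of_nonneg (by positivity)]
        have l3 : log (k : ℝ) ≤ 2 * √(k : ℝ) := by linarith [log_add_two_le_two_mul_sqrt hk0]
        calc log (k : ℝ) * (primeWeight k * k - 1) ≤ 2 * √(k : ℝ) * (2 / k) :=
              mul_le_mul l3 l2 l1 (by positivity)
          _ = 4 * (1 / √(k : ℝ)) := by rw [← sqrt_div_self']; ring
      · simp only [hc, if_neg hk]
        simp
    refine (sum_le_sum this).trans ?_
    rw [← mul_sum]
    linarith [sum_Ioc_inv_sqrt_le n]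
  rw [abs_le] at h1 h3 h4 ⊢
  constructor <;> linarith [h1.1, h1.2, h3.1, h3.2, h4.1, h4.2]

theorem exists_abs_sum_vonMangoldt_mul_le : ∃ B : ℝ, ∀ (f : ℕ → ℝ) (σ : ℝ), |σ| = 1 →
    (∀ n, 0 ≤ f n) → (∀ n, f n ≤ 1) → (∀ p : ℕ, p.Prime → 2 * f p - 1 = σ * greedySign p) →
    ∀ n : ℕ, |∑ k ∈ Ioc 0 n, Λ k * (2 * f k - 1)| ≤ B * √(n : ℝ) := by
  obtain ⟨C, hC⟩ := Chebyshev.psi_sub_theta_le_mul_sqrt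
  refine ⟨32 + C, fun f σ hσ f0 f1 hf n => ?_⟩
  rw [← sum_filter_add_sum_filter_not _ Nat.Prime]
  refine (abs_add_le _ _).trans ?_
  rw [add_mul]
  refine add_le_add ?_ ?_
  · have : ∑ k ∈ Ioc 0 n with k.Prime, Λ k * (2 * f k - 1) =
        σ * ∑ k ∈ Ioc 0 n, if k.Prime then greedySign k * log k else 0 := by
      rw [← sum_filter, mul_sum]
      refine sum_congr rfl fun k hk => ?_
      have hk' := (mem_filter.1 hk).2
      rw [hf k hk', ArithmeticFunction.vonMangoldt_apply_prime hk']
      ring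
    rw [this, abs_mul, hσ, one_mul]
    exact abs_sum_prime_greedySign_mul_log_le n
  · refine le_trans ?_ (hC n)
    rw [Chebyshev.psi_sub_theta_eq_sum_not_prime, Nat.floor_natCast]
    refine (abs_sum_le_sum_abs _ _).trans (sum_le_sum fun k _ => ?_)
    rw [abs_mul, abs_of_nonneg vonMangoldt_nonneg]
    refine mul_le_of_le_one_right vonMangoldt_nonneg ?_
    rw [abs_le]
    constructor <;> linarith [f0 k, f1 k]

end GreedySigns

section EulerProducts

/-- The indicator of the positive integers all of whose prime factors have greedy sign `σ`. -/
noncomputable def signIndicator (σ : ℝ) (n : ℕ) : ℝ :=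
  open Classical in if n ≠ 0 ∧ ∀ p : ℕ, p.Prime → p ∣ n → greedySign p = σ then 1 else 0

theorem signIndicator_nonneg (σ : ℝ) (n : ℕ) : 0 ≤ signIndicator σ n := by
  rw [signIndicator]; split_ifs <;> norm_num

theorem signIndicator_le_one (σ : ℝ) (n : ℕ) : signIndicator σ n ≤ 1 := by
  rw [signIndicator]; split_ifs <;> norm_num

theorem signIndicator_eq_one_iff {σ : ℝ} {n : ℕ} : signIndicator σ n = 1 ↔
    n ≠ 0 ∧ ∀ p : ℕ, p.Prime → p ∣ n → greedySign p = σ := by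
  simp [signIndicator]

theorem signIndicator_eq_zero_or_one (σ : ℝ) (n : ℕ) :
    signIndicator σ n = 0 ∨ signIndicator σ n = 1 := by
  rw [signIndicator]; split_ifs <;> simp

theorem signIndicator_zero (σ : ℝ) : signIndicator σ 0 = 0 := by simp [signIndicator]

theorem signIndicator_one (σ : ℝ) : signIndicator σ 1 = 1 := by
  rw [signIndicator_eq_one_iff]
  exact ⟨one_ne_zero, fun p hp h => absurd (Nat.dvd_one.1 h) hp.ne_one⟩

theorem signIndicator_mul (σ : ℝ) (a b : ℕ) :
    signIndicator σ (a * b) = signIndicator σ a * signIndicator σ b := by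
  have h : signIndicator σ (a * b) = 1 ↔ signIndicator σ a = 1 ∧ signIndicator σ b = 1 := by
    simp only [signIndicator_eq_one_iff]
    constructor
    · rintro ⟨h0, h⟩
      exact ⟨⟨left_ne_zero_of_mul h0, fun p hp hd => h p hp (hd.mul_right b)⟩,
        right_ne_zero_of_mul h0, fun p hp hd => h p hp (hd.mul_left a)⟩
    · rintro ⟨⟨ha0, ha⟩, hb0, hb⟩
      exact ⟨mul_ne_zero ha0 hb0, fun p hp hd => (hp.dvd_mul.1 hd).elim (ha p hp) (hb p hp)⟩
  rcases signIndicator_eq_zero_or_one σ a with ha | ha <;>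
  rcases signIndicator_eq_zero_or_one σ b with hb | hb <;>
  rcases signIndicator_eq_zero_or_one σ (a * b) with hc | hc <;> simp_all

theorem signIndicator_prime {σ : ℝ} (hσ : σ = 1 ∨ σ = -1) {p : ℕ} (hp : p.Prime) :
    2 * signIndicator σ p - 1 = σ * greedySign p := by
  have h : signIndicator σ p = 1 ↔ greedySign p = σ := by
    refine signIndicator_eq_one_iff.trans
      ⟨fun h => h.2 p hp dvd_rfl, fun h => ⟨hp.ne_zero, fun q hq hqp => ?_⟩⟩
    rwa [(Nat.prime_dvd_prime_iff_eq hq hp).1 hqp]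
  rcases signIndicator_eq_zero_or_one σ p with h2 | h2 <;> rcases hσ with rfl | rfl <;>
  rcases greedySign_eq p with h1 | h1 <;> rw [h1, h2] at h <;> norm_num at h <;>
  rw [h1, h2] <;> norm_num

theorem inv_mul_exp_neg_mul_log {δ : ℝ} (hδ : 0 < δ) (n : ℕ) :
    1 / (n : ℝ) * exp (-δ * log n) = 1 / (n : ℝ) ^ (1 + δ) := by
  rcases n.eq_zero_or_pos with rfl | hn
  · rw [Nat.cast_zero, zero_rpow (by linarith)]
    simp
  · have hn' : (0 : ℝ) < n := by exact_mod_cast hn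
    rw [rpow_add hn', rpow_one, rpow_def_of_pos hn', neg_mul, exp_neg, mul_comm (log _),
      one_div, one_div, mul_inv]

theorem summable_mul_exp_neg_mul_log {f : ℕ → ℝ} (f0 : ∀ n, 0 ≤ f n) (f1 : ∀ n, f n ≤ 1) {δ : ℝ}
    (hδ : 0 < δ) : Summable (fun n : ℕ => f n * (1 / (n : ℝ)) * exp (-δ * log n)) := by
  have h : Summable (fun n : ℕ => 1 / (n : ℝ) * exp (-δ * log n)) := by
    simp_rw [inv_mul_exp_neg_mul_log hδ, one_div]
    exact summable_nat_rpow_inv.2 (by linarith)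
  refine Summable.of_nonneg_of_le (fun n => ?_) (fun n => ?_) h
  · have := f0 n
    positivity
  · rw [mul_assoc]
    exact mul_le_of_le_one_left (by positivity) (f1 n)

theorem tendsto_prod_primesBelow {f : ℕ → ℝ} (f0 : ∀ n, 0 ≤ f n) (f1 : ∀ n, f n ≤ 1)
    (fone : f 1 = 1) (fmul : ∀ a b, f (a * b) = f a * f b) {δ : ℝ} (hδ : 0 < δ) :
    Tendsto (fun n : ℕ => ∏ p ∈ (n + 1).primesBelow, (1 - f p * (1 / (p : ℝ)) * exp (-δ * log p))⁻¹)
      atTop (𝓝 (∑' n : ℕ, f n * (1 / (n : ℝ)) * exp (-δ * log n))) := by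
  let φ : ℕ →*₀ ℝ :=
    { toFun := fun n => f n * (1 / (n : ℝ)) * exp (-δ * log n)
      map_zero' := by simp
      map_one' := by simp [fone]
      map_mul' := fun a b => by
        rcases a.eq_zero_or_pos with rfl | ha
        · simp
        rcases b.eq_zero_or_pos with rfl | hb
        · simp
        have ha' : (a : ℝ) ≠ 0 := by exact_mod_cast ha.ne'
        have hb' : (b : ℝ) ≠ 0 := by exact_mod_cast hb.ne'
        rw [fmul, Nat.cast_mul, log_mul ha' hb', mul_add, exp_add]
        field_simp }
  exact (EulerProduct.eulerProduct_completely_multiplicative (f := φ)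
    (summable_mul_exp_neg_mul_log f0 f1 hδ).norm).comp (tendsto_add_atTop_nat 1)

theorem mul_log_sub_log_bounds {t x : ℝ} (ht0 : 0 ≤ t) (ht1 : t ≤ 1)
    (hx : x ≤ 1 / 2) : 0 ≤ log (1 - t * x) - t * log (1 - x) ∧
      log (1 - t * x) - t * log (1 - x) ≤ 2 * (1 - t) * x ^ 2 := by
  have hx1 : 0 < 1 - x := by linarith
  have htx : 0 < 1 - t * x := by nlinarith
  constructor
  · have h := log_le_log (rpow_pos_of_pos (by linarith : 0 < 1 + -x) t)
      (rpow_one_add_le_one_add_mul_self (by linarith : -1 ≤ -x) ht0 ht1)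
    rw [log_rpow (by linarith), mul_neg, ← sub_eq_add_neg, ← sub_eq_add_neg] at h
    linarith
  · have h1 : log (1 - t * x) - log (1 - x) ≤ (1 - t) * (x / (1 - x)) := by
      rw [← log_div htx.ne' hx1.ne']
      refine (log_le_sub_one_of_pos (by positivity)).trans_eq ?_
      field_simp
      ring
    have h2 : x / (1 - x) ≤ x + 2 * x ^ 2 := by
      rw [div_le_iff₀ hx1]
      nlinarith [mul_nonneg (sq_nonneg x) (by linarith : 0 ≤ 1 - 2 * x)]
    have h3 := log_le_sub_one_of_pos hx1
    nlinarith [mul_le_mul_of_nonneg_left h2 (by linarith : 0 ≤ 1 - t),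
      mul_le_mul_of_nonneg_left h3 (by linarith : 0 ≤ 1 - t)]

theorem abs_exp_neg_mul_log_succ_sub_le {δ : ℝ} (hδ : 0 < δ) {k : ℕ} (hk : 0 < k) :
    |exp (-δ * log (k + 1 : ℕ)) - exp (-δ * log k)| ≤ δ / k := by
  have hk0 : (0 : ℝ) < k := by exact_mod_cast hk
  have hk1 : (1 : ℝ) ≤ k := by exact_mod_cast hk
  have h2 : log ((k : ℝ) + 1) - log k ≤ 1 / k := by
    rw [← log_div (by positivity) hk0.ne']
    refine (log_le_sub_one_of_pos (by positivity)).trans_eq ?_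
    field_simp
    ring
  have h3 : log (k : ℝ) ≤ log ((k : ℝ) + 1) := log_le_log hk0 (by linarith)
  have h4 : 0 ≤ log (k : ℝ) := log_nonneg hk1
  push_cast
  have e : exp (-δ * log ((k : ℝ) + 1)) =
      exp (-δ * log k) * exp (-δ * (log ((k : ℝ) + 1) - log k)) := by
    rw [← exp_add]
    ring_nf
  have h5 : exp (-δ * log k) ≤ 1 := exp_le_one_iff.2 (by nlinarith)
  have h6 := add_one_le_exp (-δ * (log ((k : ℝ) + 1) - log k))
  have h7 : exp (-δ * (log ((k : ℝ) + 1) - log k)) ≤ 1 := exp_le_one_iff.2 (by nlinarith)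
  have h8 : δ * (log ((k : ℝ) + 1) - log k) ≤ δ / k := by
    have := mul_le_mul_of_nonneg_left h2 hδ.le
    rwa [mul_one_div] at this
  have h9 : exp (-δ * log k) * (1 - exp (-δ * (log ((k : ℝ) + 1) - log k))) ≤ 1 * (δ / k) :=
    mul_le_mul h5 (by linarith) (by linarith) zero_le_one
  have h10 := mul_nonneg (exp_pos (-δ * log k)).le (sub_nonneg.2 h7)
  rw [e, abs_le]
  constructor <;> linarith

theorem abs_sum_prime_greedySign_mul_log_one_sub_le {δ : ℝ} (hδ : 0 < δ) (n : ℕ) :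
    |∑ k ∈ Ioc 0 n, if k.Prime then greedySign k * log (1 - 1 / (k : ℝ) * exp (-δ * log k)) else 0| ≤
      24 * δ + 4 / n := by
  set c : ℕ → ℝ := fun k => if k.Prime then greedySign k * primeWeight k else 0 with hc
  have hC : ∀ n : ℕ, |∑ k ∈ Ioc 0 n, c k| ≤ 4 / n := fun n => by
    rw [hc, ← greedySum_eq_sum]
    exact abs_greedySum_le n
  have h1 := abs_sum_Ioc_mul_sub_le hC (h := fun k : ℕ => exp (-δ * log k))
    (g := fun k : ℕ => δ / k) (fun k hk => abs_exp_neg_mul_log_succ_sub_le hδ hk) n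
  have hle : ∀ k ∈ Ioc 0 n, 1 / (k : ℝ) ≤ 1 / √(k : ℝ) := fun k hk => by
    have hk1 : (1 : ℝ) ≤ k := by exact_mod_cast (mem_Ioc.1 hk).1
    refine one_div_le_one_div_of_le (by positivity) ?_
    rw [sqrt_le_left (by linarith)]
    nlinarith
  have h2 : ∑ k ∈ Ioc 0 n, 4 / (k : ℝ) * (δ / k) ≤ 12 * δ := by
    have : ∀ k ∈ Ioc 0 n, 4 / (k : ℝ) * (δ / k) ≤ 4 * δ * (1 / √(k : ℝ) * (1 / k)) := by
      intro k hk
      have e : 4 / (k : ℝ) * (δ / k) = 4 * δ * (1 / k * (1 / k)) := by ring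
      rw [e]
      gcongr ?_ * (?_ * _)
      exact hle k hk
    refine (sum_le_sum this).trans ?_
    rw [← mul_sum]
    nlinarith [sum_Ioc_inv_mul_sqrt_le n]
  have h3 : |(∑ k ∈ Ioc 0 n, c k) * exp (-δ * log n)| ≤ 4 / n := by
    rw [abs_mul, abs_of_pos (exp_pos _)]
    refine (mul_le_of_le_one_right (abs_nonneg _) (exp_le_one_iff.2 ?_)).trans (hC n)
    nlinarith [log_natCast_nonneg n]
  have h4 : |∑ k ∈ Ioc 0 n, c k * exp (-δ * log k) + ∑ k ∈ Ioc 0 n,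
      (if k.Prime then greedySign k * log (1 - 1 / (k : ℝ) * exp (-δ * log k)) else 0)| ≤ 12 * δ := by
    rw [← sum_add_distrib]
    refine (abs_sum_le_sum_abs _ _).trans ?_
    have : ∀ k ∈ Ioc 0 n, |c k * exp (-δ * log k) +
        (if k.Prime then greedySign k * log (1 - 1 / (k : ℝ) * exp (-δ * log k)) else 0)| ≤
        4 * δ * (1 / √(k : ℝ) * (1 / k)) := by
      intro k _
      by_cases hk : k.Prime
      · have hk2 : (2 : ℝ) ≤ k := by exact_mod_cast hk.two_le
        have hk0 : (0 : ℝ) < k := by linarith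
        have hl : 0 ≤ log (k : ℝ) := log_nonneg (by linarith)
        simp only [hc, if_pos hk, primeWeight]
        have e : greedySign k * -log (1 - 1 / (k : ℝ)) * exp (-δ * log k) +
            greedySign k * log (1 - 1 / (k : ℝ) * exp (-δ * log k)) = greedySign k *
              (log (1 - exp (-δ * log k) * (1 / (k : ℝ))) - exp (-δ * log k) * log (1 - 1 / k)) := by
          rw [mul_comm (1 / (k : ℝ)) (exp _)]
          ring
        have ht : exp (-δ * log k) ≤ 1 := exp_le_one_iff.2 (by nlinarith)
        have hb := mul_log_sub_log_bounds (exp_pos (-δ * log k)).le ht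
          (one_div_le_one_div_of_le two_pos hk2)
        rw [e, abs_mul, abs_greedySign, one_mul, abs_of_nonneg hb.1]
        refine hb.2.trans ?_
        have l1 : 1 - exp (-δ * log k) ≤ δ * (2 * √(k : ℝ)) := by
          have := add_one_le_exp (-δ * log k)
          have l3 : log (k : ℝ) ≤ 2 * √(k : ℝ) := by linarith [log_add_two_le_two_mul_sqrt hk0]
          nlinarith
        calc 2 * (1 - exp (-δ * log k)) * (1 / (k : ℝ)) ^ 2
            ≤ 2 * (δ * (2 * √(k : ℝ))) * (1 / (k : ℝ)) ^ 2 := by gcongr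
          _ = 4 * δ * (1 / √(k : ℝ) * (1 / k)) := by rw [← sqrt_div_self']; ring
      · simp only [hc, if_neg hk]
        simp only [zero_mul, add_zero, abs_zero]
        positivity
    refine (sum_le_sum this).trans ?_
    rw [← mul_sum]
    nlinarith [sum_Ioc_inv_mul_sqrt_le n]
  rw [abs_le] at h1 h3 h4 ⊢
  constructor <;> linarith [h1.1, h1.2, h3.1, h3.2, h4.1, h4.2]

/-- The Dirichlet series of `signIndicator σ` at `1 + δ`. -/
noncomputable def signSeries (σ δ : ℝ) : ℝ :=
  ∑' n : ℕ, signIndicator σ n * (1 / (n : ℝ)) * exp (-δ * log n)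

theorem hasSum_signSeries (σ : ℝ) {δ : ℝ} (hδ : 0 < δ) :
    HasSum (fun n : ℕ => signIndicator σ n * (1 / (n : ℝ)) * exp (-δ * log n)) (signSeries σ δ) :=
  (summable_mul_exp_neg_mul_log (signIndicator_nonneg σ) (signIndicator_le_one σ) hδ).hasSum

theorem signSeries_nonneg (σ δ : ℝ) : 0 ≤ signSeries σ δ :=
  tsum_nonneg fun n => by have := signIndicator_nonneg σ n; positivity

theorem tendsto_signSeries (σ : ℝ) {δ : ℝ} (hδ : 0 < δ) :
    Tendsto (fun n : ℕ => ∏ p ∈ (n + 1).primesBelow,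
      (1 - signIndicator σ p * (1 / (p : ℝ)) * exp (-δ * log p))⁻¹) atTop (𝓝 (signSeries σ δ)) :=
  tendsto_prod_primesBelow (signIndicator_nonneg σ) (signIndicator_le_one σ) (signIndicator_one σ)
    (signIndicator_mul σ) hδ

theorem signIndicator_neg_prime {σ : ℝ} (hσ : σ = 1 ∨ σ = -1) {p : ℕ} (hp : p.Prime) :
    signIndicator (-σ) p = 1 - signIndicator σ p := by
  have h1 := signIndicator_prime hσ hp
  have h2 := signIndicator_prime (σ := -σ) (by rcases hσ with rfl | rfl <;> norm_num) hp
  linarith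

theorem one_sub_inv_mul_exp_pos {δ : ℝ} (hδ : 0 < δ) {p : ℕ} (hp : p.Prime) :
    0 < 1 - 1 / (p : ℝ) * exp (-δ * log p) := by
  have hp2 : (2 : ℝ) ≤ p := by exact_mod_cast hp.two_le
  have h1 : 1 / (p : ℝ) ≤ 1 / 2 := one_div_le_one_div_of_le two_pos hp2
  have h2 : exp (-δ * log p) ≤ 1 := exp_le_one_iff.2 (by nlinarith [log_natCast_nonneg p])
  nlinarith [mul_le_mul h1 h2 (exp_pos _).le (by norm_num)]

theorem signSeries_mul_signSeries_neg {σ : ℝ} (hσ : σ = 1 ∨ σ = -1) {δ : ℝ} (hδ : 0 < δ) :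
    signSeries σ δ * signSeries (-σ) δ = ∑' n : ℕ, 1 / (n : ℝ) ^ (1 + δ) := by
  have h := tendsto_prod_primesBelow (f := fun _ => 1) (fun _ => zero_le_one) (fun _ => le_rfl) rfl
    (fun _ _ => (one_mul 1).symm) hδ
  simp only [one_mul, inv_mul_exp_neg_mul_log hδ] at h
  refine tendsto_nhds_unique ((tendsto_signSeries σ hδ).mul (tendsto_signSeries (-σ) hδ))
    (h.congr fun n => ?_)
  rw [← prod_mul_distrib]
  refine prod_congr rfl fun p hp => ?_
  rw [signIndicator_neg_prime hσ (Nat.prime_of_mem_primesBelow hp)]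
  simp only [mul_assoc, inv_mul_exp_neg_mul_log hδ]
  rcases signIndicator_eq_zero_or_one σ p with h | h <;> simp [h]

theorem signSeries_le {σ : ℝ} (hσ : σ = 1 ∨ σ = -1) {δ : ℝ} (hδ : 0 < δ) :
    signSeries σ δ ≤ exp (24 * δ) * signSeries (-σ) δ := by
  have hlim : Tendsto (fun n : ℕ => exp (24 * δ + 4 / n)) atTop (𝓝 (exp (24 * δ))) := by
    have := (tendsto_const_div_atTop_nhds_zero_nat 4).const_add (24 * δ)
    rw [add_zero] at this
    exact (continuous_exp.tendsto _).comp this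
  refine le_of_tendsto_of_tendsto' (tendsto_signSeries σ hδ)
    (hlim.mul (tendsto_signSeries (-σ) hδ)) fun n => ?_
  have hpos : 0 ≤ ∏ p ∈ (n + 1).primesBelow,
      (1 - signIndicator (-σ) p * (1 / (p : ℝ)) * exp (-δ * log p))⁻¹ := by
    refine prod_nonneg fun p hp => inv_nonneg.2 ?_
    have := one_sub_inv_mul_exp_pos hδ (Nat.prime_of_mem_primesBelow hp)
    rcases signIndicator_eq_zero_or_one (-σ) p with h | h <;> rw [h, mul_assoc] <;> linarith
  have e : ∏ p ∈ (n + 1).primesBelow,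
        (1 - signIndicator σ p * (1 / (p : ℝ)) * exp (-δ * log p))⁻¹ =
      exp (-σ * ∑ k ∈ Ioc 0 n, if k.Prime then
        greedySign k * log (1 - 1 / (k : ℝ) * exp (-δ * log k)) else 0) *
      ∏ p ∈ (n + 1).primesBelow,
        (1 - signIndicator (-σ) p * (1 / (p : ℝ)) * exp (-δ * log p))⁻¹ := by
    have e1 : Ioc 0 n = (range (n + 1)).erase 0 := by
      ext k
      simp only [mem_Ioc, mem_erase, mem_range]
      omega
    have e2 : (∑ k ∈ Ioc 0 n, if k.Prime then
        greedySign k * log (1 - 1 / (k : ℝ) * exp (-δ * log k)) else 0) =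
        ∑ p ∈ (n + 1).primesBelow, greedySign p * log (1 - 1 / (p : ℝ) * exp (-δ * log p)) := by
      rw [e1, sum_erase _ (by simp [Nat.not_prime_zero]), Nat.primesBelow, sum_filter]
    rw [e2, mul_sum, exp_sum, ← prod_mul_distrib]
    refine prod_congr rfl fun p hp => ?_
    have hp' := Nat.prime_of_mem_primesBelow hp
    have hpos := one_sub_inv_mul_exp_pos hδ hp'
    have hs : -σ * greedySign p = -(2 * signIndicator σ p - 1) := by
      rw [signIndicator_prime hσ hp', neg_mul]
    rw [signIndicator_neg_prime hσ hp', ← mul_assoc, hs, mul_assoc (signIndicator σ p),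
      mul_assoc (1 - signIndicator σ p)]
    generalize 1 / (p : ℝ) * exp (-δ * log p) = x at hpos ⊢
    rcases signIndicator_eq_zero_or_one σ p with h | h
    · rw [h, show -(2 * (0 : ℝ) - 1) = 1 by norm_num, one_mul, exp_log hpos, sub_zero, one_mul,
        mul_inv_cancel₀ hpos.ne', zero_mul, sub_zero, inv_one]
    · rw [h, show -(2 * (1 : ℝ) - 1) = -1 by norm_num, neg_one_mul, exp_neg, exp_log hpos, sub_self,
        one_mul, zero_mul, sub_zero, inv_one, mul_one]
  rw [e]
  refine mul_le_mul_of_nonneg_right (exp_le_exp.2 ?_) hpos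
  refine (le_abs_self _).trans ?_
  have : |-σ| = 1 := by rcases hσ with rfl | rfl <;> simp
  rw [abs_mul, this, one_mul]
  exact abs_sum_prime_greedySign_mul_log_one_sub_le hδ n

theorem tendsto_sqrt_mul_signSeries {σ : ℝ} (hσ : σ = 1 ∨ σ = -1) :
    Tendsto (fun δ => √δ * signSeries σ δ) (𝓝[>] 0) (𝓝 1) := by
  have hz : Tendsto (fun δ : ℝ => δ * ∑' n : ℕ, 1 / (n : ℝ) ^ (1 + δ)) (𝓝[>] 0) (𝓝 1) := by
    have h1 : Tendsto (fun δ : ℝ => 1 + δ) (𝓝[>] 0) (𝓝[>] 1) := by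
      refine tendsto_nhdsWithin_iff.2 ⟨?_, ?_⟩
      · have : Tendsto (fun δ : ℝ => 1 + δ) (𝓝 0) (𝓝 (1 + 0)) := tendsto_id.const_add 1
        rw [add_zero] at this
        exact this.mono_left nhdsWithin_le_nhds
      · filter_upwards [self_mem_nhdsWithin] with δ (hδ : 0 < δ)
        exact Set.mem_Ioi.2 (by linarith)
    refine (tendsto_sub_mul_tsum_nat_rpow.comp h1).congr fun δ => ?_
    simp
  have he : ∀ a : ℝ, Tendsto (fun δ : ℝ => exp (a * δ)) (𝓝[>] 0) (𝓝 1) := fun a => by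
    have : Tendsto (fun δ : ℝ => exp (a * δ)) (𝓝 0) (𝓝 (exp (a * 0))) :=
      (by fun_prop : Continuous fun δ : ℝ => exp (a * δ)).tendsto 0
    rw [mul_zero, exp_zero] at this
    exact this.mono_left nhdsWithin_le_nhds
  have hsq : Tendsto (fun δ : ℝ => δ * signSeries σ δ ^ 2) (𝓝[>] 0) (𝓝 1) := by
    have hl := (he (-24)).mul hz
    have hu := (he 24).mul hz
    rw [one_mul] at hl hu
    refine tendsto_of_tendsto_of_tendsto_of_le_of_le' hl hu ?_ ?_
    · filter_upwards [self_mem_nhdsWithin] with δ (hδ : 0 < δ)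
      have h := signSeries_le (σ := -σ) (by rcases hσ with rfl | rfl <;> norm_num) hδ
      rw [neg_neg] at h
      rw [← signSeries_mul_signSeries_neg hσ hδ]
      have e : exp (-24 * δ) * exp (24 * δ) = 1 := by
        rw [← exp_add]
        ring_nf
        exact exp_zero
      have h' : exp (-24 * δ) * signSeries (-σ) δ ≤ signSeries σ δ := by
        have := mul_le_mul_of_nonneg_left h (exp_pos (-24 * δ)).le
        rwa [← mul_assoc, e, one_mul] at this
      have h'' := mul_le_mul_of_nonneg_left h' (mul_nonneg hδ.le (signSeries_nonneg σ δ))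
      linarith
    · filter_upwards [self_mem_nhdsWithin] with δ (hδ : 0 < δ)
      rw [← signSeries_mul_signSeries_neg hσ hδ]
      have := mul_le_mul_of_nonneg_left (signSeries_le hσ hδ)
        (mul_nonneg hδ.le (signSeries_nonneg σ δ))
      linarith
  have := (continuous_sqrt.tendsto 1).comp hsq
  rw [sqrt_one] at this
  refine this.congr' ?_
  filter_upwards [self_mem_nhdsWithin] with δ (hδ : 0 < δ)
  simp [sqrt_mul hδ.le, sqrt_sq (signSeries_nonneg σ δ)]

end EulerProducts

section Basis

/-- The union of the multiplicative semigroups generated by the primes of each greedy sign. -/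
def greedyBasis : Set ℕ := {n | signIndicator 1 n = 1 ∨ signIndicator (-1) n = 1}

/-- The indicator of `greedyBasis` in terms of the two semigroups, which share only `1`. -/
noncomputable def basisIndicator (n : ℕ) : ℝ :=
  signIndicator 1 n + signIndicator (-1) n - if n = 1 then 1 else 0

open Classical in
theorem basisIndicator_eq (n : ℕ) : basisIndicator n = if n ∈ greedyBasis then 1 else 0 := by
  rw [basisIndicator, greedyBasis, Set.mem_ofPred_eq]
  rcases eq_or_ne n 1 with rfl | hn
  · simp [signIndicator_one]
  rcases signIndicator_eq_zero_or_one 1 n with h1 | h1 <;>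
  rcases signIndicator_eq_zero_or_one (-1) n with h2 | h2
  · simp [h1, h2, hn]
  · simp [h1, h2, hn]
  · simp [h1, h2, hn]
  · obtain ⟨p, hp, hpn⟩ := Nat.exists_prime_and_dvd hn
    have e1 := (signIndicator_eq_one_iff.1 h1).2 p hp hpn
    have e2 := (signIndicator_eq_one_iff.1 h2).2 p hp hpn
    linarith

theorem basisIndicator_nonneg (n : ℕ) : 0 ≤ basisIndicator n := by
  rw [basisIndicator_eq]; split_ifs <;> norm_num

theorem zero_notMem_greedyBasis : 0 ∉ greedyBasis := by simp [greedyBasis, signIndicator_zero]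

theorem cntF_greedyBasis (x : ℝ) :
    (cntF greedyBasis x : ℝ) = ∑ n ∈ Ioc 0 ⌊x⌋₊, basisIndicator n := by
  classical
  have h : greedyBasis ∩ Set.Icc 1 ⌊x⌋₊ = ((Ioc 0 ⌊x⌋₊).filter (· ∈ greedyBasis) : Finset ℕ) := by
    ext n
    simp only [Set.mem_inter_iff, Set.mem_Icc, coe_filter, mem_Ioc, Set.mem_ofPred_eq,
      Nat.succ_le_iff]
    tauto
  simp_rw [cntF, h, Set.ncard_coe_finset, basisIndicator_eq, sum_boole]

theorem exists_mul_eq_of_signIndicator {n : ℕ} (hn : n ≠ 0) :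
    ∃ a b : ℕ, signIndicator 1 a = 1 ∧ signIndicator (-1) b = 1 ∧ a * b = n := by
  induction n using induction_on_primes with
  | zero => exact absurd rfl hn
  | one => exact ⟨1, 1, signIndicator_one _, signIndicator_one _, rfl⟩
  | prime_mul p m hp ih =>
    obtain ⟨a, b, ha, hb, hab⟩ := ih (right_ne_zero_of_mul hn)
    rcases greedySign_eq p with h | h
    · refine ⟨p * a, b, ?_, hb, by rw [mul_assoc, hab]⟩
      have := signIndicator_prime (Or.inl rfl) hp
      rw [signIndicator_mul, ha]
      linarith
    · refine ⟨a, p * b, ha, ?_, by rw [mul_left_comm, hab]⟩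
      have := signIndicator_prime (Or.inr rfl) hp
      rw [signIndicator_mul, hb]
      linarith

theorem isMB_greedyBasis : IsMB 2 greedyBasis := by
  intro n hn
  have hfin : {f : Fin 2 → ℕ | (∀ i, f i ∈ greedyBasis) ∧ ∏ i, f i = n}.Finite := by
    refine (Set.finite_Iic fun _ : Fin 2 => n).subset fun f hf => ?_
    intro i
    exact Nat.le_of_dvd hn (hf.2 ▸ dvd_prod_of_mem f (mem_univ i))
  rw [mulRep, Nat.succ_le_iff, Set.ncard_pos hfin]
  obtain ⟨a, b, ha, hb, hab⟩ := exists_mul_eq_of_signIndicator (by omega : n ≠ 0)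
  refine ⟨![a, b], ?_, by simpa using hab⟩
  intro i
  fin_cases i
  · exact Or.inl ha
  · exact Or.inr hb

theorem eventually_sum_basisIndicator_le {ε : ℝ} (hε : 0 < ε) :
    ∀ᶠ N : ℕ in atTop, (∑ n ∈ Ioc 0 N, basisIndicator n) * √(1 + log N) / N ≤ 2 / √π + ε := by
  obtain ⟨B, hB⟩ := exists_abs_sum_vonMangoldt_mul_le
  have key : ∀ σ : ℝ, σ = 1 ∨ σ = -1 → ∀ᶠ N : ℕ in atTop,
      (∑ n ∈ Ioc 0 N, signIndicator σ n) * √(1 + log N) / N ≤ 1 / √π + ε / 2 := fun σ hσ =>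
    eventually_sum_mul_sqrt_le (signIndicator_nonneg σ) (signIndicator_le_one σ)
      (signIndicator_mul σ) (hB (signIndicator σ) σ (by rcases hσ with rfl | rfl <;> simp)
        (signIndicator_nonneg σ) (signIndicator_le_one σ) fun p => signIndicator_prime hσ)
      (fun δ => hasSum_signSeries σ) (tendsto_sqrt_mul_signSeries hσ) (half_pos hε)
  filter_upwards [key 1 (Or.inl rfl), key (-1) (Or.inr rfl)] with N h1 h2
  have h : ∑ n ∈ Ioc 0 N, basisIndicator n ≤
      ∑ n ∈ Ioc 0 N, signIndicator 1 n + ∑ n ∈ Ioc 0 N, signIndicator (-1) n := by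
    rw [← sum_add_distrib]
    refine sum_le_sum fun n _ => sub_le_self _ ?_
    split_ifs <;> norm_num
  calc (∑ n ∈ Ioc 0 N, basisIndicator n) * √(1 + log N) / N
      ≤ (∑ n ∈ Ioc 0 N, signIndicator 1 n + ∑ n ∈ Ioc 0 N, signIndicator (-1) n) *
        √(1 + log N) / N := by gcongr
    _ = (∑ n ∈ Ioc 0 N, signIndicator 1 n) * √(1 + log N) / N +
        (∑ n ∈ Ioc 0 N, signIndicator (-1) n) * √(1 + log N) / N := by ring
    _ ≤ 1 / √π + ε / 2 + (1 / √π + ε / 2) := add_le_add h1 h2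
    _ = 2 / √π + ε := by ring

theorem eventually_cntF_greedyBasis_le {ε : ℝ} (hε : 0 < ε) :
    ∀ᶠ x : ℝ in atTop,
      (cntF greedyBasis x : ℝ) * log x ^ ((1 : ℝ) / 2) / x ≤ 2 / √π + ε := by
  filter_upwards [(tendsto_nat_floor_atTop (α := ℝ)).eventually
    (eventually_sum_basisIndicator_le hε), eventually_ge_atTop 1] with x hx hx1
  refine le_trans ?_ hx
  have hN : 1 ≤ ⌊x⌋₊ := Nat.one_le_floor_iff x |>.2 hx1
  have hN1 : (1 : ℝ) ≤ ⌊x⌋₊ := by exact_mod_cast hN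
  have hNx : (⌊x⌋₊ : ℝ) ≤ x := Nat.floor_le (by linarith)
  have hlog : log x ≤ 1 + log ⌊x⌋₊ := by
    have h := log_le_log (by linarith) (show x ≤ exp 1 * ⌊x⌋₊ by
      have := Nat.lt_floor_add_one x
      nlinarith [add_one_le_exp 1])
    rwa [log_mul (exp_pos 1).ne' (by linarith), log_exp] at h
  rw [← sqrt_eq_rpow, cntF_greedyBasis]
  have hs : 0 ≤ ∑ n ∈ Ioc 0 ⌊x⌋₊, basisIndicator n := sum_nonneg fun n _ => basisIndicator_nonneg n
  gcongr

theorem hasSum_basisIndicator {δ : ℝ} (hδ : 0 < δ) :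
    HasSum (fun n : ℕ => basisIndicator n * (1 / (n : ℝ)) * exp (-δ * log n))
      (signSeries 1 δ + signSeries (-1) δ - 1) := by
  have h := hasSum_single (f := fun n : ℕ => (if n = 1 then (1 : ℝ) else 0) * (1 / (n : ℝ)) *
    exp (-δ * log n)) 1 fun n hn => by simp [hn]
  simp only [↓reduceIte, Nat.cast_one, div_one, mul_one, log_one, mul_zero, exp_zero] at h
  refine (((hasSum_signSeries 1 hδ).add (hasSum_signSeries (-1) hδ)).sub h).congr_fun ?_
  intro n
  simp only [basisIndicator]
  ring

theorem sum_div_eq_add_sum_div (a : ℕ → ℝ) (N : ℕ) :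
    ∑ n ∈ Ioc 0 (N + 1), a n * (1 / (n : ℝ)) -
      (∑ n ∈ Ioc 0 (N + 1), a n) / ((N + 1 : ℕ) : ℝ) =
    ∑ n ∈ Ioc 0 N, a n * (1 / (n : ℝ)) - (∑ n ∈ Ioc 0 N, a n) / (N : ℝ) +
      (∑ n ∈ Ioc 0 N, a n) * (1 / (N : ℝ) - 1 / ((N + 1 : ℕ) : ℝ)) := by
  rw [sum_Ioc_succ_top (Nat.zero_le N), sum_Ioc_succ_top (Nat.zero_le N)]
  ring

theorem exists_sum_div_le_sqrt_log {a : ℕ → ℝ} (a1 : ∀ n, a n ≤ 1) {c : ℝ} (hc : 0 ≤ c)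
    (h : ∀ᶠ N : ℕ in atTop, ∑ n ∈ Ioc 0 N, a n ≤ c * (N / √(log N))) :
    ∃ K, ∀ N : ℕ, ∑ n ∈ Ioc 0 N, a n * (1 / (n : ℝ)) ≤ 2 * c * √(log N) + K := by
  obtain ⟨N₀, hN₀, h⟩ := (atTop_basis' 3).eventually_iff.1 h
  set T : ℕ → ℝ := fun N => ∑ n ∈ Ioc 0 N, a n * (1 / (n : ℝ)) - (∑ n ∈ Ioc 0 N, a n) / (N : ℝ)
    with hT
  have hstep : ∀ N, N₀ ≤ N → T (N + 1) - T N ≤ 2 * c * √(log N) - 2 * c * √(log (N - 1 : ℕ)) := by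
    intro N hN
    have hN3 : (3 : ℝ) ≤ N := by exact_mod_cast hN₀.trans hN
    have hN0 : (0 : ℝ) < N := by linarith
    have hl : 0 < log (N : ℝ) := log_pos (by linarith)
    have hs : 0 < √(log (N : ℝ)) := sqrt_pos.2 hl
    have h1 : T (N + 1) - T N ≤ c * (1 / N / √(log N)) := by
      simp only [hT, sum_div_eq_add_sum_div]
      rw [add_sub_cancel_left]
      have e : 1 / (N : ℝ) - 1 / ((N + 1 : ℕ) : ℝ) = 1 / (N * (N + 1)) := by
        push_cast
        field_simp
        ring
      rw [e]
      refine (mul_le_mul_of_nonneg_right (h hN) (by positivity)).trans ?_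
      rw [mul_assoc]
      refine mul_le_mul_of_nonneg_left ?_ hc
      rw [div_mul_div_comm, mul_one, div_div, div_le_div_iff₀ (by positivity) (by positivity)]
      nlinarith [mul_pos hN0 hs, mul_pos hN0 (mul_pos hN0 hs)]
    have h2 : 1 / (N : ℝ) ≤ log N - log (N - 1 : ℕ) := by
      rw [Nat.cast_sub (by exact_mod_cast (by linarith : (1 : ℝ) ≤ N)), Nat.cast_one]
      have := log_le_sub_one_of_pos (show 0 < ((N : ℝ) - 1) / N from div_pos (by linarith) hN0)
      rw [log_div (by linarith) hN0.ne'] at this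
      have e : ((N : ℝ) - 1) / N - 1 = -(1 / N) := by
        field_simp
        ring
      linarith
    have h3 : 0 ≤ log ((N - 1 : ℕ) : ℝ) := log_natCast_nonneg _
    have h4 : 1 / (N : ℝ) / √(log N) ≤ 2 * (√(log N) - √(log (N - 1 : ℕ))) := by
      rw [div_le_iff₀ hs]
      have e1 := sq_sqrt hl.le
      have e2 := sq_sqrt h3
      nlinarith [sq_nonneg (√(log (N : ℝ)) - √(log ((N - 1 : ℕ) : ℝ)))]
    nlinarith [mul_le_mul_of_nonneg_left h4 hc]
  have hmono : ∀ N, N₀ ≤ N → T (N + 1) ≤ 2 * c * √(log N) + T N₀ := by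
    intro N hN
    induction N, hN using Nat.le_induction with
    | base =>
      have := hstep N₀ le_rfl
      have : 0 ≤ 2 * c * √(log (N₀ - 1 : ℕ)) := by positivity
      linarith
    | succ N hN ih =>
      have := hstep (N + 1) (by omega)
      rw [Nat.add_sub_cancel] at this
      linarith
  obtain ⟨K, -, hK⟩ := exists_le_add_const_of_eventually_le
    (x := fun N : ℕ => ∑ n ∈ Ioc 0 N, a n * (1 / (n : ℝ)))
    (y := fun N : ℕ => 2 * c * √(log N) + (T N₀ + 1)) (by
      filter_upwards [eventually_ge_atTop (N₀ + 1)] with N hN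
      obtain ⟨M, rfl⟩ : ∃ M, N = M + 1 := ⟨N - 1, by omega⟩
      have h1 := hmono M (by omega)
      have hM : (0 : ℝ) < M := by exact_mod_cast (by omega : 0 < M)
      have h2 : (∑ n ∈ Ioc 0 (M + 1), a n) / ((M + 1 : ℕ) : ℝ) ≤ 1 := by
        refine div_le_one_of_le₀ ((sum_le_sum fun n _ => a1 n).trans ?_) (by positivity)
        simp
      have h3 : √(log M) ≤ √(log (M + 1 : ℕ)) :=
        sqrt_le_sqrt (log_le_log hM (by push_cast; linarith))
      have h4 := mul_le_mul_of_nonneg_left h3 (by positivity : 0 ≤ 2 * c)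
      simp only [hT] at h1
      linarith)
  exact ⟨T N₀ + 1 + K, fun N => by have := hK N; linarith⟩

theorem two_div_sqrt_pi_le {c : ℝ} (hc : 0 ≤ c)
    (h : ∀ᶠ N : ℕ in atTop, ∑ n ∈ Ioc 0 N, basisIndicator n ≤ c * (N / √(log N))) :
    2 / √π ≤ c := by
  obtain ⟨K, hK⟩ := exists_sum_div_le_sqrt_log
    (fun n => by rw [basisIndicator_eq]; split_ifs <;> norm_num) hc h
  have hs : Tendsto (fun δ : ℝ => √δ) (𝓝[>] 0) (𝓝 0) := by
    have := continuous_sqrt.tendsto 0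
    rw [sqrt_zero] at this
    exact this.mono_left nhdsWithin_le_nhds
  have h1 := ((tendsto_sqrt_mul_signSeries (Or.inl rfl)).add
    (tendsto_sqrt_mul_signSeries (Or.inr rfl))).sub hs
  have h2 := (hs.const_mul K).const_add (c * √π)
  have h3 := le_of_tendsto_of_tendsto h1 h2 (by
    filter_upwards [self_mem_nhdsWithin] with δ (hδ : 0 < δ)
    have hF := hasSum_le_of_sum_le_sqrt_log (a := 2 * c) hδ (by positivity) (by simp)
      (hasSum_basisIndicator hδ) fun N _ => hK N
    have hδ' := sqrt_pos.2 hδ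
    have := mul_le_mul_of_nonneg_left hF hδ'.le
    have e : √δ * (2 * c * (√π / 2 / √δ) + K) = c * √π + K * √δ := by field_simp
    linarith)
  rw [div_le_iff₀ (sqrt_pos.2 pi_pos)]
  linarith

theorem limsup_cntF_greedyBasis :
    Filter.limsup (fun x : ℝ =>
        (((cntF greedyBasis x : ℝ) * Real.log x ^ ((1 : ℝ) / 2) / x : ℝ) : EReal))
      Filter.atTop = ((2 / Real.sqrt Real.pi : ℝ) : EReal) := by
  refine le_antisymm (EReal.le_of_forall_lt_iff_le.1 fun z hz => ?_)
    (EReal.ge_of_forall_gt_iff_ge.1 fun z hz => ?_)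
  · rw [EReal.coe_lt_coe_iff] at hz
    refine limsup_le_of_le (h := ?_)
    filter_upwards [eventually_cntF_greedyBasis_le (sub_pos.2 hz)] with x hx
    rw [EReal.coe_le_coe_iff]
    linarith
  · rw [EReal.coe_lt_coe_iff] at hz
    by_contra! hlt
    have h := tendsto_natCast_atTop_atTop.eventually (eventually_lt_of_limsup_lt hlt)
    refine absurd (two_div_sqrt_pi_le (le_max_right z 0) ?_)
      (not_le.2 (max_lt hz (by positivity)))
    filter_upwards [h, eventually_ge_atTop 2] with N hN hN2
    have hN1 : (1 : ℝ) < N := by exact_mod_cast hN2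
    have hs : 0 < √(log (N : ℝ)) := sqrt_pos.2 (log_pos hN1)
    rw [EReal.coe_lt_coe_iff, ← sqrt_eq_rpow, cntF_greedyBasis, Nat.floor_natCast] at hN
    rw [← mul_div_assoc, le_div_iff₀ hs, ← div_le_iff₀ (by linarith)]
    exact hN.le.trans (le_max_left _ _)

end Basis

end

theorem stmt8 :
    ∃ A : Set ℕ, 0 ∉ A ∧ IsMB 2 A ∧
      Filter.limsup (fun x : ℝ =>
          (((cntF A x : ℝ) * Real.log x ^ ((1 : ℝ) / 2) / x : ℝ) : EReal))
        Filter.atTop = ((2 / Real.sqrt Real.pi : ℝ) : EReal) :=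
  ⟨greedyBasis, zero_notMem_greedyBasis, isMB_greedyBasis, limsup_cntF_greedyBasis⟩
end

section
/- Let h ∈ ℤ⁺. For every multiplicative complement (A_1,…,A_h) of order h, one has liminf_{x→∞} max{A_1(x),…,A_h(x)} · (log x) / x > 1/h. -/
open Filter Real

/-- Common multiplicative representation function. -/
noncomputable def mulRepFam (h : ℕ) (A : Fin h → Set ℕ) (n : ℕ) : ℕ :=
  {f : Fin h → ℕ | (∀ i, f i ∈ A i) ∧ ∏ i, f i = n}.ncard

/-- `(A_1,…,A_h)` is a multiplicative complement of order `h`. -/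
def IsMC (h : ℕ) (A : Fin h → Set ℕ) : Prop := ∀ n : ℕ, 1 ≤ n → 1 ≤ mulRepFam h A n

theorem fejer_integral (w : ℝ) :
    ∫ t in (-1 : ℝ)..1, ((1 - |t| : ℝ) : ℂ) * Complex.exp (Complex.I * t * w) =
      ((Real.sinc (w / 2) ^ 2 : ℝ) : ℂ) := by
  have hInt : ∀ a b : ℝ, IntervalIntegrable
      (fun t : ℝ => ((1 - |t| : ℝ) : ℂ) * Complex.exp (Complex.I * t * w)) MeasureTheory.volume a b :=
    fun a b => Continuous.intervalIntegrable (by fun_prop) a b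
  rw [← intervalIntegral.integral_add_adjacent_intervals (hInt (-1) 0) (hInt 0 1)]
  have e1 : ∫ t in (0 : ℝ)..1, ((1 - |t| : ℝ) : ℂ) * Complex.exp (Complex.I * t * w) =
      ∫ t in (0 : ℝ)..1, (1 - t : ℂ) * Complex.exp (Complex.I * t * w) := by
    refine intervalIntegral.integral_congr fun t ht => ?_
    rw [Set.uIcc_of_le zero_le_one] at ht
    simp [abs_of_nonneg ht.1]
  have e2 : ∫ t in (-1 : ℝ)..0, ((1 - |t| : ℝ) : ℂ) * Complex.exp (Complex.I * t * w) =
      ∫ t in (-1 : ℝ)..0, (1 + t : ℂ) * Complex.exp (Complex.I * t * w) := by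
    refine intervalIntegral.integral_congr fun t ht => ?_
    rw [Set.uIcc_of_le (by norm_num)] at ht
    simp [abs_of_nonpos ht.2]
  rw [e1, e2]
  have hexp : ∀ t : ℝ, HasDerivAt (fun t : ℝ => Complex.exp (Complex.I * t * w))
      (Complex.exp (Complex.I * t * w) * (Complex.I * w)) t := fun t => by
    simpa using ((((hasDerivAt_id t).ofReal_comp).const_mul Complex.I).mul_const (w : ℂ)).cexp
  have hid : ∀ t : ℝ, HasDerivAt (fun t : ℝ => (t : ℂ)) 1 t := fun t =>
    (hasDerivAt_id t).ofReal_comp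
  rcases eq_or_ne w 0 with rfl | hw
  · have h1 : ∫ t in (0 : ℝ)..1, (1 - t : ℂ) * Complex.exp (Complex.I * t * (0 : ℝ)) = 1 / 2 := by
      rw [intervalIntegral.integral_eq_sub_of_hasDerivAt (f := fun t : ℝ => (t : ℂ) - t ^ 2 / 2)]
      · norm_num
      · intro t _
        refine HasDerivAt.congr_deriv ((hid t).sub (((hid t).pow 2).div_const 2)) ?_
        simp
      · exact Continuous.intervalIntegrable (by fun_prop) _ _
    have h2 : ∫ t in (-1 : ℝ)..0, (1 + t : ℂ) * Complex.exp (Complex.I * t * (0 : ℝ)) = 1 / 2 := by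
      rw [intervalIntegral.integral_eq_sub_of_hasDerivAt (f := fun t : ℝ => (t : ℂ) + t ^ 2 / 2)]
      · norm_num
      · intro t _
        refine HasDerivAt.congr_deriv ((hid t).add (((hid t).pow 2).div_const 2)) ?_
        simp
      · exact Continuous.intervalIntegrable (by fun_prop) _ _
    rw [h1, h2]
    norm_num
  · have hw' : (w : ℂ) ≠ 0 := by exact_mod_cast hw
    have hc : Complex.I * w ≠ 0 := mul_ne_zero Complex.I_ne_zero hw'
    have h1 : ∫ t in (0 : ℝ)..1, (1 - t : ℂ) * Complex.exp (Complex.I * t * w) =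
        Complex.exp (Complex.I * w) / (Complex.I * w) ^ 2 - 1 / (Complex.I * w)
          - 1 / (Complex.I * w) ^ 2 := by
      rw [intervalIntegral.integral_eq_sub_of_hasDerivAt
        (f := fun t : ℝ => (1 - t : ℂ) * (Complex.exp (Complex.I * t * w) / (Complex.I * w))
          + Complex.exp (Complex.I * t * w) / (Complex.I * w) ^ 2)]
      · simp; ring
      · intro t _
        refine HasDerivAt.congr_deriv ((((hid t).const_sub 1).mul ((hexp t).div_const (Complex.I * w))).add
          ((hexp t).div_const ((Complex.I * w) ^ 2))) ?_
        field_simp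
        ring
      · exact Continuous.intervalIntegrable (by fun_prop) _ _
    have h2 : ∫ t in (-1 : ℝ)..0, (1 + t : ℂ) * Complex.exp (Complex.I * t * w) =
        1 / (Complex.I * w) - 1 / (Complex.I * w) ^ 2 +
          Complex.exp (-(Complex.I * w)) / (Complex.I * w) ^ 2 := by
      rw [intervalIntegral.integral_eq_sub_of_hasDerivAt
        (f := fun t : ℝ => (1 + t : ℂ) * (Complex.exp (Complex.I * t * w) / (Complex.I * w))
          - Complex.exp (Complex.I * t * w) / (Complex.I * w) ^ 2)]
      · simp
      · intro t _
        refine HasDerivAt.congr_deriv ((((hid t).const_add 1).mul ((hexp t).div_const (Complex.I * w))).sub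
          ((hexp t).div_const ((Complex.I * w) ^ 2))) ?_
        field_simp
        ring
      · exact Continuous.intervalIntegrable (by fun_prop) _ _
    rw [h1, h2, Real.sinc_of_ne_zero (by positivity)]
    have hs : (Real.sin (w / 2)) ^ 2 = (1 - Real.cos w) / 2 := by
      rw [Real.sin_sq_eq_half_sub]; ring_nf
    have hcos : Complex.exp (-(Complex.I * w)) = 2 * Complex.cos w - Complex.exp (Complex.I * w) := by
      rw [Complex.cos]; ring_nf
    rw [div_pow, hs, hcos]
    push_cast
    rw [mul_pow, Complex.I_sq]
    field_simp
    ring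

theorem fejer_le (w : ℝ) : Real.sinc (w / 2) ^ 2 ≤ 5 * (1 + w ^ 2)⁻¹ := by
  have h0 : Real.sinc (w / 2) ^ 2 ≤ 1 := (sq_le_one_iff_abs_le_one _).2 (Real.abs_sinc_le_one _)
  rw [← div_eq_mul_inv, le_div_iff₀ (by positivity)]
  rcases le_total (w ^ 2) 4 with h | h
  · nlinarith [sq_nonneg (Real.sinc (w / 2))]
  · have hw : w ≠ 0 := by rintro rfl; norm_num at h
    have h1 : Real.sinc (w / 2) ^ 2 * w ^ 2 ≤ 4 := by
      rw [Real.sinc_of_ne_zero (by positivity)]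
      have := Real.sin_sq_le_one (w / 2)
      field_simp
      linarith
    nlinarith

theorem integrable_fejer : MeasureTheory.Integrable (fun w : ℝ => Real.sinc (w / 2) ^ 2) := by
  refine (integrable_inv_one_add_sq.const_mul 5).mono'
    (Continuous.aestronglyMeasurable ?_) (Eventually.of_forall fun w => ?_)
  · exact (Real.continuous_sinc.comp (continuous_id.div_const 2)).pow 2
  · rw [Real.norm_of_nonneg (sq_nonneg _)]
    exact fejer_le w

theorem integral_fejer_pos : 0 < ∫ w : ℝ, Real.sinc (w / 2) ^ 2 := by
  refine MeasureTheory.integral_pos_of_integrable_nonneg_nonzero (x := 0) ?_ integrable_fejer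
    (fun w => sq_nonneg _) (by simp)
  exact (Real.continuous_sinc.comp (continuous_id.div_const 2)).pow 2

theorem abs_one_sub_abs_le_one {t : ℝ} (ht : |t| ≤ 1) : |(1 - |t|)| ≤ 1 := by
  rw [abs_le]; constructor <;> linarith [abs_nonneg t]

open MeasureTheory in
theorem integral_fejer_mul_laplace {b : ℝ → ℝ} {C : ℝ} {H : ℂ → ℂ} (hbm : Measurable b)
    (hbC : ∀ u, |b u| ≤ C)
    (hL : ∀ z : ℂ, 0 < z.re → ∫ u in Set.Ioi (0 : ℝ), (b u : ℂ) * Complex.exp (-z * u) = H z)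
    {δ : ℝ} (hδ : 0 < δ) (lam y : ℝ) :
    ∫ t in (-1 : ℝ)..1, ((1 - |t| : ℝ) : ℂ) * Complex.exp (Complex.I * t * (lam * y : ℝ)) *
        H (δ + Complex.I * lam * t) =
      ((∫ u in Set.Ioi (0 : ℝ), b u * Real.exp (-δ * u) * Real.sinc (lam * (y - u) / 2) ^ 2 : ℝ) :
        ℂ) := by
  set F : ℝ → ℝ → ℂ := fun t u => ((1 - |t| : ℝ) : ℂ) *
    Complex.exp (Complex.I * t * (lam * y : ℝ)) *
      ((b u : ℂ) * Complex.exp (-(δ + Complex.I * lam * t) * u)) with hF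
  have h1 : ∀ t : ℝ, ((1 - |t| : ℝ) : ℂ) * Complex.exp (Complex.I * t * (lam * y : ℝ)) *
      H (δ + Complex.I * lam * t) = ∫ u in Set.Ioi (0 : ℝ), F t u := fun t => by
    rw [← hL _ (by simpa using hδ), hF, integral_const_mul]
  simp_rw [h1]
  rw [intervalIntegral.integral_of_le (by norm_num), integral_integral_swap, ← integral_complex_ofReal]
  · refine integral_congr_ae (Eventually.of_forall fun u => ?_)
    have h2 : ∀ t : ℝ, F t u = (b u * Real.exp (-δ * u) : ℝ) *
        (((1 - |t| : ℝ) : ℂ) * Complex.exp (Complex.I * t * (lam * (y - u) : ℝ))) := fun t => by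
      simp only [hF]
      have : Complex.exp (-(δ + Complex.I * lam * t) * u) =
          Complex.exp (-δ * u) * Complex.exp (- Complex.I * lam * t * u) := by
        rw [← Complex.exp_add]; ring_nf
      rw [this]
      have : Complex.exp (Complex.I * t * (lam * (y - u) : ℝ)) =
          Complex.exp (Complex.I * t * (lam * y : ℝ)) * Complex.exp (- Complex.I * lam * t * u) := by
        rw [← Complex.exp_add]; push_cast; ring_nf
      rw [this]
      push_cast
      ring
    simp only [h2]
    rw [integral_const_mul, ← intervalIntegral.integral_of_le (by norm_num), fejer_integral]
    push_cast
    ring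
  · have hg : Integrable (fun u : ℝ => C * Real.exp (-δ * u)) (volume.restrict (Set.Ioi 0)) :=
      (exp_neg_integrableOn_Ioi 0 hδ).const_mul C
    have hf : Integrable (fun _ : ℝ => (1 : ℝ)) (volume.restrict (Set.Ioc (-1) 1)) :=
      integrable_const _
    refine (hf.mul_prod hg).mono' ?_ ?_
    · refine Measurable.aestronglyMeasurable ?_
      simp only [hF, Function.uncurry_def]
      fun_prop
    · have : ∀ᵐ z : ℝ × ℝ ∂((volume.restrict (Set.Ioc (-1) 1)).prod (volume.restrict (Set.Ioi 0))),
          z ∈ Set.Ioc (-1 : ℝ) 1 ×ˢ Set.Ioi (0 : ℝ) := by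
        rw [Measure.prod_restrict]
        exact ae_restrict_mem (measurableSet_Ioc.prod measurableSet_Ioi)
      filter_upwards [this] with z hz
      have h3 := abs_one_sub_abs_le_one (abs_le.2 ⟨hz.1.1.le, hz.1.2⟩)
      simp only [hF, Function.uncurry_def, norm_mul, Complex.norm_exp, Complex.norm_real,
        Real.norm_eq_abs]
      have h4 : (Complex.I * (z.1 : ℂ) * ((lam * y : ℝ) : ℂ)).re = 0 := by simp
      have h5 : (-((δ : ℂ) + Complex.I * lam * z.1) * z.2).re = -δ * z.2 := by simp
      rw [h4, h5, Real.exp_zero, mul_one]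
      gcongr
      exact hbC _

open MeasureTheory in
theorem integrable_fejer_comp {lam : ℝ} (hlam : 0 < lam) (y : ℝ) :
    Integrable (fun u : ℝ => Real.sinc (lam * (y - u) / 2) ^ 2) :=
  ((integrable_fejer.comp_mul_left' hlam.ne').comp_sub_left y)

open MeasureTheory in
theorem integral_fejer_mul_laplace_boundary {b : ℝ → ℝ} {C : ℝ} {H : ℂ → ℂ} (hbm : Measurable b)
    (hbC : ∀ u, |b u| ≤ C) (hH : ContinuousOn H {z | 0 ≤ z.re})
    (hL : ∀ z : ℂ, 0 < z.re → ∫ u in Set.Ioi (0 : ℝ), (b u : ℂ) * Complex.exp (-z * u) = H z)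
    {lam : ℝ} (hlam : 0 < lam) (y : ℝ) :
    ∫ t in (-1 : ℝ)..1, ((1 - |t| : ℝ) : ℂ) * Complex.exp (Complex.I * t * (lam * y : ℝ)) *
        H (Complex.I * lam * t) =
      ((∫ u in Set.Ioi (0 : ℝ), b u * Real.sinc (lam * (y - u) / 2) ^ 2 : ℝ) : ℂ) := by
  have hev : ∀ᶠ δ : ℝ in nhdsWithin 0 (Set.Ioi 0), 0 < δ ∧ δ < 1 := by
    filter_upwards [self_mem_nhdsWithin, Ioo_mem_nhdsGT (zero_lt_one' ℝ)] with δ h1 h2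
    exact h2
  have hC : 0 ≤ C := (abs_nonneg _).trans (hbC 0)
  set φ : ℝ × ℝ → ℂ := fun p => p.1 + Complex.I * lam * p.2 with hφ
  have hφc : Continuous φ := by fun_prop
  have hHφ : ContinuousOn (fun p => H (φ p)) (Set.Icc (0 : ℝ) 1 ×ˢ Set.Icc (-1 : ℝ) 1) :=
    hH.comp hφc.continuousOn fun p hp => by simpa [hφ] using hp.1.1
  obtain ⟨D, hD⟩ := (isCompact_Icc.prod isCompact_Icc).exists_bound_of_continuousOn hHφ
  have hleft : Tendsto (fun δ : ℝ => ∫ t in (-1 : ℝ)..1, ((1 - |t| : ℝ) : ℂ) *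
      Complex.exp (Complex.I * t * (lam * y : ℝ)) * H (δ + Complex.I * lam * t))
      (nhdsWithin 0 (Set.Ioi 0)) (nhds (∫ t in (-1 : ℝ)..1, ((1 - |t| : ℝ) : ℂ) *
      Complex.exp (Complex.I * t * (lam * y : ℝ)) * H (Complex.I * lam * t))) := by
    simp only [intervalIntegral.integral_of_le (show (-1 : ℝ) ≤ 1 by norm_num)]
    refine tendsto_integral_filter_of_dominated_convergence (fun _ => D) ?_ ?_
      (integrable_const _) ?_
    · filter_upwards [hev] with δ hδ
      refine ContinuousOn.aestronglyMeasurable ?_ measurableSet_Ioc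
      refine ContinuousOn.mul (Continuous.continuousOn (by fun_prop)) ?_
      exact hH.comp (Continuous.continuousOn (by fun_prop)) fun t _ => by simpa using hδ.1.le
    · filter_upwards [hev] with δ hδ
      filter_upwards [ae_restrict_mem measurableSet_Ioc] with t ht
      have h3 := abs_one_sub_abs_le_one (abs_le.2 ⟨ht.1.le, ht.2⟩)
      have h4 : (Complex.I * (t : ℂ) * ((lam * y : ℝ) : ℂ)).re = 0 := by simp
      have h5 := hD (δ, t) ⟨⟨hδ.1.le, hδ.2.le⟩, ⟨ht.1.le, ht.2⟩⟩
      rw [norm_mul, norm_mul, Complex.norm_exp, h4, Real.exp_zero, mul_one, Complex.norm_real,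
        Real.norm_eq_abs]
      calc _ ≤ 1 * ‖H (δ + Complex.I * lam * t)‖ := by gcongr
        _ ≤ D := by simpa [hφ] using h5
    · refine Eventually.of_forall fun t => Tendsto.const_mul _ ?_
      have h6 : ContinuousWithinAt H {z | 0 ≤ z.re} (Complex.I * lam * t) := hH _ (by simp)
      refine h6.tendsto.comp (tendsto_nhdsWithin_iff.2 ⟨?_, ?_⟩)
      · have : Continuous (fun δ : ℝ => (δ : ℂ) + Complex.I * lam * t) := by fun_prop
        simpa using (this.tendsto 0).mono_left nhdsWithin_le_nhds
      · filter_upwards [hev] with δ hδ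
        simpa using hδ.1.le
  have hright : Tendsto (fun δ : ℝ => ((∫ u in Set.Ioi (0 : ℝ),
      b u * Real.exp (-δ * u) * Real.sinc (lam * (y - u) / 2) ^ 2 : ℝ) : ℂ))
      (nhdsWithin 0 (Set.Ioi 0)) (nhds ((∫ u in Set.Ioi (0 : ℝ),
      b u * Real.sinc (lam * (y - u) / 2) ^ 2 : ℝ) : ℂ)) := by
    refine (Complex.continuous_ofReal.tendsto _).comp ?_
    have hs : Measurable fun u : ℝ => Real.sinc (lam * (y - u) / 2) ^ 2 :=
      ((Real.continuous_sinc.comp (by fun_prop)).pow 2).measurable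
    refine tendsto_integral_filter_of_dominated_convergence
      (fun u => C * Real.sinc (lam * (y - u) / 2) ^ 2) ?_ ?_
      ((integrable_fejer_comp hlam y).integrableOn.const_mul C) ?_
    · refine Eventually.of_forall fun δ => Measurable.aestronglyMeasurable ?_
      exact (hbm.mul (by fun_prop)).mul hs
    · filter_upwards [hev] with δ hδ
      filter_upwards [ae_restrict_mem measurableSet_Ioi] with u hu
      rw [norm_mul, Real.norm_of_nonneg (sq_nonneg _), norm_mul, Real.norm_eq_abs,
        Real.norm_of_nonneg (Real.exp_pos _).le]
      have : Real.exp (-δ * u) ≤ 1 := Real.exp_le_one_iff.2 (by nlinarith [hδ.1, Set.mem_Ioi.1 hu])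
      gcongr
      calc _ ≤ C * 1 := by gcongr; exact hbC u
        _ = C := mul_one C
    · refine Eventually.of_forall fun u => Tendsto.mul_const _ ?_
      have : Continuous (fun δ : ℝ => b u * Real.exp (-δ * u)) := by fun_prop
      simpa using (this.tendsto 0).mono_left nhdsWithin_le_nhds
  refine tendsto_nhds_unique hleft (hright.congr' ?_)
  filter_upwards [hev] with δ hδ
  exact (integral_fejer_mul_laplace hbm hbC hL hδ.1 lam y).symm

open MeasureTheory in
theorem tendsto_integral_mul_fejer {b : ℝ → ℝ} {C : ℝ} {H : ℂ → ℂ} (hbm : Measurable b)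
    (hbC : ∀ u, |b u| ≤ C) (hH : ContinuousOn H {z | 0 ≤ z.re})
    (hL : ∀ z : ℂ, 0 < z.re → ∫ u in Set.Ioi (0 : ℝ), (b u : ℂ) * Complex.exp (-z * u) = H z)
    {lam : ℝ} (hlam : 0 < lam) :
    Tendsto (fun y => ∫ u in Set.Ioi (0 : ℝ), b u * Real.sinc (lam * (y - u) / 2) ^ 2)
      atTop (nhds 0) := by
  rw [Complex.isometry_ofReal.isEmbedding.tendsto_nhds_iff]
  have hRL := Real.tendsto_integral_exp_smul_cocompact
    ((Set.Ioc (-1 : ℝ) 1).indicator fun t => ((1 - |t| : ℝ) : ℂ) * H (Complex.I * lam * t))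
  have hw : Tendsto (fun y : ℝ => -(lam / (2 * π)) * y) atTop (cocompact ℝ) :=
    (tendsto_id.const_mul_atTop_of_neg (neg_neg_of_pos (by positivity))).mono_right
      atBot_le_cocompact
  refine ((hRL.comp hw).congr fun y => ?_)
  simp only [Function.comp_apply]
  rw [← integral_fejer_mul_laplace_boundary hbm hbC hH hL hlam y,
    intervalIntegral.integral_of_le (by norm_num), ← integral_indicator measurableSet_Ioc]
  refine integral_congr_ae (Eventually.of_forall fun t => ?_)
  by_cases ht : t ∈ Set.Ioc (-1 : ℝ) 1
  · simp only [Set.indicator_of_mem ht, Circle.smul_def, Real.fourierChar_apply, smul_eq_mul]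
    have : ((2 * π * -(t * (-(lam / (2 * π)) * y)) : ℝ) : ℂ) * Complex.I =
        Complex.I * t * (lam * y : ℝ) := by
      have : (2 * π * -(t * (-(lam / (2 * π)) * y)) : ℝ) = t * (lam * y) := by
        field_simp
      rw [this]; push_cast; ring
    rw [this]; ring
  · simp [Set.indicator_of_notMem ht]

open MeasureTheory in
theorem tendsto_setIntegral_fejer {lam : ℝ} (hlam : 0 < lam) :
    Tendsto (fun y => ∫ u in Set.Ioi (0 : ℝ), Real.sinc (lam * (y - u) / 2) ^ 2) atTop
      (nhds (lam⁻¹ * ∫ w : ℝ, Real.sinc (w / 2) ^ 2)) := by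
  have hInt : Integrable fun v : ℝ => Real.sinc (lam * v / 2) ^ 2 :=
    integrable_fejer.comp_mul_left' hlam.ne'
  have h := (aecover_Iio (μ := (volume : Measure ℝ)) tendsto_id).integral_tendsto_of_countably_generated
    hInt
  rw [Measure.integral_comp_mul_left (fun w : ℝ => Real.sinc (w / 2) ^ 2) lam,
    abs_of_pos (inv_pos.2 hlam), smul_eq_mul] at h
  refine h.congr fun y => ?_
  rw [← integral_indicator measurableSet_Iio, ← integral_indicator measurableSet_Ioi,
    ← integral_sub_left_eq_self _ volume y]
  refine integral_congr_ae (Eventually.of_forall fun u => ?_)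
  simp only [Set.indicator_apply, Set.mem_Iio, Set.mem_Ioi, id, sub_lt_self_iff]

open MeasureTheory in
theorem exists_integral_fejer_compl_le {ε : ℝ} (hε : 0 < ε) :
    ∃ R > 0, ∫ w in (Set.Icc (-R) R)ᶜ, Real.sinc (w / 2) ^ 2 ≤ ε := by
  have h := (aecover_Icc (μ := (volume : Measure ℝ)) tendsto_neg_atTop_atBot
    tendsto_id).integral_tendsto_of_countably_generated integrable_fejer
  have h2 := h.eventually (lt_mem_nhds (sub_lt_self (∫ w : ℝ, Real.sinc (w / 2) ^ 2) hε))
  obtain ⟨R, hR, hR0⟩ := (h2.and (eventually_gt_atTop 0)).exists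
  refine ⟨R, hR0, ?_⟩
  have h3 := integral_add_compl (measurableSet_Icc (a := -R) (b := R)) integrable_fejer
  simp only [id] at hR
  linarith

open MeasureTheory in
theorem eventually_one_sub_le_of_laplace {B : ℝ → ℝ} {C : ℝ} {H : ℂ → ℂ} (hBm : Measurable B)
    (hB0 : ∀ u, 0 ≤ B u) (hBC : ∀ u, B u ≤ C)
    (hBexp : ∀ u v, u ≤ v → B u * Real.exp u ≤ B v * Real.exp v)
    (hH : ContinuousOn H {z | 0 ≤ z.re})
    (hL : ∀ z : ℂ, 0 < z.re →
      ∫ u in Set.Ioi (0 : ℝ), ((B u - 1 : ℝ) : ℂ) * Complex.exp (-z * u) = H z)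
    {ε : ℝ} (hε : 0 < ε) : ∀ᶠ y in atTop, 1 - ε ≤ B y := by
  rcases le_or_gt 1 ε with hε1 | hε1
  · exact Eventually.of_forall fun y => by linarith [hB0 y]
  have hC : 0 ≤ C := (hB0 0).trans (hBC 0)
  set M := ∫ w : ℝ, Real.sinc (w / 2) ^ 2 with hM
  have hMpos : 0 < M := integral_fejer_pos
  set η := ε / 4 with hη
  have hη0 : 0 < η := by positivity
  set κ := ε / (4 * (1 + C)) with hκ
  have hκ0 : 0 < κ := by positivity
  have hκC : κ * (1 + C) = ε / 4 := by rw [hκ]; field_simp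
  obtain ⟨R, hR0, hR⟩ := exists_integral_fejer_compl_le (mul_pos hκ0 hMpos)
  set lam := R / η with hlam'
  have hlam : 0 < lam := by positivity
  have hsm : ∀ y, Measurable fun u : ℝ => Real.sinc (lam * (y - u) / 2) ^ 2 := fun y =>
    ((Real.continuous_sinc.comp (by fun_prop)).pow 2).measurable
  have hBK : ∀ y, Integrable fun u => B u * Real.sinc (lam * (y - u) / 2) ^ 2 := fun y => by
    refine ((integrable_fejer_comp hlam y).const_mul C).mono'
      (hBm.mul (hsm y)).aestronglyMeasurable (Eventually.of_forall fun u => ?_)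
    rw [Real.norm_of_nonneg (mul_nonneg (hB0 u) (sq_nonneg _))]
    exact mul_le_mul_of_nonneg_right (hBC u) (sq_nonneg _)
  set g : ℝ → ℝ := (Set.Icc (-R) R)ᶜ.indicator fun w => Real.sinc (w / 2) ^ 2 with hg
  have hgint : Integrable g := integrable_fejer.indicator measurableSet_Icc.compl
  have hgle : ∫ w, g w ≤ κ * M := by rwa [hg, integral_indicator measurableSet_Icc.compl]
  have hupper : ∀ y, lam * ∫ u in Set.Ioi (0 : ℝ), B u * Real.sinc (lam * (y - u) / 2) ^ 2 ≤
      Real.exp (2 * η) * B (y + η) * M + C * (κ * M) := fun y => by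
    have hpt : ∀ u, B u * Real.sinc (lam * (y - u) / 2) ^ 2 ≤
        Real.exp (2 * η) * B (y + η) * Real.sinc (lam * (y - u) / 2) ^ 2 +
          C * g (lam * (y - u)) := fun u => by
      by_cases hu : lam * (y - u) ∈ Set.Icc (-R) R
      · have hgz : g (lam * (y - u)) = 0 := by simp [hg, hu]
        rw [hgz, mul_zero, add_zero]
        refine mul_le_mul_of_nonneg_right ?_ (sq_nonneg _)
        have hRlam : R = lam * η := by rw [hlam']; field_simp
        have h1 : y - u ≤ η := le_of_mul_le_mul_left (hu.2.trans hRlam.le) hlam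
        have h2 : -η ≤ y - u := by
          refine le_of_mul_le_mul_left (le_trans ?_ hu.1) hlam
          rw [hRlam]; linarith
        have h3 := hBexp u (y + η) (by linarith)
        have h4 : B (y + η) * Real.exp (y + η) ≤ B (y + η) * Real.exp (2 * η + u) :=
          mul_le_mul_of_nonneg_left (Real.exp_le_exp.2 (by linarith)) (hB0 _)
        rw [Real.exp_add (2 * η)] at h4
        refine le_of_mul_le_mul_right (h3.trans (h4.trans_eq (by ring))) (Real.exp_pos u)
      · have hgz : g (lam * (y - u)) = Real.sinc (lam * (y - u) / 2) ^ 2 := by simp [hg, hu]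
        rw [hgz]
        have h1 : B u * Real.sinc (lam * (y - u) / 2) ^ 2 ≤ C * Real.sinc (lam * (y - u) / 2) ^ 2 :=
          mul_le_mul_of_nonneg_right (hBC u) (sq_nonneg _)
        have h2 : 0 ≤ Real.exp (2 * η) * B (y + η) * Real.sinc (lam * (y - u) / 2) ^ 2 :=
          mul_nonneg (mul_nonneg (Real.exp_pos _).le (hB0 _)) (sq_nonneg _)
        linarith
    have hscale : ∀ f : ℝ → ℝ, lam * ∫ u, f (lam * (y - u)) = ∫ w, f w := fun f => by
      rw [integral_sub_left_eq_self (fun v => f (lam * v)) volume y,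
        Measure.integral_comp_mul_left, abs_of_pos (inv_pos.2 hlam), smul_eq_mul,
        mul_inv_cancel_left₀ hlam.ne']
    have hgc : Integrable fun u => g (lam * (y - u)) :=
      (hgint.comp_mul_left' hlam.ne').comp_sub_left y
    calc lam * ∫ u in Set.Ioi (0 : ℝ), B u * Real.sinc (lam * (y - u) / 2) ^ 2
        ≤ lam * ∫ u, B u * Real.sinc (lam * (y - u) / 2) ^ 2 := by
          refine mul_le_mul_of_nonneg_left (setIntegral_le_integral (hBK y) ?_) hlam.le
          exact Eventually.of_forall fun u => mul_nonneg (hB0 u) (sq_nonneg _)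
      _ ≤ lam * ∫ u, (Real.exp (2 * η) * B (y + η) * Real.sinc (lam * (y - u) / 2) ^ 2 +
          C * g (lam * (y - u))) := by
          refine mul_le_mul_of_nonneg_left (integral_mono (hBK y) ?_ hpt) hlam.le
          exact ((integrable_fejer_comp hlam y).const_mul _).add (hgc.const_mul C)
      _ = Real.exp (2 * η) * B (y + η) * M + C * ∫ w, g w := by
          rw [integral_add ((integrable_fejer_comp hlam y).const_mul _) (hgc.const_mul C),
            integral_const_mul, integral_const_mul, ← hscale g,
            hM, ← hscale fun w => Real.sinc (w / 2) ^ 2]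
          ring
      _ ≤ _ := by gcongr
  have hlim : Tendsto (fun y => lam * ∫ u in Set.Ioi (0 : ℝ),
      B u * Real.sinc (lam * (y - u) / 2) ^ 2) atTop (nhds M) := by
    have h0 := tendsto_integral_mul_fejer (b := fun u => B u - 1) (C := C + 1)
      (hBm.sub_const 1) (fun u => abs_le.2 ⟨by linarith [hB0 u], by linarith [hBC u]⟩) hH hL hlam
    have h1 := ((h0.add (tendsto_setIntegral_fejer hlam)).const_mul lam)
    rw [zero_add, mul_inv_cancel_left₀ hlam.ne'] at h1
    refine h1.congr fun y => ?_
    rw [← integral_add]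
    · congr 1
      refine integral_congr_ae (Eventually.of_forall fun u => ?_)
      simp only
      ring
    · refine (((hBK y).sub (integrable_fejer_comp hlam y)).integrableOn).congr
        (Eventually.of_forall fun u => ?_)
      simp only [Pi.sub_apply]
      ring
    · exact (integrable_fejer_comp hlam y).integrableOn
  have hev := hlim.eventually (lt_mem_nhds (show (1 - κ) * M < M by nlinarith))
  have hev2 := (tendsto_atTop_add_const_right atTop (-η) tendsto_id).eventually hev
  filter_upwards [hev2] with y hy
  have h1 := hupper (y + -η)
  simp only [id] at hy
  rw [neg_add_cancel_right] at h1
  have h2 : 1 - κ ≤ Real.exp (2 * η) * B y + C * κ := by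
    refine le_of_mul_le_mul_right ?_ hMpos
    linarith
  have h3 : 1 - ε / 4 ≤ Real.exp (2 * η) * B y := by linarith
  have h4 : 1 - ε / 2 ≤ Real.exp (-(2 * η)) := by
    have := Real.add_one_le_exp (-(2 * η))
    rw [hη] at this ⊢
    linarith
  have h5 : B y = Real.exp (-(2 * η)) * (Real.exp (2 * η) * B y) := by
    rw [← mul_assoc, ← Real.exp_add]; simp
  rw [h5]
  calc 1 - ε ≤ (1 - ε / 2) * (1 - ε / 4) := by nlinarith
    _ ≤ _ := mul_le_mul h4 h3 (by linarith) (Real.exp_pos _).le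

theorem integrableOn_psi_exp_mul_cexp {z : ℂ} (hz : 0 < z.re) :
    MeasureTheory.IntegrableOn
      (fun u : ℝ => ((Chebyshev.psi (Real.exp u) * Real.exp (-u) : ℝ) : ℂ) * Complex.exp (-z * u))
      (Set.Ioi 0) := by
  have hI := integrableOn_exp_mul_complex_Ioi (a := -z) (by simpa using hz) 0
  refine MeasureTheory.Integrable.bdd_mul (c := Real.log 4 + 4) hI ?_ ?_
  · exact (Complex.measurable_ofReal.comp ((Chebyshev.psi_mono.measurable.comp
      Real.measurable_exp).mul (by fun_prop))).aestronglyMeasurable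
  · refine Filter.Eventually.of_forall fun u => ?_
    have h1 := Chebyshev.psi_le_const_mul_self (Real.exp_pos u).le
    rw [Complex.norm_real, Real.norm_of_nonneg (mul_nonneg (Chebyshev.psi_nonneg _)
      (Real.exp_pos _).le)]
    calc _ ≤ ((Real.log 4 + 4) * Real.exp u) * Real.exp (-u) := by gcongr
      _ = _ := by rw [mul_assoc, ← Real.exp_add]; simp

theorem LSeries_vonMangoldt_eq_mul_integral_psi_exp {z : ℂ} (hz : 0 < z.re) :
    LSeries (fun n => (ArithmeticFunction.vonMangoldt n : ℂ)) (1 + z) =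
      (1 + z) * ∫ u in Set.Ioi (0 : ℝ),
        ((Chebyshev.psi (Real.exp u) * Real.exp (-u) : ℝ) : ℂ) * Complex.exp (-z * u) := by
  have hpsi : ∀ t : ℝ, ∑ k ∈ Finset.Icc 1 ⌊t⌋₊, ArithmeticFunction.vonMangoldt k =
      Chebyshev.psi t := fun t => by rw [Chebyshev.psi]; rfl
  have hO : (fun n : ℕ => ∑ k ∈ Finset.Icc 1 n, ArithmeticFunction.vonMangoldt k) =O[atTop]
      fun n => (n : ℝ) ^ (1 : ℝ) := by
    refine Asymptotics.IsBigO.of_bound (Real.log 4 + 4) (Filter.Eventually.of_forall fun n => ?_)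
    have h1 := hpsi n
    rw [Nat.floor_natCast] at h1
    rw [h1, Real.norm_of_nonneg (Chebyshev.psi_nonneg _), Real.rpow_one,
      Real.norm_of_nonneg (by positivity)]
    exact Chebyshev.psi_le_const_mul_self (by positivity)
  rw [LSeries_eq_mul_integral_of_nonneg _ zero_le_one (by simpa using hz) hO
    fun _ => ArithmeticFunction.vonMangoldt_nonneg]
  congr 1
  have himg : Set.Ioi (1 : ℝ) = Real.exp '' Set.Ioi 0 := by
    ext t
    constructor
    · intro ht
      have ht : 1 < t := ht
      exact ⟨Real.log t, Real.log_pos ht, Real.exp_log (by linarith)⟩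
    · rintro ⟨u, hu, rfl⟩
      exact Real.one_lt_exp_iff.2 hu
  rw [himg, MeasureTheory.integral_image_eq_integral_abs_deriv_smul measurableSet_Ioi
    (fun u _ => (Real.hasDerivAt_exp u).hasDerivWithinAt) Real.exp_injective.injOn]
  refine MeasureTheory.setIntegral_congr_fun measurableSet_Ioi fun u _ => ?_
  have hc : (∑ k ∈ Finset.Icc 1 ⌊Real.exp u⌋₊, (ArithmeticFunction.vonMangoldt k : ℂ)) =
      (Chebyshev.psi (Real.exp u) : ℂ) := by
    rw [← hpsi]; push_cast; rfl
  simp only [hc, abs_of_pos (Real.exp_pos u), Complex.real_smul]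
  rw [Complex.cpow_def_of_ne_zero (by exact_mod_cast (Real.exp_pos u).ne'),
    ← Complex.ofReal_log (Real.exp_pos u).le, Real.log_exp]
  push_cast
  rw [mul_left_comm, mul_assoc, ← Complex.exp_add, ← Complex.exp_add]
  congr 2
  ring

theorem integral_psi_exp_sub_one_mul_cexp {z : ℂ} (hz : 0 < z.re) :
    ∫ u in Set.Ioi (0 : ℝ),
      ((Chebyshev.psi (Real.exp u) * Real.exp (-u) - 1 : ℝ) : ℂ) * Complex.exp (-z * u) =
      (ArithmeticFunction.vonMangoldt.LFunctionResidueClassAux (1 : ZMod 1) (1 + z) - 1) /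
        (1 + z) := by
  have hz0 : z ≠ 0 := by rintro rfl; simp at hz
  have hz1 : 1 + z ≠ 0 := by
    intro h0
    have := congrArg Complex.re h0
    simp at this
    linarith
  have hI := integrableOn_exp_mul_complex_Ioi (a := -z) (by simpa using hz) 0
  have hres : (fun n => (ArithmeticFunction.vonMangoldt.residueClass (1 : ZMod 1) n : ℂ)) =
      fun n => (ArithmeticFunction.vonMangoldt n : ℂ) := by
    funext n
    simp [ArithmeticFunction.vonMangoldt.residueClass, Set.indicator, Subsingleton.elim (n : ZMod 1) 1]
  have hG := ArithmeticFunction.vonMangoldt.eqOn_LFunctionResidueClassAux (a := (1 : ZMod 1))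
    isUnit_one (x := 1 + z) (by simpa using hz)
  simp only [hres] at hG
  rw [hG, LSeries_vonMangoldt_eq_mul_integral_psi_exp hz]
  have hsub : ∀ u : ℝ,
      ((Chebyshev.psi (Real.exp u) * Real.exp (-u) - 1 : ℝ) : ℂ) * Complex.exp (-z * u) =
      ((Chebyshev.psi (Real.exp u) * Real.exp (-u) : ℝ) : ℂ) * Complex.exp (-z * u) -
        Complex.exp (-z * u) := fun u => by push_cast; ring
  simp_rw [hsub]
  rw [MeasureTheory.integral_sub (integrableOn_psi_exp_mul_cexp hz) hI,
    integral_exp_mul_complex_Ioi (by simpa using hz)]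
  simp only [Nat.totient_one, Nat.cast_one, inv_one, Complex.ofReal_zero, mul_zero,
    Complex.exp_zero, add_sub_cancel_left]
  generalize (∫ u in Set.Ioi (0 : ℝ), (_ : ℂ)) = J
  field_simp
  ring

theorem eventually_mul_le_psi {ε : ℝ} (hε : 0 < ε) :
    ∀ᶠ x : ℝ in atTop, (1 - ε) * x ≤ Chebyshev.psi x := by
  have key := eventually_one_sub_le_of_laplace
    (B := fun u => Chebyshev.psi (Real.exp u) * Real.exp (-u)) (C := Real.log 4 + 4)
    (H := fun z =>
      (ArithmeticFunction.vonMangoldt.LFunctionResidueClassAux (1 : ZMod 1) (1 + z) - 1) / (1 + z))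
    ((Chebyshev.psi_mono.measurable.comp Real.measurable_exp).mul (by fun_prop))
    (fun u => mul_nonneg (Chebyshev.psi_nonneg _) (Real.exp_pos _).le)
    (fun u => by
      have h1 := Chebyshev.psi_le_const_mul_self (Real.exp_pos u).le
      calc _ ≤ ((Real.log 4 + 4) * Real.exp u) * Real.exp (-u) := by gcongr
        _ = _ := by rw [mul_assoc, ← Real.exp_add]; simp)
    (fun u v huv => by
      simp only [mul_assoc, ← Real.exp_add, neg_add_cancel, Real.exp_zero, mul_one]
      exact Chebyshev.psi_mono (Real.exp_le_exp.2 huv))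
    (by
      refine ContinuousOn.div (ContinuousOn.sub
        ((ArithmeticFunction.vonMangoldt.continuousOn_LFunctionResidueClassAux (1 : ZMod 1)).comp
          (by fun_prop) fun z hz => ?_) continuousOn_const) (by fun_prop) fun z hz h0 => ?_
      · have hz : 0 ≤ z.re := hz
        simpa using hz
      · have hz : 0 ≤ z.re := hz
        have := congrArg Complex.re h0
        simp at this
        linarith)
    (fun z hz => integral_psi_exp_sub_one_mul_cexp hz) hε
  filter_upwards [Real.tendsto_log_atTop.eventually key, eventually_gt_atTop 0] with x hx hx0
  rw [Real.exp_neg, Real.exp_log hx0, ← div_eq_mul_inv, le_div_iff₀ hx0] at hx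
  exact hx

theorem eventually_mul_le_primeCounting_mul_log {ε : ℝ} (hε : 0 < ε) :
    ∀ᶠ x : ℝ in atTop, (1 - ε) * x ≤ Nat.primeCounting ⌊x⌋₊ * Real.log x := by
  filter_upwards [eventually_mul_le_psi hε] with x hx
  exact hx.trans (Chebyshev.psi_le_primeCounting_mul_log' x)

theorem IsMC.exists_prod_eq {h : ℕ} {A : Fin h → Set ℕ} (hMC : IsMC h A) {n : ℕ} (hn : 1 ≤ n) :
    ∃ f : Fin h → ℕ, (∀ i, f i ∈ A i) ∧ ∏ i, f i = n :=
  Set.nonempty_of_ncard_ne_zero (Nat.one_le_iff_ne_zero.1 (hMC n hn))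

theorem Nat.Prime.exists_mem_eq_of_prod_eq {ι : Type*} {s : Finset ι} {f : ι → ℕ} {p : ℕ}
    (hp : p.Prime) (hf : ∏ i ∈ s, f i = p) : ∃ i ∈ s, f i = p := by
  obtain ⟨i, hi, hd⟩ := hp.prime.exists_mem_finset_dvd (hf ▸ dvd_rfl : p ∣ ∏ i ∈ s, f i)
  exact ⟨i, hi, Nat.dvd_antisymm (hf ▸ Finset.dvd_prod_of_mem f hi) hd⟩

theorem card_le_sum_cntF {h : ℕ} {A : Fin h → Set ℕ} {s : Finset (Fin h)} {x : ℝ}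
    {T : Finset (Fin h × ℕ)}
    (hT : ∀ q ∈ T, q.1 ∈ s ∧ q.2 ∈ A q.1 ∧ 1 ≤ q.2 ∧ q.2 ≤ ⌊x⌋₊) :
    T.card ≤ ∑ i ∈ s, cntF (A i) x := by
  classical
  rw [Finset.card_eq_sum_card_fiberwise (f := Prod.fst) (t := s) fun q hq => (hT q hq).1]
  refine Finset.sum_le_sum fun i _ => ?_
  rw [cntF, ← Finset.card_image_of_injOn (f := Prod.snd) (s := T.filter fun q => q.1 = i),
    ← Set.ncard_coe_finset]
  · refine Set.ncard_le_ncard (fun a ha => ?_) ((Set.finite_Icc _ _).inter_of_right _)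
    obtain ⟨q, hq, rfl⟩ := Finset.mem_image.1 (Finset.mem_coe.1 ha)
    obtain ⟨hqT, rfl⟩ := Finset.mem_filter.1 hq
    exact (hT q hqT).2
  · intro q hq r hr hqr
    have hq := (Finset.mem_filter.1 (Finset.mem_coe.1 hq)).2
    have hr := (Finset.mem_filter.1 (Finset.mem_coe.1 hr)).2
    exact Prod.ext (hq.trans hr.symm) hqr

theorem primeCounting_le_sum_cntF {h : ℕ} {A : Fin h → Set ℕ} {s : Finset (Fin h)}
    (hs : ∀ p : ℕ, p.Prime → ∃ i ∈ s, p ∈ A i) (x : ℝ) :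
    Nat.primeCounting ⌊x⌋₊ ≤ ∑ i ∈ s, cntF (A i) x := by
  classical
  have : Nonempty (Fin h) := (hs 2 Nat.prime_two).nonempty
  choose! g hgs hgA using hs
  rw [← Nat.primesLE_card_eq_primeCounting,
    ← Finset.card_image_of_injective (f := fun p => (g p, p)) _ fun p q hpq => (Prod.ext_iff.1 hpq).2]
  refine card_le_sum_cntF fun q hq => ?_
  obtain ⟨p, hp, rfl⟩ := Finset.mem_image.1 hq
  obtain ⟨hpN, hp⟩ := Nat.mem_primesLE.1 hp
  exact ⟨hgs p hp, hgA p hp, hp.one_le, hpN⟩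

theorem exists_second_mem_of_not_represented {h : ℕ} {A : Fin h → Set ℕ} (hMC : IsMC h A)
    {i₀ : Fin h} {m p : ℕ} (hm : 1 ≤ m) (hp : p.Prime)
    (hnot : ¬ ∃ f : Fin h → ℕ,
      (∀ j ∈ Finset.univ.erase i₀, f j ∈ A j) ∧ ∏ j ∈ Finset.univ.erase i₀, f j = m) :
    ∃ i d, d * p ∈ A i ∧ 1 ≤ d ∧ d ≤ m ∧ (i, d * p) ≠ (i₀, p) := by
  obtain ⟨f, hfA, hf⟩ := hMC.exists_prod_eq (n := m * p) (Nat.mul_pos hm hp.pos)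
  obtain ⟨i, -, d, hd⟩ := hp.prime.exists_mem_finset_dvd (hf ▸ dvd_mul_left p m : p ∣ ∏ i, f i)
  rw [mul_comm] at hd
  have hrest : d * ∏ j ∈ Finset.univ.erase i, f j = m := by
    refine Nat.eq_of_mul_eq_mul_right hp.pos ?_
    rw [← hf, ← Finset.mul_prod_erase _ _ (Finset.mem_univ i), hd]
    ring
  have hdm : d ∣ m := ⟨_, hrest.symm⟩
  refine ⟨i, d, hd ▸ hfA i, Nat.pos_of_dvd_of_pos hdm hm, Nat.le_of_dvd hm hdm, fun heq => hnot ?_⟩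
  obtain ⟨rfl, hdp⟩ := Prod.ext_iff.1 heq
  have hd1 : d = 1 := Nat.eq_of_mul_eq_mul_right hp.pos (by simpa using hdp)
  exact ⟨f, fun j _ => hfA j, by simpa [hd1] using hrest⟩

theorem primeCounting_add_primeCounting_le {h : ℕ} {A : Fin h → Set ℕ} (hMC : IsMC h A) {K : ℕ}
    (hnot : ∀ i₀ : Fin h, ∃ m, 1 ≤ m ∧ m ≤ K ∧ ¬ ∃ f : Fin h → ℕ,
      (∀ j ∈ Finset.univ.erase i₀, f j ∈ A j) ∧ ∏ j ∈ Finset.univ.erase i₀, f j = m) (x : ℝ) :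
    Nat.primeCounting ⌊x⌋₊ + Nat.primeCounting (⌊x⌋₊ / K) ≤
      ∑ i, cntF (A i) x + Nat.primeCounting K := by
  classical
  have hg : ∀ p : ℕ, p.Prime → ∃ i, p ∈ A i := fun p hp => by
    obtain ⟨f, hfA, hf⟩ := hMC.exists_prod_eq hp.one_le
    obtain ⟨i, -, hi⟩ := hp.exists_mem_eq_of_prod_eq hf
    exact ⟨i, hi ▸ hfA i⟩
  have : Nonempty (Fin h) := (hg 2 Nat.prime_two).nonempty
  choose! g hgA using hg
  have hsecond : ∀ p : ℕ, p.Prime →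
      ∃ q : Fin h × ℕ, q.2 * p ∈ A q.1 ∧ 1 ≤ q.2 ∧ q.2 ≤ K ∧ (q.1, q.2 * p) ≠ (g p, p) := by
    intro p hp
    obtain ⟨m, hm1, hmK, hm⟩ := hnot (g p)
    obtain ⟨i, d, h1, h2, h3, h4⟩ := exists_second_mem_of_not_represented hMC hm1 hp hm
    exact ⟨(i, d), h1, h2, h3.trans hmK, h4⟩
  choose! q hqA hq1 hqK hqne using hsecond
  have hdvd : ∀ {p r : ℕ}, p.Prime → r.Prime → K < p → p ∣ (q r).2 * r → p = r := by
    intro p r hp hr hKp hpr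
    rcases hp.dvd_mul.1 hpr with h1 | h1
    · exact absurd (Nat.le_of_dvd (hq1 r hr) h1) (by have := hqK r hr; omega)
    · exact (Nat.prime_dvd_prime_iff_eq hp hr).1 h1
  set P₂ := Nat.primesLE (⌊x⌋₊ / K) \ Nat.primesLE K with hP₂
  have hP₂mem : ∀ p ∈ P₂, p.Prime ∧ K < p ∧ p ≤ ⌊x⌋₊ / K := by
    intro p hp
    rw [hP₂, Finset.mem_sdiff, Nat.mem_primesLE, Nat.mem_primesLE] at hp
    exact ⟨hp.1.2, by by_contra hle; exact hp.2 ⟨not_lt.1 hle, hp.1.2⟩, hp.1.1⟩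
  set U₁ := (Nat.primesLE ⌊x⌋₊).image fun p => (g p, p)
  set U₂ := P₂.image fun p => ((q p).1, (q p).2 * p)
  have hU₁ : U₁.card = Nat.primeCounting ⌊x⌋₊ := by
    rw [← Nat.primesLE_card_eq_primeCounting]
    exact Finset.card_image_of_injective _ fun p r hpr => (Prod.ext_iff.1 hpr).2
  have hU₂ : U₂.card = P₂.card := by
    refine Finset.card_image_of_injOn fun p hp r hr hpr => ?_
    obtain ⟨hp, hKp, -⟩ := hP₂mem p hp
    obtain ⟨hr, -, -⟩ := hP₂mem r hr
    have hpr' : (q p).2 * p = (q r).2 * r := (Prod.ext_iff.1 hpr).2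
    exact hdvd hp hr hKp (hpr' ▸ dvd_mul_left p _)
  have hdisj : Disjoint U₁ U₂ := by
    refine Finset.disjoint_left.2 fun a ha₁ ha₂ => ?_
    obtain ⟨r, hr, rfl⟩ := Finset.mem_image.1 ha₁
    obtain ⟨p, hp, hpr⟩ := Finset.mem_image.1 ha₂
    obtain ⟨hp, -, -⟩ := hP₂mem p hp
    have hr := (Nat.mem_primesLE.1 hr).2
    have hpr' : (q p).2 * p = r := (Prod.ext_iff.1 hpr).2
    obtain rfl := (Nat.prime_dvd_prime_iff_eq hp hr).1 (hpr' ▸ dvd_mul_left p _)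
    exact hqne p hp hpr
  have hcard : P₂.card + Nat.primeCounting K ≥ Nat.primeCounting (⌊x⌋₊ / K) := by
    rw [← Nat.primesLE_card_eq_primeCounting, ← Nat.primesLE_card_eq_primeCounting]
    have := Finset.le_card_sdiff (Nat.primesLE K) (Nat.primesLE (⌊x⌋₊ / K))
    rw [← hP₂] at this
    omega
  have hle : (U₁ ∪ U₂).card ≤ ∑ i, cntF (A i) x := by
    refine card_le_sum_cntF fun a ha => ⟨Finset.mem_univ _, ?_⟩
    rcases Finset.mem_union.1 ha with ha | ha
    · obtain ⟨p, hp, rfl⟩ := Finset.mem_image.1 ha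
      obtain ⟨hpN, hp⟩ := Nat.mem_primesLE.1 hp
      exact ⟨hgA p hp, hp.one_le, hpN⟩
    · obtain ⟨p, hp, rfl⟩ := Finset.mem_image.1 ha
      obtain ⟨hp, -, hpN⟩ := hP₂mem p hp
      refine ⟨hqA p hp, Nat.mul_pos (hq1 p hp) hp.pos, ?_⟩
      exact (Nat.mul_le_mul (hqK p hp) hpN).trans (Nat.mul_div_le _ _)
  rw [Finset.card_union_of_disjoint hdisj] at hle
  omega

theorem lt_liminf_of_eventually_mul_le {b c : ℝ} (hbc : b < c) {M : ℝ → ℕ}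
    (hM : ∀ᶠ x : ℝ in atTop, c * x ≤ M x * Real.log x) :
    ((b : ℝ) : EReal) <
      Filter.liminf (fun x : ℝ => (((M x : ℝ) * Real.log x / x : ℝ) : EReal)) Filter.atTop := by
  refine lt_of_lt_of_le (EReal.coe_lt_coe_iff.2 hbc) (Filter.le_liminf_of_le (by isBoundedDefault) ?_)
  filter_upwards [hM, eventually_gt_atTop 0] with x hx hx0
  exact EReal.coe_le_coe_iff.2 ((le_div_iff₀ hx0).2 hx)

theorem sum_cntF_le_card_mul_sup {h : ℕ} (A : Fin h → Set ℕ) (s : Finset (Fin h)) (x : ℝ) :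
    ∑ i ∈ s, cntF (A i) x ≤ s.card * Finset.univ.sup fun i => cntF (A i) x := by
  rw [← smul_eq_mul]
  exact Finset.sum_le_card_nsmul _ _ _ fun i _ =>
    Finset.le_sup (f := fun i => cntF (A i) x) (Finset.mem_univ i)

theorem eventually_mul_le_of_primeCounting_le {k : ℕ} {b : ℝ} {M : ℝ → ℕ} (hb : b * k < 1)
    (hM : ∀ x : ℝ, Nat.primeCounting ⌊x⌋₊ ≤ k * M x) :
    ∃ c, b < c ∧ ∀ᶠ x : ℝ in atTop, c * x ≤ M x * Real.log x := by
  have hk : 0 < k := by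
    refine Nat.pos_of_ne_zero fun hk => ?_
    have := hM 2
    simp [hk, show Nat.primeCounting 2 = 1 from by decide] at this
  have hk' : (0 : ℝ) < k := by exact_mod_cast hk
  refine ⟨(1 - (1 - b * k) / 2) / k, (lt_div_iff₀ hk').2 (by linarith), ?_⟩
  filter_upwards [eventually_mul_le_primeCounting_mul_log (ε := (1 - b * k) / 2) (by linarith),
    eventually_ge_atTop 1] with x hx hx1
  have h1 : (Nat.primeCounting ⌊x⌋₊ : ℝ) ≤ k * M x := by exact_mod_cast hM x
  have h2 := mul_le_mul_of_nonneg_right h1 (Real.log_nonneg hx1)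
  rw [div_mul_eq_mul_div, div_le_iff₀ hk']
  linarith

theorem eventually_mul_le_of_primeCounting_add_le {k K : ℕ} (hk : 0 < k) (hK : 0 < K)
    {M : ℝ → ℕ} (hM : ∀ x : ℝ, Nat.primeCounting ⌊x⌋₊ + Nat.primeCounting (⌊x⌋₊ / K) ≤
      k * M x + Nat.primeCounting K) :
    ∃ c, 1 / (k : ℝ) < c ∧ ∀ᶠ x : ℝ in atTop, c * x ≤ M x * Real.log x := by
  have hk' : (0 : ℝ) < k := by exact_mod_cast hk
  have hK' : (1 : ℝ) ≤ K := by exact_mod_cast hK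
  have hK0 : (0 : ℝ) < K := by linarith
  set ε : ℝ := 1 / (4 * K) with hε
  have hε0 : 0 < ε := by positivity
  have hpnt := eventually_mul_le_primeCounting_mul_log hε0
  have hlog : ∀ᶠ x : ℝ in atTop, Nat.primeCounting K * Real.log x ≤ ε * x := by
    have := (Real.isLittleO_log_id_atTop.const_mul_left (Nat.primeCounting K : ℝ)).bound hε0
    filter_upwards [this, eventually_ge_atTop 0] with x hx hx0
    simp only [id, Real.norm_eq_abs, abs_of_nonneg hx0] at hx
    exact (le_abs_self _).trans hx
  refine ⟨(1 + ε) / k, by gcongr; linarith, ?_⟩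
  filter_upwards [hpnt, (tendsto_id.atTop_div_const hK0).eventually hpnt, hlog,
    eventually_ge_atTop 1] with x h1 h2 h3 hx1
  simp only [id, Nat.floor_div_natCast] at h2
  have h4 : Real.log (x / K) ≤ Real.log x :=
    Real.log_le_log (by positivity) (div_le_self (by linarith) hK')
  have h5 : (Nat.primeCounting (⌊x⌋₊ / K) : ℝ) * Real.log (x / K) ≤
      Nat.primeCounting (⌊x⌋₊ / K) * Real.log x := by gcongr
  have h6 : (Nat.primeCounting ⌊x⌋₊ + Nat.primeCounting (⌊x⌋₊ / K) : ℝ) ≤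
      k * M x + Nat.primeCounting K := by exact_mod_cast hM x
  have h7 := mul_le_mul_of_nonneg_right h6 (Real.log_nonneg hx1)
  have h8 : x / K = 4 * ε * x := by rw [hε]; field_simp
  have h9 : ε ≤ 1 / 4 := by
    rw [hε]
    exact one_div_le_one_div_of_le (by norm_num) (by linarith)
  have h10 : 0 ≤ (1 / 4 - ε) * (ε * x) := by
    have : 0 ≤ 1 / 4 - ε := by linarith
    positivity
  replace h2 := h2.trans h5
  rw [h8] at h2
  rw [div_mul_eq_mul_div, div_le_iff₀ hk']
  nlinarith

theorem stmt9 (h : ℕ) (hh : 1 ≤ h) (A : Fin h → Set ℕ) (hA0 : ∀ i, 0 ∉ A i)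
    (hMC : IsMC h A) :
    ((1 / (h : ℝ) : ℝ) : EReal) <
      Filter.liminf (fun x : ℝ =>
        ((((Finset.univ.sup fun i => cntF (A i) x : ℕ) : ℝ) *
          Real.log x / x : ℝ) : EReal)) Filter.atTop := by
  suffices ∃ c, 1 / (h : ℝ) < c ∧
      ∀ᶠ x : ℝ in atTop, c * x ≤ (Finset.univ.sup fun i => cntF (A i) x : ℕ) * Real.log x by
    obtain ⟨c, hc, hev⟩ := this
    exact lt_liminf_of_eventually_mul_le hc hev
  have hh' : (0 : ℝ) < h := by exact_mod_cast hh
  by_cases hred : ∃ i₀ : Fin h, ∀ m, 1 ≤ m → ∃ f : Fin h → ℕ,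
      (∀ j ∈ Finset.univ.erase i₀, f j ∈ A j) ∧ ∏ j ∈ Finset.univ.erase i₀, f j = m
  · obtain ⟨i₀, hi₀⟩ := hred
    refine eventually_mul_le_of_primeCounting_le (k := (Finset.univ.erase i₀).card) ?_ fun x =>
      (primeCounting_le_sum_cntF (fun p hp => ?_) x).trans (sum_cntF_le_card_mul_sup A _ x)
    · rw [one_div, inv_mul_lt_iff₀ hh', mul_one]
      have := Finset.card_erase_lt_of_mem (Finset.mem_univ i₀)
      rw [Finset.card_univ, Fintype.card_fin] at this
      exact_mod_cast this
    · obtain ⟨f, hfA, hf⟩ := hi₀ p hp.one_le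
      obtain ⟨i, hi, rfl⟩ := hp.exists_mem_eq_of_prod_eq hf
      exact ⟨i, hi, hfA i hi⟩
  · push Not at hred
    choose m hm1 hm using hred
    refine eventually_mul_le_of_primeCounting_add_le hh (K := Finset.univ.sup m + 1) (by omega)
      fun x => (primeCounting_add_primeCounting_le hMC (fun i₀ => ⟨m i₀, hm1 i₀, ?_, ?_⟩)
        x).trans ?_
    · exact (Finset.le_sup (Finset.mem_univ i₀)).trans (Nat.le_succ _)
    · push Not
      exact hm i₀
    · have := sum_cntF_le_card_mul_sup A Finset.univ x
      rw [Finset.card_univ, Fintype.card_fin] at this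
      omega
end
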